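/- arXiv:1211.2713 — 4 statements merged into one kernel-verified Lean document; each statement's English description precedes it below -/
import Mathlib

section
/- There exists an absolute constant C > 0 such that for every n × d real matrix A and every ε ∈ (0,1), there exist a natural number m ≤ C · d · (1 + log d) · ε⁻², an m × d real matrix B each of whose rows is a nonnegative scalar multiple of some row of A, such that (1 − ε)‖Ax‖₂ ≤ ‖Bx‖₂ ≤ (1 + ε)‖Ax‖₂ for all vectors x ∈ ℝᵈ. -/
open Matrix BigOperators

/-- The Euclidean (ℓ₂) norm of a vector in ℝᵈ. -/
noncomputable def l2Norm {n : ℕ} (v : Fin n → ℝ) : ℝ := Real.sqrt (∑ i, (v i) ^ 2)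

section Resolvent

variable {ι : Type*} [Fintype ι] [DecidableEq ι]

/-- First-order convexity of `δ ↦ tr (M + δ)⁻¹` at `δ = 0`. -/
theorem trace_inv_sub_le_trace_inv_add_smul_one {M : Matrix ι ι ℝ} {δ : ℝ} (hM : M.PosDef)
    (hZ : (M + δ • (1 : Matrix ι ι ℝ)).PosDef) :
    M⁻¹.trace - δ * (M⁻¹ * M⁻¹).trace ≤ (M + δ • (1 : Matrix ι ι ℝ))⁻¹.trace := by
  obtain ⟨Z, hZdef⟩ : ∃ Z, Z = M + δ • (1 : Matrix ι ι ℝ) := ⟨_, rfl⟩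
  rw [← hZdef] at hZ ⊢
  have hMu : IsUnit M.det := (isUnit_iff_isUnit_det _).1 hM.isUnit
  have hZu : IsUnit Z.det := (isUnit_iff_isUnit_det _).1 hZ.isUnit
  have hpos := (hZ.posSemidef.mul_mul_conjTranspose_same (M⁻¹ - Z⁻¹)).trace_nonneg
  have hH : (M⁻¹ - Z⁻¹)ᴴ = M⁻¹ - Z⁻¹ := (hM.inv.isHermitian.sub hZ.inv.isHermitian)
  have hexp : (M⁻¹ - Z⁻¹) * Z * (M⁻¹ - Z⁻¹) = Z⁻¹ - M⁻¹ + δ • (M⁻¹ * M⁻¹) := by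
    have h1 : (M⁻¹ - Z⁻¹) * Z * (M⁻¹ - Z⁻¹)
        = M⁻¹ * Z * M⁻¹ - M⁻¹ * (Z * Z⁻¹) - (Z⁻¹ * Z) * M⁻¹ + (Z⁻¹ * Z) * Z⁻¹ := by
      noncomm_ring
    rw [h1, mul_nonsing_inv _ hZu, nonsing_inv_mul _ hZu, hZdef, mul_add, add_mul,
      nonsing_inv_mul _ hMu]
    simp only [Matrix.mul_smul, Matrix.smul_mul, mul_one, one_mul]
    abel
  rw [hH, hexp] at hpos
  simp only [trace_add, trace_sub, trace_smul, smul_eq_mul] at hpos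
  linarith

/-- The Sherman–Morrison formula for a symmetric rank-one update of a positive definite matrix. -/
theorem Matrix.PosDef.inv_add_smul_vecMulVec {M : Matrix ι ι ℝ} (hM : M.PosDef) (v : ι → ℝ)
    {c : ℝ} (hc : 1 + c * (v ⬝ᵥ M⁻¹ *ᵥ v) ≠ 0) :
    (M + c • vecMulVec v v)⁻¹ =
      M⁻¹ - (c / (1 + c * (v ⬝ᵥ M⁻¹ *ᵥ v))) • vecMulVec (M⁻¹ *ᵥ v) (M⁻¹ *ᵥ v) := by
  have hMu : IsUnit M.det := (isUnit_iff_isUnit_det _).1 hM.isUnit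
  have hT : M⁻¹ᵀ = M⁻¹ := by
    simpa [conjTranspose_eq_transpose_of_trivial] using hM.inv.isHermitian.eq
  have hvM : v ᵥ* M⁻¹ = M⁻¹ *ᵥ v := by rw [← mulVec_transpose, hT]
  apply inv_eq_right_inv
  rw [add_mul, mul_sub, mul_sub, mul_nonsing_inv _ hMu]
  simp only [Matrix.mul_smul, Matrix.smul_mul, mul_vecMulVec, vecMulVec_mul, mulVec_mulVec,
    mul_nonsing_inv _ hMu, one_mulVec, hvM, smul_mulVec, vecMulVec_mulVec]
  ext i j
  simp [vecMulVec_apply]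
  rw [dotProduct_comm (M⁻¹ *ᵥ v) v]
  field_simp
  ring

theorem Matrix.PosDef.add_smul_vecMulVec {M : Matrix ι ι ℝ} (hM : M.PosDef) (v : ι → ℝ)
    {c : ℝ} (hc : 0 < 1 + c * (v ⬝ᵥ M⁻¹ *ᵥ v)) : (M + c • vecMulVec v v).PosDef := by
  have hrank (u : ι → ℝ) : (vecMulVec u u).PosSemidef := by
    simpa using posSemidef_vecMulVec_self_star u
  rcases le_total 0 c with h | h
  · exact hM.add_posSemidef ((hrank v).smul h)
  · rw [← posDef_inv_iff, hM.inv_add_smul_vecMulVec v hc.ne', sub_eq_add_neg, ← neg_smul]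
    refine hM.inv.add_posSemidef ((hrank _).smul ?_)
    rw [neg_nonneg]
    exact div_nonpos_of_nonpos_of_nonneg h hc.le

theorem Matrix.PosDef.trace_inv_add_smul_vecMulVec {M : Matrix ι ι ℝ} (hM : M.PosDef) (v : ι → ℝ)
    {c : ℝ} (hc : 1 + c * (v ⬝ᵥ M⁻¹ *ᵥ v) ≠ 0) :
    (M + c • vecMulVec v v)⁻¹.trace = M⁻¹.trace -
      c / (1 + c * (v ⬝ᵥ M⁻¹ *ᵥ v)) * (v ⬝ᵥ (M⁻¹ * M⁻¹) *ᵥ v) := by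
  have hT : M⁻¹ᵀ = M⁻¹ := by
    simpa [conjTranspose_eq_transpose_of_trivial] using hM.inv.isHermitian.eq
  rw [hM.inv_add_smul_vecMulVec v hc, trace_sub, trace_smul, trace_vecMulVec, smul_eq_mul,
    ← mulVec_mulVec, dotProduct_mulVec v M⁻¹ (M⁻¹ *ᵥ v), ← mulVec_transpose, hT]

/-- Shifting a positive definite matrix whose inverse has trace at most one. -/
theorem Matrix.PosDef.sub_smul_one_of_trace_inv_le_one {N : Matrix ι ι ℝ} (hN : N.PosDef)
    (htr : N⁻¹.trace ≤ 1) {δ : ℝ} (hδ : δ ≤ 1 / 2) :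
    (N - δ • (1 : Matrix ι ι ℝ)).PosDef ∧
      (N - δ • (1 : Matrix ι ι ℝ))⁻¹.trace ≤ 2 * N⁻¹.trace := by
  have hpos := hN.eigenvalues_pos
  obtain ⟨U, D, hD, hU, hU', hspec⟩ : ∃ (U : Matrix ι ι ℝ) (D : ι → ℝ), (∀ i, 0 < D i) ∧
      U * Uᴴ = 1 ∧ Uᴴ * U = 1 ∧ N = U * diagonal D * Uᴴ := by
    refine ⟨hN.isHermitian.eigenvectorUnitary, hN.isHermitian.eigenvalues, hpos, ?_, ?_, ?_⟩
    · exact Unitary.coe_mul_star_self hN.isHermitian.eigenvectorUnitary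
    · exact Unitary.coe_star_mul_self hN.isHermitian.eigenvectorUnitary
    · conv_lhs => rw [hN.isHermitian.spectral_theorem]
      rfl
  have hshift (x : ℝ) : N - x • (1 : Matrix ι ι ℝ) = U * diagonal (fun i => D i - x) * Uᴴ := by
    have : diagonal (fun i => D i - x) = diagonal D - x • (1 : Matrix ι ι ℝ) := by
      ext i j; by_cases h : i = j <;> simp [h, diagonal]
    rw [this, mul_sub, sub_mul, ← hspec]
    simp [hU, -conjTranspose_eq_transpose_of_trivial]
  have htrace (x : ℝ) (hx : ∀ i, D i - x ≠ 0) :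
      (N - x • (1 : Matrix ι ι ℝ))⁻¹.trace = ∑ i, (D i - x)⁻¹ := by
    have hinv : (N - x • (1 : Matrix ι ι ℝ))⁻¹ = U * diagonal (fun i => (D i - x)⁻¹) * Uᴴ := by
      apply inv_eq_right_inv
      rw [hshift]
      calc _ = U * (diagonal (fun i => D i - x) * (Uᴴ * U) * diagonal (fun i => (D i - x)⁻¹)) * Uᴴ
            := by simp only [Matrix.mul_assoc]
        _ = 1 := by simp [hU', diagonal_mul_diagonal, hx, hU, -conjTranspose_eq_transpose_of_trivial]
    rw [hinv, trace_mul_comm, ← Matrix.mul_assoc, hU', one_mul, trace_diagonal]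
  have htr0 : N⁻¹.trace = ∑ i, (D i)⁻¹ := by
    simpa using htrace 0 (fun i => by simpa using (hD i).ne')
  have hD1 (i : ι) : 1 ≤ D i := by
    have h : (D i)⁻¹ ≤ 1 := by
      refine le_trans ?_ (htr0 ▸ htr)
      exact Finset.single_le_sum (f := fun i => (D i)⁻¹)
        (fun j _ => (inv_pos.2 (hD j)).le) (Finset.mem_univ i)
    exact (inv_le_one₀ (hD i)).1 h
  have hDδ (i : ι) : 0 < D i - δ := by linarith [hD1 i]
  constructor
  · rw [hshift]
    refine (PosDef.diagonal hDδ).mul_mul_conjTranspose_same ?_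
    refine Function.LeftInverse.injective (g := fun y => y ᵥ* Uᴴ) fun y => ?_
    simp [vecMul_vecMul, hU, -conjTranspose_eq_transpose_of_trivial]
  · rw [htrace δ (fun i => (hDδ i).ne'), htr0, Finset.mul_sum]
    refine Finset.sum_le_sum fun i _ => ?_
    rw [inv_le_comm₀ (hDδ i) (by have := hD i; positivity), mul_inv, inv_inv]
    linarith [hD1 i]


/-- If the rank-one matrices `v i (v i)ᵀ` sum to the identity, some multiple of one of them moves
the two resolvent traces by at most the average first-order amount. -/
theorem exists_rank_one_update_trace_inv_le [Nonempty ι] {α : Type*} [Fintype α] {v : α → ι → ℝ}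
    (hv : ∑ i, vecMulVec (v i) (v i) = 1) {M N : Matrix ι ι ℝ} (hM : M.PosDef) (hN : N.PosDef)
    {s : ℝ} (hs : 0 < s) (hs' : 2 * s < 1) (htr : M⁻¹.trace + N⁻¹.trace ≤ 2) :
    ∃ (i : α) (t : ℝ), 0 ≤ t ∧ (M + (-t) • vecMulVec (v i) (v i)).PosDef ∧
      (M + (-t) • vecMulVec (v i) (v i))⁻¹.trace + (N + t • vecMulVec (v i) (v i))⁻¹.trace ≤
        M⁻¹.trace + s / (1 - 2 * s) * (M⁻¹ * M⁻¹).trace +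
          (N⁻¹.trace - s / (1 + 2 * s) * (N⁻¹ * N⁻¹).trace) := by
  have hsum (P : Matrix ι ι ℝ) : ∑ i, v i ⬝ᵥ P *ᵥ v i = P.trace := by
    calc _ = ∑ i, (P * vecMulVec (v i) (v i)).trace := by
          simp only [mul_vecMulVec, trace_vecMulVec, dotProduct_comm]
      _ = P.trace := by rw [← trace_sum, ← Matrix.mul_sum, hv, mul_one]
  have hquad {P : Matrix ι ι ℝ} (hP : P.PosSemidef) (x : ι → ℝ) : 0 ≤ x ⬝ᵥ P *ᵥ x := by
    simpa using hP.dotProduct_mulVec_nonneg x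
  have hsq {P : Matrix ι ι ℝ} (hP : P.PosDef) : (P⁻¹ * P⁻¹).PosSemidef := by
    have := posSemidef_conjTranspose_mul_self P⁻¹
    rwa [hP.inv.isHermitian.eq] at this
  set a : α → ℝ := fun i => v i ⬝ᵥ M⁻¹ *ᵥ v i with ha
  set b : α → ℝ := fun i => v i ⬝ᵥ N⁻¹ *ᵥ v i with hb
  set p : α → ℝ := fun i => v i ⬝ᵥ (M⁻¹ * M⁻¹) *ᵥ v i with hp
  set q : α → ℝ := fun i => v i ⬝ᵥ (N⁻¹ * N⁻¹) *ᵥ v i with hq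
  have ha0 (i : α) : 0 ≤ a i := hquad hM.inv.posSemidef _
  have hb0 (i : α) : 0 ≤ b i := hquad hN.inv.posSemidef _
  have hp0 (i : α) : 0 ≤ p i := hquad (hsq hM) _
  have hq0 (i : α) : 0 ≤ q i := hquad (hsq hN) _
  set τ : ℝ := M⁻¹.trace + N⁻¹.trace with hτ
  have hτ0 : 0 < τ := add_pos hM.inv.trace_pos hN.inv.trace_pos
  have hτsum : ∑ i, (a i + b i) = τ := by
    rw [Finset.sum_add_distrib, hsum, hsum]
  set f : α → ℝ := fun i => p i / (1 - 2 * s) - q i / (1 + 2 * s) with hf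
  set F : ℝ := (M⁻¹ * M⁻¹).trace / (1 - 2 * s) - (N⁻¹ * N⁻¹).trace / (1 + 2 * s) with hF
  have hFsum : ∑ i, f i = F := by
    rw [Finset.sum_sub_distrib, ← Finset.sum_div, ← Finset.sum_div, hsum, hsum]
  have hv0 (i : α) (h : a i + b i = 0) : v i = 0 := by
    by_contra hne
    have h1 : 0 < a i := by simpa using hM.inv.dotProduct_mulVec_pos hne
    linarith [hb0 i]
  obtain ⟨i, hi, hfi⟩ : ∃ i, 0 < a i + b i ∧ τ * f i ≤ (a i + b i) * F := by
    by_contra! hcon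
    have hle (i : α) : (a i + b i) * F ≤ τ * f i := by
      rcases (add_nonneg (ha0 i) (hb0 i)).eq_or_lt with h | h
      · have := hv0 i h.symm
        simp [ha, hb, hf, hp, hq, this]
      · exact (hcon i h).le
    obtain ⟨j, -, hj⟩ : ∃ j ∈ Finset.univ, 0 < a j + b j := by
      apply Finset.exists_lt_of_sum_lt
      simpa [hτsum] using hτ0
    have := Finset.sum_lt_sum (fun i _ => hle i) ⟨j, Finset.mem_univ j, hcon j hj⟩
    rw [← Finset.sum_mul, ← Finset.mul_sum, hτsum, hFsum] at this
    exact lt_irrefl _ this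
  obtain ⟨t, ht⟩ : ∃ t, t = s * τ / (a i + b i) := ⟨_, rfl⟩
  have ht0 : 0 ≤ t := by rw [ht]; positivity
  have htab : t * a i + t * b i = s * τ := by rw [ht]; field_simp
  have hta : t * a i ≤ 2 * s := by nlinarith [mul_nonneg ht0 (hb0 i)]
  have htb : t * b i ≤ 2 * s := by nlinarith [mul_nonneg ht0 (ha0 i)]
  have htf : t * f i ≤ s * F := by
    rw [ht, div_mul_eq_mul_div, div_le_iff₀ hi]
    nlinarith
  have hca : 0 < 1 + -t * (v i ⬝ᵥ M⁻¹ *ᵥ v i) := by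
    change 0 < 1 + -t * a i
    linarith
  have hcb : 0 < 1 + t * (v i ⬝ᵥ N⁻¹ *ᵥ v i) := by
    change 0 < 1 + t * b i
    linarith [mul_nonneg ht0 (hb0 i)]
  refine ⟨i, t, ht0, hM.add_smul_vecMulVec _ hca, ?_⟩
  rw [hM.trace_inv_add_smul_vecMulVec _ hca.ne', hN.trace_inv_add_smul_vecMulVec _ hcb.ne']
  change M⁻¹.trace - -t / (1 + -t * a i) * p i + (N⁻¹.trace - t / (1 + t * b i) * q i) ≤ _
  have h1 : t / (1 + -t * a i) * p i ≤ t / (1 - 2 * s) * p i := by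
    refine mul_le_mul_of_nonneg_right (div_le_div_of_nonneg_left ht0 (by linarith) ?_) (hp0 i)
    linarith
  have h2 : t / (1 + 2 * s) * q i ≤ t / (1 + t * b i) * q i := by
    refine mul_le_mul_of_nonneg_right (div_le_div_of_nonneg_left ht0 hcb ?_) (hq0 i)
    linarith
  have h3 : t * f i = t / (1 - 2 * s) * p i - t / (1 + 2 * s) * q i := by
    simp only [hf]; ring
  have h4 : s * F = s / (1 - 2 * s) * (M⁻¹ * M⁻¹).trace - s / (1 + 2 * s) * (N⁻¹ * N⁻¹).trace := by
    rw [hF]; ring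
  have h5 : -t / (1 + -t * a i) * p i = -(t / (1 + -t * a i) * p i) := by ring
  linarith

/-- One step of the barrier argument: a rank-one update that lets both barriers advance without
increasing the potential. -/
theorem exists_barrier_step [Nonempty ι] {α : Type*} [Fintype α] {v : α → ι → ℝ}
    (hv : ∑ i, vecMulVec (v i) (v i) = 1) {A : Matrix ι ι ℝ} {u l s : ℝ} (hs : 0 < s)
    (hs' : 2 * s < 1) (hu : (u • (1 : Matrix ι ι ℝ) - A).PosDef)
    (hl : (A - l • (1 : Matrix ι ι ℝ)).PosDef)
    (htr : (u • (1 : Matrix ι ι ℝ) - A)⁻¹.trace + (A - l • (1 : Matrix ι ι ℝ))⁻¹.trace ≤ 1) :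
    ∃ (i : α) (t : ℝ), 0 ≤ t ∧
      ((u + s / (1 - 2 * s)) • (1 : Matrix ι ι ℝ) - (A + t • vecMulVec (v i) (v i))).PosDef ∧
      (A + t • vecMulVec (v i) (v i) - (l + s / (1 + 2 * s)) • (1 : Matrix ι ι ℝ)).PosDef ∧
      ((u + s / (1 - 2 * s)) • (1 : Matrix ι ι ℝ) - (A + t • vecMulVec (v i) (v i)))⁻¹.trace +
        (A + t • vecMulVec (v i) (v i) - (l + s / (1 + 2 * s)) • (1 : Matrix ι ι ℝ))⁻¹.trace
          ≤ 1 := by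
  obtain ⟨δ, hδ⟩ : ∃ δ, δ = s / (1 - 2 * s) := ⟨_, rfl⟩
  obtain ⟨η, hη⟩ : ∃ η, η = s / (1 + 2 * s) := ⟨_, rfl⟩
  have hδ0 : 0 ≤ δ := by rw [hδ]; exact div_nonneg hs.le (by linarith)
  have hη' : η ≤ 1 / 2 := by rw [hη, div_le_iff₀ (by linarith)]; linarith
  obtain ⟨M₀, hM₀⟩ : ∃ M, M = u • (1 : Matrix ι ι ℝ) - A := ⟨_, rfl⟩
  obtain ⟨N₀, hN₀⟩ : ∃ N, N = A - l • (1 : Matrix ι ι ℝ) := ⟨_, rfl⟩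
  rw [← hM₀, ← hN₀] at htr
  rw [← hM₀] at hu
  rw [← hN₀] at hl
  have htrM₀ := hu.inv.posSemidef.trace_nonneg
  have htrN₀ := hl.inv.posSemidef.trace_nonneg
  have hM : (M₀ + δ • (1 : Matrix ι ι ℝ)).PosDef :=
    hu.add_posSemidef (PosSemidef.one.smul hδ0)
  obtain ⟨hN, hNtr⟩ := hl.sub_smul_one_of_trace_inv_le_one (by linarith) hη'
  obtain ⟨M, hMdef⟩ : ∃ M, M = M₀ + δ • (1 : Matrix ι ι ℝ) := ⟨_, rfl⟩
  obtain ⟨N, hNdef⟩ : ∃ N, N = N₀ - η • (1 : Matrix ι ι ℝ) := ⟨_, rfl⟩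
  rw [← hMdef] at hM
  rw [← hNdef] at hN hNtr
  have hM₀' : M + (-δ) • (1 : Matrix ι ι ℝ) = M₀ := by rw [hMdef]; module
  have hN₀' : N + η • (1 : Matrix ι ι ℝ) = N₀ := by rw [hNdef]; module
  have hconvM := trace_inv_sub_le_trace_inv_add_smul_one (δ := -δ) hM (by rwa [hM₀'])
  have hconvN := trace_inv_sub_le_trace_inv_add_smul_one (δ := η) hN (by rwa [hN₀'])
  rw [hM₀'] at hconvM
  rw [hN₀'] at hconvN
  have hMsq : 0 ≤ (M⁻¹ * M⁻¹).trace := by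
    have := (posSemidef_conjTranspose_mul_self M⁻¹).trace_nonneg
    rwa [hM.inv.isHermitian.eq] at this
  obtain ⟨i, t, ht, hpos, hle⟩ := exists_rank_one_update_trace_inv_le hv hM hN hs hs'
    (by nlinarith [mul_nonneg hδ0 hMsq])
  rw [← hδ, ← hη] at hle ⊢
  have e1 : (u + δ) • (1 : Matrix ι ι ℝ) - (A + t • vecMulVec (v i) (v i)) =
      M + (-t) • vecMulVec (v i) (v i) := by rw [hMdef, hM₀]; module
  have e2 : A + t • vecMulVec (v i) (v i) - (l + η) • (1 : Matrix ι ι ℝ) =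
      N + t • vecMulVec (v i) (v i) := by rw [hNdef, hN₀]; module
  refine ⟨i, t, ht, ?_⟩
  rw [e1, e2]
  refine ⟨hpos, hN.add_posSemidef (PosSemidef.smul ?_ ht), by linarith⟩
  simpa using posSemidef_vecMulVec_self_star (v i)

/-- Iterating the barrier step. -/
theorem exists_barrier_sum [Nonempty ι] {α : Type*} [Fintype α] {v : α → ι → ℝ}
    (hv : ∑ i, vecMulVec (v i) (v i) = 1) {s : ℝ} (hs : 0 < s) (hs' : 2 * s < 1) (T : ℕ) :
    ∃ (σ : Fin T → α) (t : Fin T → ℝ), (∀ k, 0 ≤ t k) ∧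
      ((2 * Fintype.card ι + T * (s / (1 - 2 * s))) • (1 : Matrix ι ι ℝ) -
        ∑ k, t k • vecMulVec (v (σ k)) (v (σ k))).PosDef ∧
      (∑ k, t k • vecMulVec (v (σ k)) (v (σ k)) -
        (-(2 * Fintype.card ι) + T * (s / (1 + 2 * s))) • (1 : Matrix ι ι ℝ)).PosDef ∧
      ((2 * Fintype.card ι + T * (s / (1 - 2 * s))) • (1 : Matrix ι ι ℝ) -
        ∑ k, t k • vecMulVec (v (σ k)) (v (σ k)))⁻¹.trace +
      (∑ k, t k • vecMulVec (v (σ k)) (v (σ k)) -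
        (-(2 * Fintype.card ι) + T * (s / (1 + 2 * s))) • (1 : Matrix ι ι ℝ))⁻¹.trace ≤ 1 := by
  induction T with
  | zero =>
    have hr : (0 : ℝ) < Fintype.card ι := by exact_mod_cast Fintype.card_pos
    have hpos : ((2 * Fintype.card ι : ℝ) • (1 : Matrix ι ι ℝ)).PosDef :=
      PosDef.one.smul (by positivity)
    have hinv : ((2 * Fintype.card ι : ℝ) • (1 : Matrix ι ι ℝ))⁻¹.trace = 1 / 2 := by
      have : ((2 * Fintype.card ι : ℝ) • (1 : Matrix ι ι ℝ))⁻¹ =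
          (2 * Fintype.card ι : ℝ)⁻¹ • (1 : Matrix ι ι ℝ) := by
        apply inv_eq_right_inv
        rw [smul_mul_smul_comm, mul_one, mul_inv_cancel₀ (by positivity), one_smul]
      rw [this, trace_smul, trace_one, smul_eq_mul]
      field_simp
    refine ⟨Fin.elim0, Fin.elim0, fun k => k.elim0, ?_, ?_, ?_⟩
    · simpa using hpos
    · simpa using hpos
    · simp only [Finset.univ_eq_empty, Finset.sum_empty, CharP.cast_eq_zero, zero_mul, add_zero,
        sub_zero, zero_sub, neg_smul, neg_neg, hinv]
      norm_num
  | succ T ih =>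
    obtain ⟨σ, t, ht, hu, hl, htr⟩ := ih
    obtain ⟨i, x, hx, hu', hl', htr'⟩ := exists_barrier_step hv hs hs' hu hl htr
    have hsum : ∑ k : Fin (T + 1), (Fin.snoc t x : Fin (T + 1) → ℝ) k •
          vecMulVec (v ((Fin.snoc σ i : Fin (T + 1) → α) k))
            (v ((Fin.snoc σ i : Fin (T + 1) → α) k)) =
        ∑ k, t k • vecMulVec (v (σ k)) (v (σ k)) + x • vecMulVec (v i) (v i) := by
      simp [Fin.sum_univ_castSucc]
    have hcu : 2 * (Fintype.card ι : ℝ) + ((T + 1 : ℕ) : ℝ) * (s / (1 - 2 * s)) =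
        2 * Fintype.card ι + T * (s / (1 - 2 * s)) + s / (1 - 2 * s) := by
      push_cast; ring
    have hcl : -(2 * (Fintype.card ι : ℝ)) + ((T + 1 : ℕ) : ℝ) * (s / (1 + 2 * s)) =
        -(2 * Fintype.card ι) + T * (s / (1 + 2 * s)) + s / (1 + 2 * s) := by
      push_cast; ring
    refine ⟨Fin.snoc σ i, Fin.snoc t x, ?_, ?_⟩
    · intro k
      refine Fin.lastCases ?_ (fun k => ?_) k
      · simpa using hx
      · simpa using ht k
    · rw [hsum, hcu, hcl]
      exact ⟨hu', hl', htr'⟩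

end Resolvent

/-- Weighted row sampling for a matrix with orthonormal columns. -/
theorem exists_weighted_rows_of_transpose_mul_self_eq_one {α : Type*} [Fintype α] {r : ℕ}
    {U : Matrix α (Fin r) ℝ} (hU : Uᵀ * U = 1) {ε : ℝ} (hε : 0 < ε) (hε' : ε < 1) :
    ∃ (m : ℕ) (σ : Fin m → α) (t : Fin m → ℝ), (m : ℝ) ≤ 65 * r / ε ^ 2 ∧ (∀ k, 0 ≤ t k) ∧
      ∀ y : Fin r → ℝ, (1 - ε) ^ 2 * (y ⬝ᵥ y) ≤ ∑ k, t k * (U (σ k) ⬝ᵥ y) ^ 2 ∧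
        ∑ k, t k * (U (σ k) ⬝ᵥ y) ^ 2 ≤ (1 + ε) ^ 2 * (y ⬝ᵥ y) := by
  rcases Nat.eq_zero_or_pos r with rfl | hr
  · exact ⟨0, Fin.elim0, Fin.elim0, by simp, fun k => k.elim0, fun y => by simp⟩
  have : Nonempty (Fin r) := ⟨⟨0, hr⟩⟩
  have hr1 : (1 : ℝ) ≤ r := by exact_mod_cast hr
  have hv : ∑ i, vecMulVec (U i) (U i) = 1 := by
    rw [← hU]
    ext j k
    simp [Matrix.sum_apply, vecMulVec_apply, Matrix.mul_apply]
  obtain ⟨s, hs⟩ : ∃ s, s = ε / 8 := ⟨_, rfl⟩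
  have hs0 : 0 < s := by rw [hs]; positivity
  obtain ⟨T, hT⟩ : ∃ T, T = ⌈64 * r / ε ^ 2⌉₊ := ⟨_, rfl⟩
  have hTge : 64 * r / ε ^ 2 ≤ T := hT ▸ Nat.le_ceil _
  have hTle : (T : ℝ) ≤ 65 * r / ε ^ 2 := by
    have h1 : (T : ℝ) < 64 * r / ε ^ 2 + 1 := hT ▸ Nat.ceil_lt_add_one (by positivity)
    have h2 : 1 ≤ r / ε ^ 2 := by
      rw [le_div_iff₀ (by positivity)]
      nlinarith
    have h3 : 65 * r / ε ^ 2 = 64 * r / ε ^ 2 + r / ε ^ 2 := by ring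
    linarith
  have hT0 : (0 : ℝ) < T := lt_of_lt_of_le (by positivity) hTge
  have hTr : 2 * r ≤ ε / 4 * (T * s) := by
    rw [div_le_iff₀ (by positivity)] at hTge
    rw [hs]
    linarith
  obtain ⟨σ, t, ht, hu, hl, -⟩ := exists_barrier_sum hv hs0 (by linarith) T
  rw [Fintype.card_fin] at hu hl
  refine ⟨T, σ, fun k => t k / (T * s), hTle, fun k => by have := ht k; positivity, fun y => ?_⟩
  have hquad : y ⬝ᵥ (∑ k, t k • vecMulVec (U (σ k)) (U (σ k))) *ᵥ y =
      ∑ k, t k * (U (σ k) ⬝ᵥ y) ^ 2 := by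
    simp only [sum_mulVec, dotProduct_sum, smul_mulVec, vecMulVec_mulVec, dotProduct_smul]
    refine Finset.sum_congr rfl fun k _ => ?_
    simp only [dotProduct_comm y, op_smul_eq_smul, smul_eq_mul]
    ring
  have hsum : ∑ k, t k / (T * s) * (U (σ k) ⬝ᵥ y) ^ 2 =
      (∑ k, t k * (U (σ k) ⬝ᵥ y) ^ 2) / (T * s) := by
    rw [Finset.sum_div]
    exact Finset.sum_congr rfl fun k _ => by ring
  have hy : 0 ≤ y ⬝ᵥ y := by simpa using dotProduct_star_self_nonneg y
  have hu' := hu.posSemidef.dotProduct_mulVec_nonneg y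
  have hl' := hl.posSemidef.dotProduct_mulVec_nonneg y
  simp only [star_trivial, sub_mulVec, smul_mulVec, one_mulVec, dotProduct_sub, dotProduct_smul,
    smul_eq_mul, hquad] at hu' hl'
  have hTs : 0 < T * s := by positivity
  rw [hsum, le_div_iff₀ hTs, div_le_iff₀ hTs]
  constructor
  · have h1 : (1 - ε / 4) * s ≤ s / (1 + 2 * s) := by
      rw [le_div_iff₀ (by positivity), hs]
      nlinarith [pow_pos hε 3]
    have h2 : (1 - ε) ^ 2 * (T * s) ≤ -(2 * r) + T * (s / (1 + 2 * s)) := by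
      have := mul_le_mul_of_nonneg_left h1 hT0.le
      have h3 : (1 - ε) ^ 2 ≤ 1 - ε / 2 := by nlinarith
      have := mul_le_mul_of_nonneg_right h3 hTs.le
      linarith
    have := mul_le_mul_of_nonneg_right h2 hy
    linarith
  · have h1 : s / (1 - 2 * s) ≤ (1 + ε / 2) * s := by
      rw [div_le_iff₀ (by linarith), hs]
      nlinarith [pow_pos hε 2, mul_pos (pow_pos hε 2) (sub_pos.2 hε')]
    have h2 : 2 * r + T * (s / (1 - 2 * s)) ≤ (1 + ε) ^ 2 * (T * s) := by
      have := mul_le_mul_of_nonneg_left h1 hT0.le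
      have h3 : 1 + 3 * ε / 4 ≤ (1 + ε) ^ 2 := by nlinarith
      have := mul_le_mul_of_nonneg_right h3 hTs.le
      linarith
    have := mul_le_mul_of_nonneg_right h2 hy
    linarith

/-- Every matrix factors through a matrix with orthonormal columns. -/
theorem exists_orthonormal_columns_factorization {n d : ℕ} (A : Matrix (Fin n) (Fin d) ℝ) :
    ∃ (r : ℕ) (U : Matrix (Fin n) (Fin r) ℝ) (R : Matrix (Fin r) (Fin d) ℝ),
      r ≤ d ∧ Uᵀ * U = 1 ∧ A = U * R := by
  let a : Fin d → EuclideanSpace ℝ (Fin n) := fun j => WithLp.toLp 2 (A.col j)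
  let W := Submodule.span ℝ (Set.range a)
  let b := stdOrthonormalBasis ℝ W
  let a' : Fin d → W := fun j => ⟨a j, Submodule.subset_span ⟨j, rfl⟩⟩
  refine ⟨Module.finrank ℝ W, Matrix.of fun i k => (b k : EuclideanSpace ℝ (Fin n)) i,
    Matrix.of fun k j => b.repr (a' j) k, ?_, ?_, ?_⟩
  · exact (finrank_range_le_card (R := ℝ) a).trans_eq (Fintype.card_fin d)
  · ext k l
    have h := orthonormal_iff_ite.1 b.orthonormal l k
    rw [Submodule.coe_inner, PiLp.inner_apply] at h
    simp only [Matrix.mul_apply, transpose_apply, of_apply, one_apply]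
    simp only [RCLike.inner_apply, conj_trivial] at h
    rw [h]
    simp [eq_comm]
  · ext i j
    have h := congrArg (fun w : W => (w : EuclideanSpace ℝ (Fin n)) i) (b.sum_repr (a' j))
    simp only [Submodule.coe_sum, Submodule.coe_smul, WithLp.ofLp_sum, WithLp.ofLp_smul,
      Finset.sum_apply, Pi.smul_apply, smul_eq_mul] at h
    simp only [Matrix.mul_apply, of_apply]
    rw [show A i j = (a' j : EuclideanSpace ℝ (Fin n)) i from rfl, ← h]
    exact Finset.sum_congr rfl fun k _ => mul_comm _ _

/-- There exists an absolute constant `C > 0` such that for every `n × d` real matrix `A`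
and every `ε ∈ (0,1)`, there exist `m ≤ C · d · (1 + log d) · ε⁻²` and an `m × d` matrix `B`,
each of whose rows is a nonnegative scalar multiple of some row of `A`, with
`(1 − ε)‖Ax‖₂ ≤ ‖Bx‖₂ ≤ (1 + ε)‖Ax‖₂` for all `x`. -/
theorem l2_row_sampling :
    ∃ C : ℝ, 0 < C ∧
      ∀ (n d : ℕ) (A : Matrix (Fin n) (Fin d) ℝ) (ε : ℝ), 0 < ε → ε < 1 →
        ∃ (m : ℕ) (B : Matrix (Fin m) (Fin d) ℝ) (σ : Fin m → Fin n) (c : Fin m → ℝ),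
          (m : ℝ) ≤ C * d * (1 + Real.log d) / ε ^ 2 ∧
          (∀ i, 0 ≤ c i) ∧
          (∀ i j, B i j = c i * A (σ i) j) ∧
          (∀ x : Fin d → ℝ,
            (1 - ε) * l2Norm (A.mulVec x) ≤ l2Norm (B.mulVec x) ∧
            l2Norm (B.mulVec x) ≤ (1 + ε) * l2Norm (A.mulVec x)) := by
  refine ⟨65, by norm_num, fun n d A ε hε hε' => ?_⟩
  obtain ⟨r, U, R, hrd, hU, rfl⟩ := exists_orthonormal_columns_factorization A
  obtain ⟨m, σ, t, hm, ht, hbound⟩ :=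
    exists_weighted_rows_of_transpose_mul_self_eq_one hU hε hε'
  refine ⟨m, Matrix.of fun k j => √(t k) * (U * R) (σ k) j, σ, fun k => √(t k), ?_,
    fun k => Real.sqrt_nonneg _, fun k j => rfl, fun x => ?_⟩
  · refine hm.trans ?_
    have hrd' : (r : ℝ) ≤ d := by exact_mod_cast hrd
    have hlog : 0 ≤ Real.log d := Real.log_natCast_nonneg d
    have hdlog : 0 ≤ (d : ℝ) * Real.log d := by positivity
    refine div_le_div_of_nonneg_right ?_ (sq_nonneg ε)
    linarith
  · have hA : ∑ i, ((U * R) *ᵥ x) i ^ 2 = (R *ᵥ x) ⬝ᵥ (R *ᵥ x) := by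
      calc _ = (U *ᵥ (R *ᵥ x)) ⬝ᵥ (U *ᵥ (R *ᵥ x)) := by
            simp only [← mulVec_mulVec, dotProduct, sq]
        _ = _ := by
            rw [dotProduct_mulVec, ← mulVec_transpose, mulVec_mulVec, hU, one_mulVec]
    have hB : ∑ k, ((Matrix.of fun k j => √(t k) * (U * R) (σ k) j) *ᵥ x) k ^ 2 =
        ∑ k, t k * (U (σ k) ⬝ᵥ (R *ᵥ x)) ^ 2 := by
      refine Finset.sum_congr rfl fun k _ => ?_
      have : ((Matrix.of fun k j => √(t k) * (U * R) (σ k) j) *ᵥ x) k =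
          √(t k) * (U *ᵥ (R *ᵥ x)) (σ k) := by
        rw [mulVec_mulVec]
        simp only [mulVec, dotProduct, of_apply, Finset.mul_sum, mul_assoc]
      rw [this, mul_pow, Real.sq_sqrt (ht k)]
      rfl
    obtain ⟨hlow, hupp⟩ := hbound (R *ᵥ x)
    simp only [l2Norm]
    rw [hA, hB]
    constructor
    · rw [← Real.sqrt_sq (sub_pos.2 hε').le, ← Real.sqrt_mul (sq_nonneg _)]
      exact Real.sqrt_le_sqrt hlow
    · rw [← Real.sqrt_sq (by linarith : 0 ≤ 1 + ε), ← Real.sqrt_mul (sq_nonneg _)]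
      exact Real.sqrt_le_sqrt hupp
end

section
/- For every θ > 0 and every ε ∈ (0,1) there exists a constant C = C(θ, ε) > 0 such that for every n × d real matrix A there exist a natural number m ≤ C · d^{4√2 − 2 + θ} and an m × d real matrix B each of whose rows is a nonnegative scalar multiple of some row of A, such that (1 − ε)‖Ax‖₁ ≤ ‖Bx‖₁ ≤ (1 + ε)‖Ax‖₁ for all vectors x ∈ ℝᵈ. -/
open Matrix BigOperators

/-- The ℓ₁ norm of a vector. -/
noncomputable def l1Norm {n : ℕ} (v : Fin n → ℝ) : ℝ := ∑ i, |v i|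

/-- **Auerbach's lemma**: a finite-dimensional real normed space has a basis of vectors of norm at
most one whose coordinate functionals also have norm at most one. -/
theorem exists_auerbach_basis (E : Type*) [NormedAddCommGroup E] [NormedSpace ℝ E]
    [FiniteDimensional ℝ E] :
    ∃ b : Module.Basis (Fin (Module.finrank ℝ E)) ℝ E,
      (∀ j, ‖b j‖ ≤ 1) ∧ ∀ x j, |b.repr x j| ≤ ‖x‖ := by
  have : ProperSpace E := FiniteDimensional.proper ℝ E
  set b₀ := Module.finBasis ℝ E
  have hcont : Continuous fun v : Fin (Module.finrank ℝ E) → E => |b₀.det v| := by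
    refine Continuous.abs ?_
    change Continuous fun v => (b₀.toMatrix v).det
    refine Continuous.matrix_det (continuous_matrix fun i j => ?_)
    exact (LinearMap.continuous_of_finiteDimensional (b₀.coord i)).comp (continuous_apply j)
  have hcompact : IsCompact (Set.pi Set.univ
      fun _ : Fin (Module.finrank ℝ E) => Metric.closedBall (0 : E) 1) :=
    isCompact_univ_pi fun _ => isCompact_closedBall 0 1
  obtain ⟨v, hv, hmax⟩ := hcompact.exists_isMaxOn ⟨0, by simp⟩ hcont.continuousOn
  have hv' : ∀ j, ‖v j‖ ≤ 1 := fun j => by simpa using hv j (Set.mem_univ j)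
  have hpos : 0 < |b₀.det v| := by
    have hw : ∀ j, ‖b₀ j‖⁻¹ ≠ 0 := fun j => inv_ne_zero (norm_ne_zero_iff.2 (b₀.ne_zero j))
    have hmem : (fun j => ‖b₀ j‖⁻¹ • b₀ j) ∈ Set.pi Set.univ
        fun _ : Fin (Module.finrank ℝ E) => Metric.closedBall (0 : E) 1 := by
      intro j _
      have := norm_ne_zero_iff.2 (b₀.ne_zero j)
      simp [norm_smul, this]
    refine lt_of_lt_of_le ?_ (hmax hmem)
    simp only [AlternatingMap.map_smul_univ, Module.Basis.det_self, smul_eq_mul, mul_one]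
    exact abs_pos.2 (Finset.prod_ne_zero_iff.2 fun j _ => hw j)
  obtain ⟨hli, hsp⟩ := b₀.is_basis_iff_det.2 (isUnit_iff_ne_zero.2 (abs_pos.1 hpos))
  refine ⟨Module.Basis.mk hli hsp.ge, by simpa using hv', fun x j => ?_⟩
  rcases eq_or_ne x 0 with rfl | hx
  · rw [map_zero]
    simp
  have hx' : 0 < ‖x‖ := norm_pos_iff.2 hx
  have hmem : Function.update v j (‖x‖⁻¹ • x) ∈ Set.pi Set.univ
      fun _ : Fin (Module.finrank ℝ E) => Metric.closedBall (0 : E) 1 := by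
    intro k _
    rcases eq_or_ne k j with rfl | hk
    · simp [norm_smul, hx'.ne']
    · simpa [hk] using hv' k
  have hle : |b₀.det (Function.update v j (‖x‖⁻¹ • x))| ≤ |b₀.det v| := hmax hmem
  have hcoord := congrArg (fun f => f x) (b₀.det_smul_mk_coord_eq_det_update hli hsp.ge j)
  simp only [LinearMap.smul_apply, smul_eq_mul, MultilinearMap.toLinearMap_apply,
    AlternatingMap.coe_multilinearMap, Module.Basis.coord_apply] at hcoord
  rw [AlternatingMap.map_update_smul, smul_eq_mul, ← hcoord, abs_mul, abs_mul, abs_inv,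
    abs_of_pos hx', inv_mul_le_iff₀ hx', mul_comm] at hle
  exact le_of_mul_le_mul_right hle hpos

/-- A union bound over Chernoff estimates: `N` samples drawn from the weights `p` can be chosen so
that finitely many bounded centred functions all have sample mean less than `ε`. -/
theorem exists_sample_sum_lt {ι τ : Type*} [Fintype ι] (T : Finset τ) {p : ι → ℝ}
    (hp : ∀ i, 0 ≤ p i) (hp1 : ∑ i, p i = 1) {g : τ → ι → ℝ} {R ε : ℝ} (hR : 0 < R) (hε : 0 < ε)
    (hεR : ε ≤ 2 * R) (hg : ∀ t ∈ T, ∀ i, |g t i| ≤ R) (hg0 : ∀ t ∈ T, ∑ i, p i * g t i = 0)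
    {N : ℕ} (hN : T.card * Real.exp (-(N * ε ^ 2 / (4 * R ^ 2))) < 1) :
    ∃ ω : Fin N → ι, ∀ t ∈ T, ∑ k, g t (ω k) < N * ε := by
  by_contra! hcon
  set l := ε / (2 * R ^ 2) with hl
  have hl0 : 0 < l := by positivity
  have hlR : l * R ≤ 1 := by
    rw [hl, div_mul_eq_mul_div, div_le_one (by positivity)]
    nlinarith
  have hmgf : ∀ t ∈ T, ∑ i, p i * Real.exp (l * g t i) ≤ Real.exp (l ^ 2 * R ^ 2) := by
    intro t ht
    have hpt : ∀ i, Real.exp (l * g t i) ≤ 1 + l * g t i + l ^ 2 * R ^ 2 := by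
      intro i
      have h1 : |l * g t i| ≤ l * R := by
        rw [abs_mul, abs_of_pos hl0]
        exact mul_le_mul_of_nonneg_left (hg t ht i) hl0.le
      have h2 := (abs_le.1 (Real.abs_exp_sub_one_sub_id_le (h1.trans hlR))).2
      have h3 : (l * g t i) ^ 2 ≤ (l * R) ^ 2 := sq_le_sq.2 (h1.trans (le_abs_self _))
      nlinarith
    calc ∑ i, p i * Real.exp (l * g t i)
        ≤ ∑ i, p i * (1 + l * g t i + l ^ 2 * R ^ 2) :=
          Finset.sum_le_sum fun i _ => mul_le_mul_of_nonneg_left (hpt i) (hp i)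
      _ = ∑ i, p i + l * ∑ i, p i * g t i + (l ^ 2 * R ^ 2) * ∑ i, p i := by
          simp only [Finset.mul_sum, ← Finset.sum_add_distrib]
          exact Finset.sum_congr rfl fun i _ => by ring
      _ = l ^ 2 * R ^ 2 + 1 := by rw [hg0 t ht, hp1]; ring
      _ ≤ Real.exp (l ^ 2 * R ^ 2) := Real.add_one_le_exp _
  have hlow : ∀ ω : Fin N → ι,
      Real.exp (l * (N * ε)) ≤ ∑ t ∈ T, ∏ k, Real.exp (l * g t (ω k)) := by
    intro ω
    obtain ⟨t, ht, htω⟩ := hcon ω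
    refine le_trans ?_ (Finset.single_le_sum
      (fun t _ => Finset.prod_nonneg fun k _ => (Real.exp_pos _).le) ht)
    rw [← Real.exp_sum, ← Finset.mul_sum]
    exact Real.exp_le_exp.2 (mul_le_mul_of_nonneg_left htω hl0.le)
  have hmain : Real.exp (l * (N * ε)) ≤ T.card * Real.exp (l ^ 2 * R ^ 2) ^ N := by
    calc Real.exp (l * (N * ε))
        = ∑ ω : Fin N → ι, (∏ k, p (ω k)) * Real.exp (l * (N * ε)) := by
          rw [← Finset.sum_mul, ← Fintype.sum_pow, hp1, one_pow, one_mul]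
      _ ≤ ∑ ω : Fin N → ι, (∏ k, p (ω k)) * ∑ t ∈ T, ∏ k, Real.exp (l * g t (ω k)) :=
          Finset.sum_le_sum fun ω _ =>
            mul_le_mul_of_nonneg_left (hlow ω) (Finset.prod_nonneg fun k _ => hp _)
      _ = ∑ t ∈ T, (∑ i, p i * Real.exp (l * g t i)) ^ N := by
          simp only [Fintype.sum_pow, Finset.mul_sum, ← Finset.prod_mul_distrib]
          exact Finset.sum_comm
      _ ≤ ∑ t ∈ T, Real.exp (l ^ 2 * R ^ 2) ^ N :=
          Finset.sum_le_sum fun t ht => pow_le_pow_left₀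
            (Finset.sum_nonneg fun i _ => mul_nonneg (hp i) (Real.exp_pos _).le) (hmgf t ht) N
      _ = T.card * Real.exp (l ^ 2 * R ^ 2) ^ N := by simp
  have hexp : Real.exp (l ^ 2 * R ^ 2) ^ N
      = Real.exp (-(N * ε ^ 2 / (4 * R ^ 2))) * Real.exp (l * (N * ε)) := by
    rw [← Real.exp_nat_mul, ← Real.exp_add]
    congr 1
    rw [hl]
    field_simp
    ring
  rw [hexp, ← mul_assoc (T.card : ℝ)] at hmain
  nlinarith [Real.exp_pos (l * (N * ε))]

theorem abs_mulVec_apply_le {n r : ℕ} (U : Matrix (Fin n) (Fin r) ℝ) {y : Fin r → ℝ} {δ : ℝ}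
    (hy : ∀ j, |y j| ≤ δ) (i : Fin n) : |(U *ᵥ y) i| ≤ (∑ j, |U i j|) * δ := by
  rw [Finset.sum_mul]
  refine (Finset.abs_sum_le_sum_abs (fun j => U i j * y j) Finset.univ).trans
    (Finset.sum_le_sum fun j _ => ?_)
  rw [abs_mul]
  exact mul_le_mul_of_nonneg_left (hy j) (abs_nonneg _)

theorem l1Norm_smul {n : ℕ} (t : ℝ) (v : Fin n → ℝ) : l1Norm (t • v) = |t| * l1Norm v := by
  simp [l1Norm, abs_mul, Finset.mul_sum]

theorem l1Norm_nonneg {n : ℕ} (v : Fin n → ℝ) : 0 ≤ l1Norm v :=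
  Finset.sum_nonneg fun _ _ => abs_nonneg _

theorem abs_l1Norm_sub_le {n : ℕ} (v w : Fin n → ℝ) :
    |l1Norm v - l1Norm w| ≤ l1Norm (v - w) := by
  simp only [l1Norm, ← Finset.sum_sub_distrib]
  exact (Finset.abs_sum_le_sum_abs _ _).trans
    (Finset.sum_le_sum fun i _ => abs_abs_sub_abs_le_abs_sub _ _)

/-- A homogeneous approximation of `‖U x‖₁` on the unit sphere is one everywhere. -/
theorem abs_l1Norm_mulVec_sub_le_of_sphere {n m r : ℕ} {U : Matrix (Fin n) (Fin r) ℝ}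
    {V : Matrix (Fin m) (Fin r) ℝ} {ε : ℝ} (hU : ∀ x j, |x j| ≤ l1Norm (U *ᵥ x))
    (h : ∀ x, l1Norm (U *ᵥ x) = 1 → |l1Norm (V *ᵥ x) - 1| ≤ ε) (x : Fin r → ℝ) :
    |l1Norm (V *ᵥ x) - l1Norm (U *ᵥ x)| ≤ ε * l1Norm (U *ᵥ x) := by
  rcases (l1Norm_nonneg (U *ᵥ x)).eq_or_lt with h0 | h0
  · have hx : x = 0 := funext fun j => abs_nonpos_iff.1 (h0 ▸ hU x j)
    simp [hx, l1Norm]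
  · set t := l1Norm (U *ᵥ x)
    have h1 := h (t⁻¹ • x) (by
      rw [mulVec_smul, l1Norm_smul, abs_of_pos (inv_pos.2 h0), inv_mul_cancel₀ h0.ne'])
    rw [mulVec_smul, l1Norm_smul, abs_of_pos (inv_pos.2 h0)] at h1
    have h2 : l1Norm (V *ᵥ x) - t = t * (t⁻¹ * l1Norm (V *ᵥ x) - 1) := by field_simp
    rw [h2, abs_mul, abs_of_pos h0, mul_comm]
    exact mul_le_mul_of_nonneg_right h1 h0.le

/-- Row sampling for a matrix whose columns form an Auerbach basis of their span in `ℓ₁`. -/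
theorem exists_rows_of_auerbach {n r : ℕ} (hr : 0 < r) (U : Matrix (Fin n) (Fin r) ℝ)
    (hcol : ∀ j, ∑ i, |U i j| ≤ 1) (hU : ∀ x j, |x j| ≤ l1Norm (U *ᵥ x)) {ε : ℝ} (hε : 0 < ε)
    (hε1 : ε < 1) {K N : ℕ} (hK : 4 * r / ε ≤ K)
    (hN : 2 * (2 * K + 1) ^ r * Real.exp (-(N * ε ^ 2 / (16 * r ^ 2))) < 1) :
    ∃ (σ : Fin N → Fin n) (c : Fin N → ℝ), (∀ k, 0 ≤ c k) ∧ ∀ x,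
      |l1Norm ((Matrix.of fun k j => c k * U (σ k) j) *ᵥ x) - l1Norm (U *ᵥ x)|
        ≤ ε * l1Norm (U *ᵥ x) := by
  have hr' : (1 : ℝ) ≤ r := by exact_mod_cast hr
  have hKpos : (0 : ℝ) < K := lt_of_lt_of_le (by positivity) hK
  have hNpos : (0 : ℝ) < N := by
    rcases Nat.eq_zero_or_pos N with rfl | h
    · have : (1 : ℝ) ≤ (2 * K + 1) ^ r := one_le_pow₀ (by linarith)
      simp at hN
      linarith
    · exact_mod_cast h
  set s : Fin n → ℝ := fun i => ∑ j, |U i j| with hs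
  have hs0 : ∀ i, 0 ≤ s i := fun i => Finset.sum_nonneg fun _ _ => abs_nonneg _
  set S := ∑ i, s i with hS
  have hSr : S ≤ r := by
    rw [hS, hs, Finset.sum_comm]
    exact (Finset.sum_le_sum fun j _ => hcol j).trans (by simp)
  have hμ : ∀ {y : Fin r → ℝ} {δ : ℝ}, (∀ j, |y j| ≤ δ) → l1Norm (U *ᵥ y) ≤ S * δ := by
    intro y δ hy
    rw [hS, Finset.sum_mul]
    exact Finset.sum_le_sum fun i _ => abs_mulVec_apply_le U hy i
  have hSpos : 0 < S := by
    have h1 := hU (fun _ => 1) ⟨0, hr⟩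
    have h2 := hμ (y := fun _ => 1) (δ := 1) (by simp)
    simp only [abs_one] at h1
    linarith
  set p : Fin n → ℝ := fun i => s i / S with hp
  have hp0 : ∀ i, 0 ≤ p i := fun i => div_nonneg (hs0 i) hSpos.le
  have hp1 : ∑ i, p i = 1 := by
    rw [hp, ← Finset.sum_div, div_self hSpos.ne']
  have hf : ∀ {y : Fin r → ℝ} {δ : ℝ}, 0 ≤ δ → (∀ j, |y j| ≤ δ) → ∀ i,
      |(U *ᵥ y) i| / p i ≤ r * δ := by
    intro y δ hδ hy i
    rcases (hs0 i).eq_or_lt with h | h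
    · simp only [hp, ← h, zero_div, div_zero]
      positivity
    · rw [hp, div_le_iff₀ (by positivity)]
      calc |(U *ᵥ y) i| ≤ s i * δ := abs_mulVec_apply_le U hy i
        _ = S * δ * (s i / S) := by field_simp
        _ ≤ r * δ * (s i / S) := by gcongr
  have hpf : ∀ y i, p i * (|(U *ᵥ y) i| / p i) = |(U *ᵥ y) i| := by
    intro y i
    rcases (hs0 i).eq_or_lt with h | h
    · have h1 := abs_mulVec_apply_le U (y := y) (δ := ∑ j, |y j|)
        (fun j => Finset.single_le_sum (f := fun j => |y j|) (fun _ _ => abs_nonneg _)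
          (Finset.mem_univ j)) i
      have h2 : (∑ j, |U i j|) = 0 := h.symm
      rw [h2, zero_mul] at h1
      rw [le_antisymm h1 (abs_nonneg _)]
      simp
    · exact mul_div_cancel₀ _ (div_pos h hSpos).ne'
  set y : (Fin r → ℤ) → Fin r → ℝ := fun z j => z j / K with hy
  set Z : Finset (Fin r → ℤ) := Fintype.piFinset fun _ => Finset.Icc (-(K : ℤ)) K with hZ
  have hyZ : ∀ z ∈ Z, ∀ j, |y z j| ≤ 1 := by
    intro z hz j
    have h1 := Finset.mem_Icc.1 (Fintype.mem_piFinset.1 hz j)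
    rw [hy, abs_div, abs_of_pos hKpos, div_le_one hKpos]
    exact_mod_cast abs_le.2 h1
  have hcard : Z.card = (2 * K + 1) ^ r := by
    have : ((K : ℤ) + 1 + K).toNat = 2 * K + 1 := by omega
    simp [hZ, this]
  set D : (Fin r → ℤ) → Fin n → ℝ :=
    fun z i => |(U *ᵥ y z) i| / p i - l1Norm (U *ᵥ y z) with hD
  have hDr : ∀ z ∈ Z, ∀ i, |D z i| ≤ r := by
    intro z hz i
    have h1 := hf zero_le_one (hyZ z hz) i
    have h2 := hμ (hyZ z hz)
    have h3 := l1Norm_nonneg (U *ᵥ y z)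
    have h4 : 0 ≤ |(U *ᵥ y z) i| / p i := div_nonneg (abs_nonneg _) (hp0 i)
    rw [abs_le]
    constructor <;> simp only [hD] <;> linarith
  have hD0 : ∀ z, ∑ i, p i * D z i = 0 := by
    intro z
    simp only [hD, mul_sub, hpf, Finset.sum_sub_distrib, ← Finset.sum_mul, hp1, one_mul]
    exact sub_self _
  obtain ⟨ω, hω⟩ := exists_sample_sum_lt (Z ×ˢ ({1, -1} : Finset ℝ)) hp0 hp1
    (g := fun t i => t.2 * D t.1 i) (R := r) (ε := ε / 2) (N := N) (by linarith) (by linarith)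
    (by linarith)
    (by
      rintro ⟨z, a⟩ hza i
      obtain ⟨hz, ha⟩ := Finset.mem_product.1 hza
      have : |a| = 1 := by
        rcases Finset.mem_insert.1 ha with h | h
        · simp_all
        · simp_all
      simpa [abs_mul, this] using hDr z hz i)
    (by
      rintro ⟨z, a⟩ -
      simp only [mul_left_comm _ a, ← Finset.mul_sum, hD0, mul_zero])
    (by
      have h2 : ({1, -1} : Finset ℝ).card = 2 := Finset.card_pair (by norm_num)
      rw [Finset.card_product, hcard, h2]
      convert hN using 2
      · push_cast; ring
      · congr 2; field_simp; ring)
  have hωD : ∀ z ∈ Z, |∑ k, D z (ω k)| ≤ N * (ε / 2) := by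
    intro z hz
    have h1 := hω (z, 1) (by simp [hz])
    have h2 := hω (z, -1) (by simp [hz])
    simp only [one_mul, neg_mul, Finset.sum_neg_distrib] at h1 h2
    exact abs_le.2 ⟨by linarith, by linarith⟩
  refine ⟨ω, fun k => (N * p (ω k))⁻¹, fun k => inv_nonneg.2 (mul_nonneg hNpos.le (hp0 _)), ?_⟩
  set V : Matrix (Fin N) (Fin r) ℝ :=
    Matrix.of fun k j => (N * p (ω k))⁻¹ * U (ω k) j with hV
  have hVx : ∀ x, l1Norm (V *ᵥ x) = (∑ k, |(U *ᵥ x) (ω k)| / p (ω k)) / N := by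
    intro x
    rw [l1Norm, Finset.sum_div]
    refine Finset.sum_congr rfl fun k _ => ?_
    have : (V *ᵥ x) k = (N * p (ω k))⁻¹ * (U *ᵥ x) (ω k) := by
      simp [hV, mulVec, dotProduct, Finset.mul_sum, mul_assoc]
    rw [this, abs_mul, abs_of_nonneg (inv_nonneg.2 (mul_nonneg hNpos.le (hp0 _))), mul_inv]
    ring
  have hVδ : ∀ {x : Fin r → ℝ} {δ : ℝ}, 0 ≤ δ → (∀ j, |x j| ≤ δ) →
      l1Norm (V *ᵥ x) ≤ r * δ := by
    intro x δ hδ hx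
    rw [hVx, div_le_iff₀ hNpos]
    refine (Finset.sum_le_sum fun k _ => hf hδ hx (ω k)).trans ?_
    simp [mul_comm]
  refine abs_l1Norm_mulVec_sub_le_of_sphere hU fun x hx => ?_
  have hx1 : ∀ j, |x j| ≤ 1 := fun j => hx ▸ hU x j
  set z : Fin r → ℤ := fun j => ⌊K * x j⌋ with hz
  have hzZ : z ∈ Z := by
    refine Fintype.mem_piFinset.2 fun j => Finset.mem_Icc.2 ⟨?_, ?_⟩
    · refine Int.le_floor.2 ?_
      push_cast
      nlinarith [(abs_le.1 (hx1 j)).1]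
    · have : (⌊K * x j⌋ : ℝ) ≤ K := (Int.floor_le _).trans (by nlinarith [(abs_le.1 (hx1 j)).2])
      exact_mod_cast this
  have hxy : ∀ j, |(x - y z) j| ≤ 1 / K := by
    intro j
    have h1 : (x - y z) j = (K * x j - ⌊K * x j⌋) / K := by
      simp only [Pi.sub_apply, hy, hz]
      field_simp
    rw [h1, abs_div, abs_of_pos hKpos]
    gcongr
    rw [abs_of_nonneg (Int.fract_nonneg _)]
    exact (Int.fract_lt_one _).le
  have hrK : r * (1 / K : ℝ) ≤ ε / 4 := by
    rw [div_le_iff₀ hε] at hK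
    rw [mul_one_div, div_le_iff₀ hKpos]
    linarith
  have hK0 : (0 : ℝ) ≤ 1 / K := by positivity
  have e1 : |l1Norm (V *ᵥ x) - l1Norm (V *ᵥ y z)| ≤ ε / 4 := by
    refine (abs_l1Norm_sub_le _ _).trans ?_
    rw [← mulVec_sub]
    exact (hVδ hK0 hxy).trans hrK
  have e2 : |l1Norm (U *ᵥ x) - l1Norm (U *ᵥ y z)| ≤ ε / 4 := by
    refine (abs_l1Norm_sub_le _ _).trans ?_
    rw [← mulVec_sub]
    exact (hμ hxy).trans ((mul_le_mul_of_nonneg_right hSr hK0).trans hrK)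
  have e3 : |l1Norm (V *ᵥ y z) - l1Norm (U *ᵥ y z)| ≤ ε / 2 := by
    have h1 : l1Norm (V *ᵥ y z) - l1Norm (U *ᵥ y z) = (∑ k, D z (ω k)) / N := by
      rw [hVx]
      simp only [hD, Finset.sum_sub_distrib, Finset.sum_const, Finset.card_univ,
        Fintype.card_fin, nsmul_eq_mul]
      field_simp
    rw [h1, abs_div, abs_of_pos hNpos, div_le_iff₀ hNpos, mul_comm]
    exact hωD z hzZ
  rw [← hx]
  rw [abs_le] at *
  constructor <;> linarith [e1.1, e1.2, e2.1, e2.2, e3.1, e3.2]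

/-- The column span of a matrix has an Auerbach basis for the `ℓ₁` norm. -/
theorem exists_auerbach_factorization {n d : ℕ} (A : Matrix (Fin n) (Fin d) ℝ) :
    ∃ (r : ℕ) (U : Matrix (Fin n) (Fin r) ℝ) (W : Matrix (Fin r) (Fin d) ℝ), r ≤ d ∧ A = U * W ∧
      (∀ j, ∑ i, |U i j| ≤ 1) ∧ ∀ x j, |x j| ≤ l1Norm (U *ᵥ x) := by
  set f : (Fin d → ℝ) →ₗ[ℝ] PiLp 1 (fun _ : Fin n => ℝ) :=
    (WithLp.linearEquiv 1 ℝ (Fin n → ℝ)).symm.toLinearMap ∘ₗ A.mulVecLin with hf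
  obtain ⟨b, hb, hrepr⟩ := exists_auerbach_basis (LinearMap.range f)
  have hnorm : ∀ v : LinearMap.range f, ‖v‖ = ∑ i, |v.1 i| := by
    intro v
    rw [Submodule.coe_norm, PiLp.norm_eq_of_nat 1 (by simp)]
    simp
  set U : Matrix (Fin n) (Fin (Module.finrank ℝ (LinearMap.range f))) ℝ :=
    Matrix.of fun i j => (b j).1 i with hU
  have hUx : ∀ x i, (U *ᵥ x) i = (∑ j, x j • b j : LinearMap.range f).1 i := by
    intro x i
    simp [hU, mulVec, dotProduct, mul_comm]
  refine ⟨_, U, Matrix.of fun j k => b.repr ⟨f (Pi.single k 1), LinearMap.mem_range_self _ _⟩ j,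
    ?_, ?_, ?_, ?_⟩
  · simpa using LinearMap.finrank_range_le f
  · ext i k
    have h1 := hUx (fun j => b.repr ⟨f (Pi.single k 1), LinearMap.mem_range_self _ _⟩ j) i
    rw [b.sum_repr] at h1
    have h2 : (f (Pi.single k 1)) i = A i k := by simp [hf]
    rw [← h2, ← h1]
    rfl
  · intro j
    simpa [hnorm, hU] using hb j
  · intro x j
    have h1 := hrepr (∑ j, x j • b j) j
    rw [b.repr_sum_self, hnorm] at h1
    simpa only [l1Norm, hUx] using h1

/-- The grid and sample sizes needed for `exists_rows_of_auerbach`. -/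
theorem exists_sample_size {ε : ℝ} (hε : 0 < ε) (hε1 : ε < 1) :
    ∃ C : ℝ, 0 < C ∧ ∀ r : ℕ, 0 < r → ∃ K N : ℕ, 4 * r / ε ≤ K ∧
      2 * (2 * K + 1) ^ r * Real.exp (-(N * ε ^ 2 / (16 * r ^ 2))) < 1 ∧
      (N : ℝ) ≤ C * (r : ℝ) ^ (7 / 2 : ℝ) := by
  refine ⟨16 / ε ^ 2 * (2 * √(11 / ε) + 1) + 1, by positivity, fun r hr => ?_⟩
  have hr' : (1 : ℝ) ≤ r := by exact_mod_cast hr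
  set K := ⌈4 * r / ε⌉₊ with hK
  set M : ℝ := r * Real.log (2 * K + 1) + 1 with hM
  set N := ⌈16 * r ^ 2 / ε ^ 2 * M⌉₊ with hN
  have hlog : 0 ≤ Real.log (2 * K + 1) := Real.log_nonneg (by
    have : (0 : ℝ) ≤ K := K.cast_nonneg
    linarith)
  have hM0 : 0 < M := by positivity
  refine ⟨K, N, Nat.le_ceil _, ?_, ?_⟩
  · have h1 : M ≤ N * ε ^ 2 / (16 * r ^ 2) := by
      rw [le_div_iff₀ (by positivity)]
      have := Nat.le_ceil (16 * r ^ 2 / ε ^ 2 * M)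
      rw [← hN, div_mul_eq_mul_div, div_le_iff₀ (by positivity)] at this
      linarith
    have h2 : Real.exp (-M) = ((2 * K + 1 : ℝ) ^ r)⁻¹ * (Real.exp 1)⁻¹ := by
      rw [Real.exp_neg, hM, Real.exp_add, mul_inv, Real.exp_nat_mul,
        Real.exp_log (by positivity)]
    calc 2 * (2 * K + 1 : ℝ) ^ r * Real.exp (-(N * ε ^ 2 / (16 * r ^ 2)))
        ≤ 2 * (2 * K + 1 : ℝ) ^ r * Real.exp (-M) := by gcongr
      _ = 2 / Real.exp 1 := by rw [h2]; field_simp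
      _ < 1 := by
        rw [div_lt_one (Real.exp_pos 1)]
        linarith [Real.exp_one_gt_d9]
  · have hKle : 2 * (K : ℝ) + 1 ≤ 11 / ε * r := by
      have h1 := (Nat.ceil_lt_add_one (a := 4 * r / ε) (by positivity)).le
      have h2 : (1 : ℝ) ≤ r / ε := by rw [le_div_iff₀ hε]; linarith
      have h3 : 4 * (r : ℝ) / ε = 4 * (r / ε) := by ring
      have h4 : 11 / ε * (r : ℝ) = 11 * (r / ε) := by ring
      rw [← hK] at h1
      linarith
    have hlogle : Real.log (2 * K + 1) ≤ 2 * (√(11 / ε) * √r) := by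
      have h1 := Real.log_le_rpow_div (x := 2 * K + 1) (ε := 1 / 2) (by positivity) (by norm_num)
      rw [← Real.sqrt_eq_rpow] at h1
      have h2 := Real.sqrt_le_sqrt hKle
      rw [Real.sqrt_mul (by positivity)] at h2
      linarith
    have hpow : (r : ℝ) ^ (7 / 2 : ℝ) = r ^ 3 * √r := by
      rw [Real.sqrt_eq_rpow, ← Real.rpow_natCast, ← Real.rpow_add (by linarith)]
      norm_num
    have hsq : 1 ≤ √(r : ℝ) := Real.one_le_sqrt.2 hr'
    have hMle : M ≤ (2 * √(11 / ε) + 1) * (r * √r) := by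
      have h1 : r * Real.log (2 * K + 1) ≤ r * (2 * (√(11 / ε) * √r)) := by gcongr
      nlinarith
    have h1 := (Nat.ceil_lt_add_one (a := 16 * r ^ 2 / ε ^ 2 * M) (by positivity)).le
    rw [← hN] at h1
    have h2 : 1 ≤ (r : ℝ) ^ 3 * √r := one_le_mul_of_one_le_of_one_le (one_le_pow₀ hr') hsq
    rw [hpow]
    calc (N : ℝ) ≤ 16 * r ^ 2 / ε ^ 2 * M + 1 := h1
      _ ≤ 16 * r ^ 2 / ε ^ 2 * ((2 * √(11 / ε) + 1) * (r * √r)) + r ^ 3 * √r := by gcongr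
      _ = _ := by ring

/-- For every `θ > 0` and `ε ∈ (0,1)` there is a constant `C > 0` so that every `n × d` matrix
`A` admits an ℓ₁ `(1 ± ε)`-approximation `B` with `m ≤ C · d^(4√2 − 2 + θ)` rows, each a
nonnegative scalar multiple of a row of `A`. -/
theorem l1_row_sampling (θ : ℝ) (hθ : 0 < θ) (ε : ℝ) (hε0 : 0 < ε) (hε1 : ε < 1) :
    ∃ C : ℝ, 0 < C ∧
      ∀ (n d : ℕ) (A : Matrix (Fin n) (Fin d) ℝ),
        ∃ (m : ℕ) (B : Matrix (Fin m) (Fin d) ℝ) (σ : Fin m → Fin n) (c : Fin m → ℝ),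
          (m : ℝ) ≤ C * (d : ℝ) ^ (4 * Real.sqrt 2 - 2 + θ) ∧
          (∀ i, 0 ≤ c i) ∧
          (∀ i j, B i j = c i * A (σ i) j) ∧
          (∀ x : Fin d → ℝ,
            (1 - ε) * l1Norm (A.mulVec x) ≤ l1Norm (B.mulVec x) ∧
            l1Norm (B.mulVec x) ≤ (1 + ε) * l1Norm (A.mulVec x)) := by
  have hexp : (7 / 2 : ℝ) ≤ 4 * √2 - 2 + θ := by
    have : (11 / 8 : ℝ) ≤ √2 := Real.le_sqrt_of_sq_le (by norm_num)
    linarith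
  obtain ⟨C, hC, hsize⟩ := exists_sample_size hε0 hε1
  refine ⟨C, hC, fun n d A => ?_⟩
  obtain ⟨r, U, W, hrd, rfl, hcol, hU⟩ := exists_auerbach_factorization A
  rcases Nat.eq_zero_or_pos r with rfl | hr
  · refine ⟨0, 0, Fin.elim0, Fin.elim0, ?_, fun i => i.elim0, fun i => i.elim0,
      fun x => ?_⟩
    · rw [Nat.cast_zero]
      positivity
    have : U * W = 0 := by
      ext i j
      simp [Matrix.mul_apply]
    simp [this, l1Norm]
  obtain ⟨K, N, hK, hN, hNle⟩ := hsize r hr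
  obtain ⟨σ, c, hc, happrox⟩ := exists_rows_of_auerbach hr U hcol hU hε0 hε1 hK hN
  refine ⟨N, (Matrix.of fun k j => c k * U (σ k) j) * W, σ, c, ?_, hc, ?_, fun x => ?_⟩
  · have hr1 : (1 : ℝ) ≤ r := by exact_mod_cast hr
    have hrd' : (r : ℝ) ≤ d := by exact_mod_cast hrd
    refine hNle.trans (mul_le_mul_of_nonneg_left ?_ hC.le)
    exact (Real.rpow_le_rpow (by positivity) hrd' (by norm_num)).trans
      (Real.rpow_le_rpow_of_exponent_le (hr1.trans hrd') hexp)
  · intro i j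
    simp [Matrix.mul_apply, Finset.mul_sum, mul_assoc]
  · have h := abs_le.1 (happrox (W *ᵥ x))
    rw [← Matrix.mulVec_mulVec, ← Matrix.mulVec_mulVec]
    constructor <;> linarith [h.1, h.2]
end

section
/- For every θ > 0 and every real p with 1 ≤ p < 4 there exists a constant C = C(θ, p) > 0 such that for every n × d real matrix A and every ε ∈ (0, 1/7], there exist a natural number m and an m × d real matrix B each of whose rows is a nonnegative scalar multiple of some row of A, such that (1 − ε)‖Ax‖_p ≤ ‖Bx‖_p ≤ (1 + ε)‖Ax‖_p for all x ∈ ℝᵈ, where m ≤ C · d^{4/p + θ} · ε⁻² if 1 ≤ p ≤ 2, and m ≤ C · d^{(3/2)p − 1 + θ} · ε⁻² if 2 ≤ p < 4. -/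
open Matrix BigOperators

/-- The ℓ_p norm of a vector: `(∑ i, |v i|^p)^(1/p)`. -/
noncomputable def lpNorm {n : ℕ} (p : ℝ) (v : Fin n → ℝ) : ℝ := (∑ i, |v i| ^ p) ^ (1 / p)

section Signs

variable {ι : Type*} [Fintype ι] [DecidableEq ι]

theorem sum_signs_eq_half_sum_add_flip (k : ι) (G : (ι → ℤˣ) → ℝ) :
    ∑ s, G s = (∑ s, (G s + G (s * Pi.mulSingle k (-1)))) / 2 := by
  have h := Equiv.sum_comp (Equiv.mulRight (Pi.mulSingle k (-1) : ι → ℤˣ)) G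
  simp only [Equiv.coe_mulRight] at h
  rw [Finset.sum_add_distrib, h]
  ring

theorem sign_flip_same (k : ι) (s : ι → ℤˣ) :
    (((s * Pi.mulSingle k (-1) : ι → ℤˣ) k : ℤ) : ℝ) = -((s k : ℤ) : ℝ) := by
  simp

theorem sign_flip_of_ne {k j : ι} (h : j ≠ k) (s : ι → ℤˣ) :
    (s * Pi.mulSingle k (-1) : ι → ℤˣ) j = s j := by
  simp [h]

theorem sum_signs_contraction_step {X : Type*} (k : ι) (F : (ι → ℤˣ) → X → ℝ)
    (hF : ∀ s x, F (s * Pi.mulSingle k (-1)) x = F s x) (φ t : X → ℝ)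
    (h : ∀ x y, |φ x - φ y| ≤ |t x - t y|) (x : (ι → ℤˣ) → X) :
    ∃ y : (ι → ℤˣ) → X, ∑ s, (((s k : ℤ) : ℝ) * φ (x s) + F s (x s)) ≤
      ∑ s, (((s k : ℤ) : ℝ) * t (y s) + F s (y s)) := by
  classical
  set e : ι → ℤˣ := Pi.mulSingle k (-1) with he
  have hee : ∀ s : ι → ℤˣ, s * e * e = s := by
    intro s
    rw [mul_assoc, he, ← Pi.mulSingle_mul]
    simp
  refine ⟨fun s ↦ if 0 ≤ ((s k : ℤ) : ℝ) * (t (x s) - t (x (s * e))) then x s else x (s * e), ?_⟩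
  rw [sum_signs_eq_half_sum_add_flip k, sum_signs_eq_half_sum_add_flip k (fun s ↦ _ * t _ + _)]
  refine div_le_div_of_nonneg_right (Finset.sum_le_sum fun s _ ↦ ?_) (by norm_num)
  have hk : (((s * e) k : ℤ) : ℝ) = -((s k : ℤ) : ℝ) := sign_flip_same k s
  have hcond : (0 ≤ (((s * e) k : ℤ) : ℝ) * (t (x (s * e)) - t (x s))) ↔
      0 ≤ ((s k : ℤ) : ℝ) * (t (x s) - t (x (s * e))) := by
    rw [hk]; constructor <;> intro h <;> linarith
  simp only [← he, hee, hcond, hF]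
  rw [hk]
  have habs : |((s k : ℤ) : ℝ)| = 1 := by
    rcases Int.units_eq_one_or (s k) with h | h <;> simp [h]
  have h1 : ((s k : ℤ) : ℝ) * (φ (x s) - φ (x (s * e))) ≤
      |((s k : ℤ) : ℝ) * (t (x s) - t (x (s * e)))| := by
    refine (le_abs_self _).trans ?_
    rw [abs_mul, abs_mul, habs, one_mul, one_mul]
    exact h _ _
  split_ifs with hc
  · rw [abs_of_nonneg hc] at h1
    linarith
  · rw [abs_of_neg (not_le.mp hc)] at h1
    linarith

/-- The Rademacher contraction principle; suprema are expressed through selections. -/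
theorem sum_signs_contraction {X : Type*} (φ t : ι → X → ℝ)
    (h : ∀ j x y, |φ j x - φ j y| ≤ |t j x - t j y|) (x : (ι → ℤˣ) → X) :
    ∃ y : (ι → ℤˣ) → X, ∑ s, ∑ j, ((s j : ℤ) : ℝ) * φ j (x s) ≤
      ∑ s, ∑ j, ((s j : ℤ) : ℝ) * t j (y s) := by
  suffices H : ∀ S : Finset ι, ∃ y : (ι → ℤˣ) → X, ∑ s, ∑ j, ((s j : ℤ) : ℝ) * φ j (x s) ≤
      ∑ s, ∑ j, ((s j : ℤ) : ℝ) * (if j ∈ S then t j else φ j) (y s) by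
    simpa using H Finset.univ
  intro S
  induction S using Finset.induction_on with
  | empty => exact ⟨x, by simp⟩
  | insert k S hk ih =>
    obtain ⟨y, hy⟩ := ih
    obtain ⟨z, hz⟩ := sum_signs_contraction_step k
      (fun s x ↦ ∑ j ∈ Finset.univ.erase k, ((s j : ℤ) : ℝ) * (if j ∈ S then t j else φ j) x)
      (fun s x ↦ Finset.sum_congr rfl fun j hj ↦ by
        rw [sign_flip_of_ne (Finset.ne_of_mem_erase hj)]) (φ k) (t k) (h k) y
    refine ⟨z, hy.trans (Eq.trans_le ?_ (hz.trans_eq ?_))⟩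
    · refine Finset.sum_congr rfl fun s _ ↦ ?_
      rw [← Finset.add_sum_erase _ _ (Finset.mem_univ k), if_neg hk]
    · refine Finset.sum_congr rfl fun s _ ↦ ?_
      rw [← Finset.add_sum_erase _ _ (Finset.mem_univ k), if_pos (Finset.mem_insert_self k S)]
      congr 1
      refine Finset.sum_congr rfl fun j hj ↦ ?_
      simp [Finset.mem_insert, Finset.ne_of_mem_erase hj]

variable {E : Type*} [NormedAddCommGroup E] [InnerProductSpace ℝ E]

theorem sum_signs_norm_sq (b : ι → E) (S : Finset ι) :
    ∑ s : ι → ℤˣ, ‖∑ j ∈ S, ((s j : ℤ) : ℝ) • b j‖ ^ 2 =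
      Fintype.card (ι → ℤˣ) * ∑ j ∈ S, ‖b j‖ ^ 2 := by
  induction S using Finset.induction_on with
  | empty => simp
  | insert k S hk ih =>
    have hzero : ∑ s : ι → ℤˣ,
        2 * inner ℝ (((s k : ℤ) : ℝ) • b k) (∑ j ∈ S, ((s j : ℤ) : ℝ) • b j) = 0 := by
      rw [sum_signs_eq_half_sum_add_flip k, div_eq_zero_iff]
      left
      refine Finset.sum_eq_zero fun s _ ↦ ?_
      have : ∑ j ∈ S, (((s * Pi.mulSingle k (-1) : ι → ℤˣ) j : ℤ) : ℝ) • b j =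
          ∑ j ∈ S, ((s j : ℤ) : ℝ) • b j :=
        Finset.sum_congr rfl fun j hj ↦ by
          rw [sign_flip_of_ne (ne_of_mem_of_not_mem hj hk)]
      rw [this, sign_flip_same, neg_smul, inner_neg_left]
      ring
    have hone : ∀ s : ι → ℤˣ, ‖((s k : ℤ) : ℝ) • b k‖ = ‖b k‖ := by
      intro s
      rcases Int.units_eq_one_or (s k) with h | h <;> simp [h]
    simp only [Finset.sum_insert hk, norm_add_sq_real, hone]
    rw [Finset.sum_add_distrib, Finset.sum_add_distrib, hzero, ih]
    simp
    ring

theorem sum_signs_norm_le {b : ι → E} {δ : ℝ} (hδ : 0 ≤ δ) (hb : ∀ j, ‖b j‖ ≤ δ) :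
    ∑ s : ι → ℤˣ, ‖∑ j, ((s j : ℤ) : ℝ) • b j‖ ≤
      Fintype.card (ι → ℤˣ) * (δ * √(Fintype.card ι)) := by
  refine abs_le_of_sq_le_sq' ?_ (by positivity) |>.2
  refine sq_sum_le_card_mul_sum_sq.trans ?_
  rw [sum_signs_norm_sq, mul_pow, mul_pow, Real.sq_sqrt (by positivity), Finset.card_univ]
  have : ∑ j, ‖b j‖ ^ 2 ≤ ∑ _j : ι, δ ^ 2 :=
    Finset.sum_le_sum fun j _ ↦ pow_le_pow_left₀ (norm_nonneg _) (hb j) 2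
  rw [Finset.sum_const, nsmul_eq_mul, Finset.card_univ] at this
  nlinarith [sq_nonneg (Fintype.card (ι → ℤˣ) : ℝ)]

theorem abs_rpow_sub_rpow_le {p a b β : ℝ} (hp : 1 ≤ p) (ha : 0 ≤ a) (hb : 0 ≤ b)
    (haβ : a ≤ β) (hbβ : b ≤ β) : |a ^ p - b ^ p| ≤ p * β ^ (p - 1) * |a - b| := by
  wlog hab : b ≤ a generalizing a b
  · rw [abs_sub_comm, abs_sub_comm a b]
    exact this hb ha hbβ haβ (le_of_not_ge hab)
  rw [abs_of_nonneg (sub_nonneg.2 hab),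
    abs_of_nonneg (sub_nonneg.2 (Real.rpow_le_rpow hb hab (by linarith)))]
  rcases ha.eq_or_lt with rfl | ha0
  · simp [le_antisymm hab hb]
  have h1 := one_add_mul_self_le_rpow_one_add (s := b / a - 1) (by
    have := div_nonneg hb ha; linarith) hp
  rw [add_sub_cancel, Real.div_rpow hb ha, le_div_iff₀ (by positivity)] at h1
  have h2 : a ^ p = a ^ (p - 1) * a := by
    rw [Real.rpow_sub_one ha0.ne']; field_simp
  have h3 : (1 + p * (b / a - 1)) * a ^ p = a ^ p - p * a ^ (p - 1) * (a - b) := by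
    rw [h2]; field_simp; ring
  have h4 : a ^ (p - 1) ≤ β ^ (p - 1) := Real.rpow_le_rpow ha haβ (by linarith)
  have h5 : p * a ^ (p - 1) * (a - b) ≤ p * β ^ (p - 1) * (a - b) := by
    have := sub_nonneg.2 hab
    gcongr
  linarith

theorem sum_signs_rpow_inner_le {b : ι → E} {δ p : ℝ} (hp : 1 ≤ p) (hδ : 0 < δ)
    (hb : ∀ j, ‖b j‖ ≤ δ) (x : (ι → ℤˣ) → E) (hx : ∀ s, ‖x s‖ ≤ 1) :
    ∑ s, ∑ j, ((s j : ℤ) : ℝ) * |inner ℝ (b j) (x s)| ^ p ≤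
      Fintype.card (ι → ℤˣ) * (p * δ ^ p * √(Fintype.card ι)) := by
  have hle : ∀ j (z : Metric.closedBall (0 : E) 1), |inner ℝ (b j) (z : E)| ≤ δ := fun j z ↦ by
    refine (abs_real_inner_le_norm _ _).trans ?_
    have := mem_closedBall_zero_iff.1 z.2
    nlinarith [hb j, norm_nonneg (b j), norm_nonneg (z : E)]
  set L := p * δ ^ (p - 1) with hL
  have hL0 : 0 ≤ L := by positivity
  obtain ⟨y, hy⟩ := sum_signs_contraction
    (fun j (z : Metric.closedBall (0 : E) 1) ↦ |inner ℝ (b j) (z : E)| ^ p)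
    (fun j z ↦ L * inner ℝ (b j) (z : E))
    (fun j z w ↦ by
      refine (abs_rpow_sub_rpow_le hp (abs_nonneg _) (abs_nonneg _) (hle j z) (hle j w)).trans ?_
      rw [← mul_sub, abs_mul, abs_of_nonneg hL0]
      exact mul_le_mul_of_nonneg_left (abs_abs_sub_abs_le_abs_sub _ _) hL0)
    (fun s ↦ ⟨x s, mem_closedBall_zero_iff.2 (hx s)⟩)
  refine hy.trans ?_
  calc ∑ s, ∑ j, ((s j : ℤ) : ℝ) * (L * inner ℝ (b j) (y s : E))
      ≤ ∑ s : ι → ℤˣ, L * ‖∑ j, ((s j : ℤ) : ℝ) • b j‖ := by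
        refine Finset.sum_le_sum fun s _ ↦ ?_
        have h1 : ∑ j, ((s j : ℤ) : ℝ) * (L * inner ℝ (b j) (y s : E)) =
            L * inner ℝ (∑ j, ((s j : ℤ) : ℝ) • b j) (y s : E) := by
          rw [sum_inner, Finset.mul_sum]
          refine Finset.sum_congr rfl fun j _ ↦ ?_
          rw [real_inner_smul_left]; ring
        rw [h1]
        refine mul_le_mul_of_nonneg_left ((real_inner_le_norm _ _).trans ?_) hL0
        exact mul_le_of_le_one_right (norm_nonneg _) (mem_closedBall_zero_iff.1 (y s).2)
    _ ≤ L * (Fintype.card (ι → ℤˣ) * (δ * √(Fintype.card ι))) := by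
        rw [← Finset.mul_sum]
        exact mul_le_mul_of_nonneg_left (sum_signs_norm_le hδ.le hb) hL0
    _ = _ := by
        rw [hL, Real.rpow_sub_one hδ.ne']
        field_simp

/-- Some choice of signs balances the functions `|⟪b j, x⟫| ^ p` uniformly in `x`. -/
theorem exists_signs_abs_sum_rpow_inner_le {b : ι → E} {δ p : ℝ} (hp : 1 ≤ p) (hδ : 0 < δ)
    (hb : ∀ j, ‖b j‖ ≤ δ) :
    ∃ s : ι → ℤˣ, ∀ x : E, |∑ j, ((s j : ℤ) : ℝ) * |inner ℝ (b j) x| ^ p| ≤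
      2 * (p * δ ^ p * √(Fintype.card ι)) * ‖x‖ ^ p := by
  have hp0 : p ≠ 0 := by linarith
  set D := p * δ ^ p * √(Fintype.card ι) with hD
  set Z : (ι → ℤˣ) → E → ℝ := fun s x ↦ ∑ j, ((s j : ℤ) : ℝ) * |inner ℝ (b j) x| ^ p with hZ
  have hZ0 : ∀ s, Z s 0 = 0 := by intro s; simp [hZ, Real.zero_rpow hp0]
  have hZneg : ∀ s x, Z (-s) x = -Z s x := by intro s x; simp [hZ]
  suffices H : ∃ s, ∀ x : E, ‖x‖ ≤ 1 → |Z s x| ≤ 2 * D by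
    obtain ⟨s, hs⟩ := H
    refine ⟨s, fun x ↦ ?_⟩
    rcases eq_or_ne x 0 with rfl | hx
    · simp [Real.zero_rpow hp0]
    have hn : 0 < ‖x‖ := norm_pos_iff.2 hx
    have h1 := hs (‖x‖⁻¹ • x) (by rw [norm_smul, norm_inv, norm_norm, inv_mul_cancel₀ hn.ne'])
    have h2 : Z s x = ‖x‖ ^ p * Z s (‖x‖⁻¹ • x) := by
      simp only [hZ, Finset.mul_sum, real_inner_smul_right]
      refine Finset.sum_congr rfl fun j _ ↦ ?_
      rw [abs_mul, Real.mul_rpow (abs_nonneg _) (abs_nonneg _), abs_inv, abs_norm,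
        Real.inv_rpow hn.le]
      field_simp
    change |Z s x| ≤ _
    rw [h2, abs_mul, abs_of_nonneg (Real.rpow_nonneg hn.le p), mul_comm]
    gcongr
  by_contra! hcon
  choose x hx hxZ using hcon
  have key : ∀ x : (ι → ℤˣ) → E, (∀ s, ‖x s‖ ≤ 1) →
      ∑ s, max (Z s (x s)) 0 ≤ Fintype.card (ι → ℤˣ) * D := by
    intro x hx
    have h := sum_signs_rpow_inner_le hp hδ hb (fun s ↦ if 0 ≤ Z s (x s) then x s else 0)
      (fun s ↦ by split_ifs <;> simp [hx])
    refine Eq.trans_le (Finset.sum_congr rfl fun s _ ↦ ?_) h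
    change _ = Z s _
    split_ifs with hc
    · exact max_eq_left hc
    · rw [hZ0]; exact max_eq_right (not_le.1 hc).le
  have h1 := key x hx
  have h2 := key (fun s ↦ x (-s)) (fun s ↦ hx _)
  rw [← Equiv.sum_comp (Equiv.neg (ι → ℤˣ))] at h2
  simp only [Equiv.neg_apply, neg_neg, hZneg] at h2
  have h3 : ∑ _s : ι → ℤˣ, 2 * D < ∑ s, |Z s (x s)| :=
    Finset.sum_lt_sum_of_nonempty Finset.univ_nonempty fun s _ ↦ hxZ s
  have h4 : ∑ s, |Z s (x s)| = ∑ s, max (Z s (x s)) 0 + ∑ s, max (-Z s (x s)) 0 := by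
    rw [← Finset.sum_add_distrib]
    refine Finset.sum_congr rfl fun s _ ↦ ?_
    rcases le_total 0 (Z s (x s)) with h | h
    · rw [abs_of_nonneg h, max_eq_left h, max_eq_right (by linarith), add_zero]
    · rw [abs_of_nonpos h, max_eq_right h, max_eq_left (by linarith), zero_add]
  rw [Finset.sum_const, nsmul_eq_mul, Finset.card_univ] at h3
  linarith

end Signs

section Halving

variable {ι E : Type*} [NormedAddCommGroup E] [InnerProductSpace ℝ E]

theorem exists_subset_two_mul_card_le_abs_sub_le {b : ι → E} {δ p : ℝ} (hp : 1 ≤ p) (hδ : 0 < δ)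
    (hb : ∀ j, ‖b j‖ ≤ δ) (J : Finset ι) :
    ∃ J' ⊆ J, 2 * J'.card ≤ J.card ∧ ∀ x : E,
      |2 * ∑ j ∈ J', |inner ℝ (b j) x| ^ p - ∑ j ∈ J, |inner ℝ (b j) x| ^ p| ≤
        2 * p * δ ^ p * √J.card * ‖x‖ ^ p := by
  classical
  obtain ⟨s, hs⟩ := exists_signs_abs_sum_rpow_inner_le (b := fun j : J ↦ b j) hp hδ (fun j ↦ hb j)
  set s' : ι → ℤˣ := fun j ↦ if h : j ∈ J then s ⟨j, h⟩ else 1 with hs'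
  have hs'J : ∀ j : J, s' j = s j := fun j ↦ by simp [hs']
  have hsum : ∀ x, ∑ j : J, ((s j : ℤ) : ℝ) * |inner ℝ (b j) x| ^ p =
      ∑ j ∈ J with s' j = 1, |inner ℝ (b j) x| ^ p -
        ∑ j ∈ J with ¬ s' j = 1, |inner ℝ (b j) x| ^ p := fun x ↦ by
    simp only [← hs'J]
    rw [Finset.sum_coe_sort J (fun j ↦ ((s' j : ℤ) : ℝ) * |inner ℝ (b j) x| ^ p),
      ← Finset.sum_filter_add_sum_filter_not J (fun j ↦ s' j = 1), sub_eq_add_neg,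
      ← Finset.sum_neg_distrib]
    congr 1
    · refine Finset.sum_congr rfl fun j hj ↦ ?_
      simp [(Finset.mem_filter.1 hj).2]
    · refine Finset.sum_congr rfl fun j hj ↦ ?_
      simp [(Int.units_eq_one_or (s' j)).resolve_left (Finset.mem_filter.1 hj).2]
  have htot := fun x ↦
    Finset.sum_filter_add_sum_filter_not J (fun j ↦ s' j = 1) (fun j ↦ |inner ℝ (b j) x| ^ p)
  have hcard := Finset.card_filter_add_card_filter_not (s := J) (fun j ↦ s' j = 1)
  simp only [hsum, Fintype.card_coe, ← mul_assoc] at hs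
  rcases le_total (J.filter fun j ↦ s' j = 1).card (J.filter fun j ↦ ¬ s' j = 1).card with h | h
  · refine ⟨J.filter fun j ↦ s' j = 1, Finset.filter_subset _ _, by lia, fun x ↦ ?_⟩
    rw [← htot]
    convert hs x using 2
    ring
  · refine ⟨J.filter fun j ↦ ¬ s' j = 1, Finset.filter_subset _ _, by lia, fun x ↦ ?_⟩
    rw [← htot, abs_sub_comm]
    convert hs x using 2
    ring

theorem exists_subset_card_le_abs_two_pow_mul_sub_le {b : ι → E} {δ p : ℝ} (hp : 1 ≤ p)
    (hδ : 0 < δ) (hb : ∀ j, ‖b j‖ ≤ δ) (m L : ℕ) (J : Finset ι) (hJ : J.card ≤ 2 ^ L * m) :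
    ∃ J' ⊆ J, J'.card ≤ m ∧ ∀ x : E,
      |2 ^ L * ∑ j ∈ J', |inner ℝ (b j) x| ^ p - ∑ j ∈ J, |inner ℝ (b j) x| ^ p| ≤
        6 * p * δ ^ p * √m * (2 ^ L - √2 ^ L) * ‖x‖ ^ p := by
  induction L generalizing J with
  | zero => exact ⟨J, subset_rfl, by simpa using hJ, by simp⟩
  | succ L ih =>
    obtain ⟨J₁, hJ₁, hcard, hbal⟩ := exists_subset_two_mul_card_le_abs_sub_le hp hδ hb J
    obtain ⟨J₂, hJ₂, hcard₂, hbal₂⟩ := ih J₁ (by rw [pow_succ] at hJ; lia)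
    refine ⟨J₂, hJ₂.trans hJ₁, hcard₂, fun x ↦ ?_⟩
    have h1 := hbal x
    have h2 := hbal₂ x
    have hs : √(J.card : ℝ) ≤ √2 ^ (L + 1) * √m := by
      refine Real.sqrt_le_iff.2 ⟨by positivity, ?_⟩
      rw [mul_pow, ← pow_mul, mul_comm (L + 1), pow_mul, Real.sq_sqrt (by positivity),
        Real.sq_sqrt (by positivity)]
      exact_mod_cast hJ
    have hD : 0 ≤ 2 * p * δ ^ p * ‖x‖ ^ p := by positivity
    have h3 : 2 * p * δ ^ p * √J.card * ‖x‖ ^ p ≤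
        2 * p * δ ^ p * ‖x‖ ^ p * (√2 ^ (L + 1) * √m) := by
      rw [mul_right_comm]
      gcongr
    have hr : √2 * √2 = (2 : ℝ) := Real.mul_self_sqrt (by norm_num)
    have hr1 : 4 / 3 ≤ √2 := Real.le_sqrt_of_sq_le (by norm_num)
    have h4 : √2 ^ (L + 1) ≤ 3 * (2 * √2 ^ L - √2 ^ (L + 1)) := by
      have : 0 ≤ √2 ^ L := by positivity
      rw [pow_succ]
      nlinarith [Real.sqrt_le_iff.2 (⟨by norm_num, by norm_num⟩ : (0 : ℝ) ≤ 3 / 2 ∧ 2 ≤ (3 / 2 : ℝ) ^ 2)]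
    have h5 : 2 * p * δ ^ p * ‖x‖ ^ p * (√2 ^ (L + 1) * √m) ≤
        2 * p * δ ^ p * ‖x‖ ^ p * ((3 * (2 * √2 ^ L - √2 ^ (L + 1))) * √m) := by gcongr
    have h6 : 2 ^ (L + 1) * ∑ j ∈ J₂, |inner ℝ (b j) x| ^ p - ∑ j ∈ J, |inner ℝ (b j) x| ^ p =
        2 * (2 ^ L * ∑ j ∈ J₂, |inner ℝ (b j) x| ^ p - ∑ j ∈ J₁, |inner ℝ (b j) x| ^ p) +
        (2 * ∑ j ∈ J₁, |inner ℝ (b j) x| ^ p - ∑ j ∈ J, |inner ℝ (b j) x| ^ p) := by ring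
    rw [h6]
    refine (abs_add_le _ _).trans ?_
    rw [abs_mul, abs_two]
    have h7 : 6 * p * δ ^ p * √m * (2 ^ (L + 1) - √2 ^ (L + 1)) * ‖x‖ ^ p =
        2 * (6 * p * δ ^ p * √m * (2 ^ L - √2 ^ L) * ‖x‖ ^ p) +
        2 * p * δ ^ p * ‖x‖ ^ p * ((3 * (2 * √2 ^ L - √2 ^ (L + 1))) * √m) := by ring
    rw [h7]
    linarith

theorem exists_rpow_sampling {n : ℕ} {u : Fin n → E} {p K ε : ℝ} (hp : 1 ≤ p) (hε : 0 < ε)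
    (hu : ∑ i, ‖u i‖ ^ p = 1) (hK0 : 0 < K)
    (hK : ∀ x, ‖x‖ ^ p ≤ K * ∑ i, |inner ℝ (u i) x| ^ p) {m₀ : ℕ}
    (hm₀ : 72 * p ^ 2 * K ^ 2 / ε ^ 2 ≤ m₀) :
    ∃ (m : ℕ) (σ : Fin m → Fin n) (c : Fin m → ℝ), m ≤ 2 * m₀ ∧ (∀ i, 0 ≤ c i) ∧ ∀ x : E,
      |∑ i, |c i * inner ℝ (u (σ i)) x| ^ p - ∑ i, |inner ℝ (u i) x| ^ p| ≤
        ε * ∑ i, |inner ℝ (u i) x| ^ p := by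
  have hp0 : 0 < p := by linarith
  have hm₀R : (0 : ℝ) < m₀ := lt_of_lt_of_le (by positivity) hm₀
  have hm₀N : 0 < m₀ := by exact_mod_cast hm₀R
  set M : ℝ := 2 ^ n * m₀ with hM
  have hM0 : 0 < M := by positivity
  set k : Fin n → ℕ := fun i ↦ ⌊‖u i‖ ^ p * M⌋₊ + 1 with hk
  have hk0 : ∀ i, (0 : ℝ) < k i := fun i ↦ by simp only [hk]; positivity
  have hkM : ∀ i, ‖u i‖ ^ p * M ≤ k i := fun i ↦ by
    simpa [hk] using (Nat.lt_floor_add_one (‖u i‖ ^ p * M)).le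
  have hroot : ∀ y : ℝ, 0 < y → (y ^ (-(1 / p))) ^ p = y⁻¹ := fun y hy ↦ by
    rw [← Real.rpow_mul hy.le, ← Real.rpow_neg_one]
    congr 1
    field_simp
  set w : Fin n → ℝ := fun i ↦ (k i : ℝ) ^ (-(1 / p)) with hw
  have hw0 : ∀ i, 0 ≤ w i := fun i ↦ Real.rpow_nonneg (hk0 i).le _
  have hwp : ∀ i, w i ^ p = (k i : ℝ)⁻¹ := fun i ↦ hroot _ (hk0 i)
  set b : (Σ i : Fin n, Fin (k i)) → E := fun j ↦ w j.1 • u j.1 with hb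
  have hbp : ∀ j x, |inner ℝ (b j) x| ^ p = (k j.1 : ℝ)⁻¹ * |inner ℝ (u j.1) x| ^ p :=
    fun j x ↦ by
      rw [hb, real_inner_smul_left, abs_mul, abs_of_nonneg (hw0 _),
        Real.mul_rpow (hw0 _) (abs_nonneg _), hwp]
  have hδ : (M ^ (-(1 / p))) ^ p = M⁻¹ := hroot M hM0
  have hbδ : ∀ j, ‖b j‖ ≤ M ^ (-(1 / p)) := fun j ↦ by
    rw [← Real.rpow_le_rpow_iff (norm_nonneg _) (by positivity) hp0, hδ, hb, norm_smul,
      Real.norm_of_nonneg (hw0 _), Real.mul_rpow (hw0 _) (norm_nonneg _), hwp,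
      inv_mul_le_iff₀ (hk0 _), ← div_eq_mul_inv, le_div_iff₀ hM0]
    exact hkM _
  have hcard : (Finset.univ : Finset (Σ i : Fin n, Fin (k i))).card ≤ 2 ^ n * (2 * m₀) := by
    have h1 : ((∑ i, k i : ℕ) : ℝ) ≤ M + n := by
      push_cast
      calc ∑ i, (k i : ℝ) ≤ ∑ i, (‖u i‖ ^ p * M + 1) := Finset.sum_le_sum fun i _ ↦ by
            simp only [hk]
            push_cast
            linarith [Nat.floor_le (show 0 ≤ ‖u i‖ ^ p * M by positivity)]
        _ = M + n := by
            rw [Finset.sum_add_distrib, ← Finset.sum_mul, hu]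
            simp
    have h2 : ∑ i, k i ≤ 2 ^ n * m₀ + n := by
      rw [hM] at h1
      exact_mod_cast h1
    have h3 : n < 2 ^ n := Nat.lt_two_pow_self
    have h4 : 2 ^ n ≤ 2 ^ n * m₀ := Nat.le_mul_of_pos_right _ hm₀N
    simp only [Finset.card_univ, Fintype.card_sigma, Fintype.card_fin]
    lia
  obtain ⟨J, -, hJ, hbal⟩ := exists_subset_card_le_abs_two_pow_mul_sub_le hp
    (show 0 < M ^ (-(1 / p)) by positivity) hbδ (2 * m₀) n Finset.univ hcard
  have htot : ∀ x, ∑ j, |inner ℝ (b j) x| ^ p = ∑ i, |inner ℝ (u i) x| ^ p := fun x ↦ by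
    rw [Fintype.sum_sigma]
    refine Finset.sum_congr rfl fun i _ ↦ ?_
    simp only [hbp, Finset.sum_const, Finset.card_univ, Fintype.card_fin, nsmul_eq_mul]
    rw [mul_inv_cancel_left₀ (hk0 i).ne']
  set a : ℝ := ((2 : ℝ) ^ n)⁻¹ ^ (-(1 / p)) with ha
  have ha0 : 0 ≤ a := by positivity
  have hap : a ^ p = 2 ^ n := by rw [ha, hroot _ (by positivity), inv_inv]
  refine ⟨J.card, fun i ↦ (J.equivFin.symm i).1.1, fun i ↦ a * w (J.equivFin.symm i).1.1, hJ,
    fun i ↦ mul_nonneg ha0 (hw0 _), fun x ↦ ?_⟩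
  have hsum : ∑ i, |a * w (J.equivFin.symm i).1.1 * inner ℝ (u (J.equivFin.symm i).1.1) x| ^ p =
      2 ^ n * ∑ j ∈ J, |inner ℝ (b j) x| ^ p := by
    rw [Equiv.sum_comp J.equivFin.symm (fun j : J ↦ |a * w j.1.1 * inner ℝ (u j.1.1) x| ^ p),
      Finset.sum_coe_sort J (fun j ↦ |a * w j.1 * inner ℝ (u j.1) x| ^ p), Finset.mul_sum]
    refine Finset.sum_congr rfl fun j _ ↦ ?_
    rw [hb, real_inner_smul_left, mul_assoc, abs_mul, Real.mul_rpow (abs_nonneg _) (abs_nonneg _),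
      abs_of_nonneg ha0, hap]
  rw [hsum, ← htot]
  refine (hbal x).trans ?_
  rw [htot, hδ]
  set G := ∑ i, |inner ℝ (u i) x| ^ p
  have hG0 : 0 ≤ G := Finset.sum_nonneg fun i _ ↦ by positivity
  have hmain : 6 * p * √(2 * m₀) * K ≤ ε * m₀ := by
    refine abs_le_of_sq_le_sq' ?_ (by positivity) |>.2
    rw [div_le_iff₀ (by positivity)] at hm₀
    rw [mul_pow, mul_pow, Real.sq_sqrt (by positivity)]
    nlinarith
  calc 6 * p * M⁻¹ * √((2 * m₀ : ℕ) : ℝ) * (2 ^ n - √2 ^ n) * ‖x‖ ^ p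
      ≤ 6 * p * M⁻¹ * √((2 * m₀ : ℕ) : ℝ) * 2 ^ n * (K * G) := by
        have : (0 : ℝ) ≤ √2 ^ n := by positivity
        gcongr
        · linarith
        · exact hK x
    _ = (6 * p * √(2 * m₀) * K) * (M⁻¹ * 2 ^ n) * G := by push_cast; ring
    _ ≤ (ε * m₀) * (M⁻¹ * 2 ^ n) * G := by gcongr
    _ = ε * G := by rw [hM]; field_simp

end Halving

section Lewis

variable {E : Type*} [NormedAddCommGroup E] [InnerProductSpace ℝ E] [FiniteDimensional ℝ E]
  {ι : Type*} [Fintype ι]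

theorem isCompact_setOf_sum_norm_rpow_le_one {a : ι → E}
    (ha : Submodule.span ℝ (Set.range a) = ⊤) {p : ℝ} (hp : 0 < p) :
    IsCompact {T : E →L[ℝ] E | ∑ i, ‖T (a i)‖ ^ p ≤ 1} := by
  have : ProperSpace (E →L[ℝ] E) := FiniteDimensional.proper_real _
  refine Metric.isCompact_of_isClosed_isBounded ?_ ?_
  · refine isClosed_le (continuous_finsetSum _ fun i _ ↦ ?_) continuous_const
    exact Continuous.rpow_const (by fun_prop) fun _ ↦ Or.inr hp.le
  · let φ : (E →L[ℝ] E) →ₗ[ℝ] (ι → E) :=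
      { toFun := fun T i ↦ T (a i)
        map_add' := fun _ _ ↦ rfl
        map_smul' := fun _ _ ↦ rfl }
    have hφ : Function.Injective φ := fun S T h ↦ by
      ext x
      have := LinearMap.ext_on_range (f := (S : E →ₗ[ℝ] E)) (g := (T : E →ₗ[ℝ] E)) ha
        (fun i ↦ congrFun h i)
      exact LinearMap.congr_fun this x
    obtain ⟨K, _, hK⟩ := (LinearMap.injective_iff_antilipschitz φ).1 hφ
    refine (hK.isBounded_preimage (Metric.isBounded_closedBall (x := 0) (r := 1))).subset ?_
    intro T hT
    rw [Set.mem_preimage, mem_closedBall_zero_iff, pi_norm_le_iff_of_nonneg zero_le_one]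
    intro i
    have h1 : ‖T (a i)‖ ^ p ≤ 1 :=
      (Finset.single_le_sum (f := fun i ↦ ‖T (a i)‖ ^ p) (fun i _ ↦ by positivity)
        (Finset.mem_univ i)).trans hT
    by_contra! h
    exact h1.not_gt (Real.one_lt_rpow h hp)

/-- A linear change of variables putting a spanning family into Lewis position, obtained by
maximizing the determinant. -/
theorem exists_lewis_position [Nontrivial E] {a : ι → E}
    (ha : Submodule.span ℝ (Set.range a) = ⊤) {p : ℝ} (hp : 0 < p) :
    ∃ T : E →L[ℝ] E, T.det ≠ 0 ∧ ∑ i, ‖T (a i)‖ ^ p = 1 ∧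
      ∀ v : E, ‖v‖ ^ 2 =
        Module.finrank ℝ E * ∑ i, ‖T (a i)‖ ^ (p - 2) * inner ℝ (T (a i)) v ^ 2 := by
  set r := Module.finrank ℝ E with hr
  have hr0 : 0 < r := Module.finrank_pos
  have hrR : (0 : ℝ) < r := Nat.cast_pos.2 hr0
  set f : (E →L[ℝ] E) → ℝ := fun T ↦ ∑ i, ‖T (a i)‖ ^ p with hf
  have hf0 : ∀ S, 0 ≤ f S := fun S ↦ Finset.sum_nonneg fun i _ ↦ by positivity
  have hfsmul : ∀ (c : ℝ) S, 0 ≤ c → f (c • S) = c ^ p * f S := fun c S hc ↦ by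
    simp only [hf, Finset.mul_sum]
    refine Finset.sum_congr rfl fun i _ ↦ ?_
    rw [_root_.smul_apply, norm_smul, Real.norm_of_nonneg hc,
      Real.mul_rpow hc (norm_nonneg _)]
  have hdet : ∀ (c : ℝ) (S : E →L[ℝ] E), (c • S).det = c ^ r * S.det := fun c S ↦ by
    simp [ContinuousLinearMap.det, hr]
  have hfpos : ∀ S : E →L[ℝ] E, S.det ≠ 0 → 0 < f S := fun S hS ↦ by
    refine (hf0 S).lt_of_ne fun h ↦ hS ?_
    have h0 : S = 0 := by
      have hz := (Finset.sum_eq_zero_iff_of_nonneg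
        (fun i _ ↦ Real.rpow_nonneg (norm_nonneg (S (a i))) p)).1 h.symm
      ext x
      refine LinearMap.congr_fun
        (LinearMap.ext_on_range (f := (S : E →ₗ[ℝ] E)) (g := (0 : E →ₗ[ℝ] E)) ha fun i ↦ ?_) x
      simpa [Real.rpow_eq_zero (norm_nonneg _) hp.ne'] using hz i (Finset.mem_univ i)
    have := hdet 0 S
    rwa [zero_smul, zero_pow hr0.ne', zero_mul, ← h0] at this
  have hscale : ∀ S : E →L[ℝ] E, f ((f S + 1) ^ (-(1 / p)) • S) ≤ 1 := fun S ↦ by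
    have := hf0 S
    rw [hfsmul _ _ (by positivity), ← Real.rpow_mul (by positivity)]
    have h1 : -(1 / p) * p = -1 := by field_simp
    rw [h1, Real.rpow_neg_one, inv_mul_le_iff₀ (by positivity)]
    linarith
  obtain ⟨T, hT, hTmax⟩ := (isCompact_setOf_sum_norm_rpow_le_one ha hp).exists_isMaxOn
    ⟨_, hscale 0⟩ (f := fun S ↦ |S.det|) (ContinuousLinearMap.continuous_det.abs.continuousOn)
  replace hTmax : ∀ S, f S ≤ 1 → |S.det| ≤ |T.det| := fun S hS ↦ hTmax hS
  have hTdet : 0 < |T.det| := by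
    refine lt_of_lt_of_le ?_ (hTmax _ (hscale (ContinuousLinearMap.id ℝ E)))
    have := hf0 (ContinuousLinearMap.id ℝ E)
    rw [hdet]
    simp only [ContinuousLinearMap.det, ContinuousLinearMap.coe_id, LinearMap.det_id, mul_one]
    positivity
  have hbound : ∀ S : E →L[ℝ] E, S.det ≠ 0 → (|S.det| / |T.det|) ^ (p / r) ≤ f S := fun S hS ↦ by
    have hS0 := hfpos S hS
    have hc : (f S ^ (-(1 / p))) ^ p = (f S)⁻¹ := by
      rw [← Real.rpow_mul hS0.le, ← Real.rpow_neg_one]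
      congr 1
      field_simp
    have h1 := hTmax (f S ^ (-(1 / p)) • S) (by
      rw [hfsmul _ _ (by positivity), hc, inv_mul_cancel₀ hS0.ne'])
    rw [hdet, abs_mul, abs_of_nonneg (by positivity)] at h1
    have h2 : |S.det| / |T.det| ≤ (f S ^ (1 / p)) ^ r := by
      rw [div_le_iff₀ hTdet]
      rw [Real.rpow_neg hS0.le, inv_pow, inv_mul_le_iff₀ (by positivity)] at h1
      exact h1
    refine (Real.rpow_le_rpow (by positivity) h2 (by positivity)).trans_eq ?_
    rw [← Real.rpow_natCast, ← Real.rpow_mul hS0.le, ← Real.rpow_mul hS0.le]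
    rw [show 1 / p * r * (p / r) = 1 by field_simp, Real.rpow_one]
  have hT1 : f T = 1 := by
    refine le_antisymm hT ?_
    have := hbound T (abs_pos.1 hTdet)
    rwa [div_self hTdet.ne', Real.one_rpow] at this
  refine ⟨T, abs_pos.1 hTdet, hT1, ?_⟩
  suffices H : ∀ v : E, ‖v‖ = 1 →
      r * ∑ i, ‖T (a i)‖ ^ (p - 2) * inner ℝ (T (a i)) v ^ 2 = 1 by
    intro v
    rcases eq_or_ne v 0 with rfl | hv
    · simp
    have hn : 0 < ‖v‖ := norm_pos_iff.2 hv
    have h1 := H (‖v‖⁻¹ • v) (by rw [norm_smul, norm_inv, norm_norm, inv_mul_cancel₀ hn.ne'])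
    simp only [real_inner_smul_right, mul_pow] at h1
    rw [← mul_one (‖v‖ ^ 2), ← h1, mul_left_comm, Finset.mul_sum]
    congr 1
    refine Finset.sum_congr rfl fun i _ ↦ ?_
    field_simp
  intro v hv
  set S : ℝ → (E →L[ℝ] E) := fun t ↦ T + t • (innerSL ℝ v ∘L T).smulRight v with hS
  have hSdet : ∀ t, (S t).det = (1 + t) * T.det := fun t ↦ by
    have h1 : ((S t : E →L[ℝ] E) : E →ₗ[ℝ] E) =
        LinearMap.transvection ((innerSL ℝ v : E →L[ℝ] ℝ) : E →ₗ[ℝ] ℝ) (t • v) ∘ₗ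
          (T : E →ₗ[ℝ] E) := by
      ext x
      simp [hS, LinearMap.transvection, smul_smul, mul_comm]
    rw [ContinuousLinearMap.det, h1, LinearMap.det_comp, LinearMap.transvection.det]
    simp [hv, ContinuousLinearMap.det]
  have hSf : ∀ t, f (S t) =
      ∑ i, (‖T (a i)‖ ^ 2 + (2 * t + t ^ 2) * inner ℝ (T (a i)) v ^ 2) ^ (p / 2) := fun t ↦ by
    refine Finset.sum_congr rfl fun i _ ↦ ?_
    have h1 : ‖S t (a i)‖ ^ 2 =
        ‖T (a i)‖ ^ 2 + (2 * t + t ^ 2) * inner ℝ (T (a i)) v ^ 2 := by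
      have : S t (a i) = T (a i) + (t * inner ℝ (T (a i)) v) • v := by
        simp [hS, smul_smul, real_inner_comm]
      rw [this, norm_add_sq_real, real_inner_smul_right, norm_smul, hv, mul_one, Real.norm_eq_abs,
        sq_abs]
      ring
    rw [← h1, ← Real.rpow_natCast, ← Real.rpow_mul (norm_nonneg _)]
    congr 1
    push_cast
    ring
  have hmin : IsLocalMin (fun t ↦ f (S t) - (1 + t) ^ (p / r)) 0 := by
    have hmem : Set.Ioi (-1 : ℝ) ∈ nhds 0 := Ioi_mem_nhds (by norm_num)
    filter_upwards [hmem] with t ht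
    have ht' : 0 < 1 + t := by linarith [Set.mem_Ioi.1 ht]
    have h0 : S 0 = T := by simp [hS]
    have h1 := hbound (S t) (by rw [hSdet]; exact mul_ne_zero ht'.ne' (abs_pos.1 hTdet))
    rw [hSdet, abs_mul, mul_div_assoc, div_self hTdet.ne', mul_one, abs_of_pos ht'] at h1
    simp only [h0, hT1, add_zero, Real.one_rpow, sub_self]
    linarith
  have hderiv : HasDerivAt (fun t ↦ f (S t) - (1 + t) ^ (p / r))
      (∑ i, p * (‖T (a i)‖ ^ (p - 2) * inner ℝ (T (a i)) v ^ 2) - p / r) 0 := by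
    refine HasDerivAt.sub ?_ ?_
    · simp only [hSf]
      refine HasDerivAt.fun_sum fun i _ ↦ ?_
      rcases eq_or_ne (T (a i)) 0 with h | h
      · simp only [h, inner_zero_left, norm_zero]
        simpa using hasDerivAt_const (0 : ℝ) ((0 : ℝ) ^ (p / 2))
      have hn : 0 < ‖T (a i)‖ := norm_pos_iff.2 h
      have h1 : HasDerivAt (fun t : ℝ ↦ 2 * t + t ^ 2) 2 0 := by
        have := ((hasDerivAt_id (0 : ℝ)).const_mul 2).fun_add (hasDerivAt_pow 2 (0 : ℝ))
        simpa using this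
      have h2 := ((h1.mul_const (inner ℝ (T (a i)) v ^ 2)).const_add (‖T (a i)‖ ^ 2)).rpow_const
        (p := p / 2) (Or.inl (by simp [hn.ne']))
      refine h2.congr_deriv ?_
      have h3 : (‖T (a i)‖ ^ 2) ^ (p / 2 - 1) = ‖T (a i)‖ ^ (p - 2) := by
        rw [← Real.rpow_natCast, ← Real.rpow_mul hn.le]
        congr 1
        push_cast
        ring
      simp only [mul_zero, ne_eq, OfNat.ofNat_ne_zero, not_false_eq_true, zero_pow, add_zero,
        zero_mul, h3]
      ring
    · have h2 := ((hasDerivAt_id (0 : ℝ)).const_add 1).rpow_const (p := p / r)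
        (Or.inl (by simp))
      simpa using h2
  have h := hmin.hasDerivAt_eq_zero hderiv
  rw [← Finset.mul_sum, sub_eq_zero] at h
  field_simp at h
  linarith

theorem norm_rpow_le_of_lewis_of_le_two {u : ι → E} {p r : ℝ} (hp : 1 ≤ p) (hp2 : p ≤ 2)
    (hr : 0 ≤ r) {x : E}
    (hx : ‖x‖ ^ 2 = r * ∑ i, ‖u i‖ ^ (p - 2) * inner ℝ (u i) x ^ 2) :
    ‖x‖ ^ p ≤ r * ∑ i, |inner ℝ (u i) x| ^ p := by
  rcases eq_or_ne x 0 with rfl | hx0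
  · rw [norm_zero, Real.zero_rpow (by linarith)]
    positivity
  have hn : 0 < ‖x‖ := norm_pos_iff.2 hx0
  have hterm : ∀ i, ‖u i‖ ^ (p - 2) * inner ℝ (u i) x ^ 2 ≤
      ‖x‖ ^ (2 - p) * |inner ℝ (u i) x| ^ p := fun i ↦ by
    rcases eq_or_ne (u i) 0 with h | h
    · simp only [h, inner_zero_left]
      simp only [ne_eq, OfNat.ofNat_ne_zero, not_false_eq_true, zero_pow, mul_zero]
      positivity
    have hu : 0 < ‖u i‖ := norm_pos_iff.2 h
    have h1 : |inner ℝ (u i) x| ^ (2 - p) ≤ (‖u i‖ * ‖x‖) ^ (2 - p) :=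
      Real.rpow_le_rpow (abs_nonneg _) (abs_real_inner_le_norm _ _) (by linarith)
    have h2 : inner ℝ (u i) x ^ 2 = |inner ℝ (u i) x| ^ (2 - p) * |inner ℝ (u i) x| ^ p := by
      rw [← Real.rpow_add_of_nonneg (abs_nonneg _) (by linarith) (by linarith), sub_add_cancel,
        Real.rpow_two, sq_abs]
    have h3 : ‖u i‖ ^ (p - 2) * ‖u i‖ ^ (2 - p) = 1 := by
      rw [← Real.rpow_add hu, sub_add_sub_cancel, sub_self, Real.rpow_zero]
    rw [h2, ← mul_assoc]
    refine mul_le_mul_of_nonneg_right ?_ (by positivity)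
    calc _ ≤ ‖u i‖ ^ (p - 2) * (‖u i‖ * ‖x‖) ^ (2 - p) := by gcongr
      _ = ‖x‖ ^ (2 - p) := by
        rw [Real.mul_rpow hu.le hn.le, ← mul_assoc, h3, one_mul]
  have hsum := Finset.sum_le_sum fun i (_ : i ∈ Finset.univ) ↦ hterm i
  rw [← Finset.mul_sum] at hsum
  have h4 : ‖x‖ ^ 2 = ‖x‖ ^ (2 - p) * ‖x‖ ^ p := by
    rw [← Real.rpow_add hn, sub_add_cancel, Real.rpow_two]
  have h5 : ‖x‖ ^ (2 - p) * ‖x‖ ^ p ≤ ‖x‖ ^ (2 - p) * (r * ∑ i, |inner ℝ (u i) x| ^ p) := by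
    rw [← h4, hx, mul_left_comm]
    gcongr
  exact le_of_mul_le_mul_left h5 (by positivity)

theorem norm_rpow_le_of_lewis_of_two_le {u : ι → E} {p r : ℝ} (hp2 : 2 ≤ p) (hr : 0 ≤ r)
    (hu : ∑ i, ‖u i‖ ^ p = 1) {x : E}
    (hx : ‖x‖ ^ 2 = r * ∑ i, ‖u i‖ ^ (p - 2) * inner ℝ (u i) x ^ 2) :
    ‖x‖ ^ p ≤ r ^ (p / 2) * ∑ i, |inner ℝ (u i) x| ^ p := by
  have hp0 : 0 < p := by linarith
  set G := ∑ i, |inner ℝ (u i) x| ^ p with hG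
  have hG0 : 0 ≤ G := Finset.sum_nonneg fun i _ ↦ by positivity
  have hpow : ∀ y : ℝ, (|y| ^ p) ^ (2 / p) = y ^ 2 := fun y ↦ by
    rw [← Real.rpow_mul (abs_nonneg _), mul_div_cancel₀ _ hp0.ne', Real.rpow_two, sq_abs]
  have hsum : ∑ i, ‖u i‖ ^ (p - 2) * inner ℝ (u i) x ^ 2 ≤ G ^ (2 / p) := by
    rcases hG0.eq_or_lt with h0 | hGpos
    · have hz := (Finset.sum_eq_zero_iff_of_nonneg
        (fun i _ ↦ Real.rpow_nonneg (abs_nonneg (inner ℝ (u i) x)) p)).1 h0.symm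
      refine (Finset.sum_eq_zero fun i hi ↦ ?_).trans_le (Real.rpow_nonneg hG0 _)
      rw [← hpow, hz i hi, Real.zero_rpow (by positivity), mul_zero]
    have hterm : ∀ i, ‖u i‖ ^ (p - 2) * (inner ℝ (u i) x ^ 2 / G ^ (2 / p)) ≤
        (p - 2) / p * ‖u i‖ ^ p + 2 / p * (|inner ℝ (u i) x| ^ p / G) := fun i ↦ by
      have h := Real.geom_mean_le_arith_mean2_weighted (w₁ := (p - 2) / p) (w₂ := 2 / p)
        (p₁ := ‖u i‖ ^ p) (p₂ := |inner ℝ (u i) x| ^ p / G)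
        (div_nonneg (by linarith) hp0.le) (by positivity) (by positivity) (by positivity)
        (by field_simp; ring)
      rwa [← Real.rpow_mul (norm_nonneg _), mul_div_cancel₀ _ hp0.ne',
        Real.div_rpow (by positivity) hG0, hpow] at h
    have h1 := Finset.sum_le_sum fun i (_ : i ∈ Finset.univ) ↦ hterm i
    rw [Finset.sum_add_distrib, ← Finset.mul_sum, ← Finset.mul_sum, ← Finset.sum_div, hu, ← hG,
      div_self hGpos.ne'] at h1
    simp only [← mul_div_assoc] at h1
    rw [← Finset.sum_div, div_le_iff₀ (by positivity)] at h1
    refine h1.trans_eq ?_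
    field_simp
    ring
  have h1 : ‖x‖ ^ 2 ≤ r * G ^ (2 / p) := by
    rw [hx]
    gcongr
  have h2 := Real.rpow_le_rpow (by positivity) h1 (show 0 ≤ p / 2 by positivity)
  rw [Real.mul_rpow hr (by positivity), ← Real.rpow_mul hG0, ← Real.rpow_natCast,
    ← Real.rpow_mul (norm_nonneg _)] at h2
  convert h2 using 2
  · push_cast; ring
  · rw [show 2 / p * (p / 2) = 1 by field_simp, Real.rpow_one]

end Lewis

section Assembly

theorem exists_inner_eq_mulVec_of_det_ne_zero {n d : ℕ} (A : Matrix (Fin n) (Fin d) ℝ)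
    {W : Submodule ℝ (EuclideanSpace ℝ (Fin d))} {a : Fin n → W}
    (ha : ∀ i, (a i : EuclideanSpace ℝ (Fin d)) = WithLp.toLp 2 (A i)) {T : W →L[ℝ] W}
    (hT : T.det ≠ 0) (x : Fin d → ℝ) : ∃ z : W, ∀ i, inner ℝ (T (a i)) z = A.mulVec x i := by
  let e : W ≃ₗ[ℝ] W := LinearMap.equivOfDetNeZero (T : W →ₗ[ℝ] W) hT
  refine ⟨LinearMap.adjoint (e.symm : W →ₗ[ℝ] W) (W.orthogonalProjectionOnto (WithLp.toLp 2 x)),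
    fun i ↦ ?_⟩
  have he : e.symm (T (a i)) = a i := e.symm_apply_apply (a i)
  rw [LinearMap.adjoint_inner_right, LinearEquiv.coe_coe, he,
    Submodule.inner_orthogonalProjectionOnto_eq_of_mem_left, ha, EuclideanSpace.inner_toLp_toLp]
  simp [Matrix.mulVec, dotProduct_comm]

theorem lpNorm_bounds_of_abs_sub_le {m n : ℕ} {p ε : ℝ} (hp : 1 ≤ p) (hε : 0 ≤ ε) (hε1 : ε < 1)
    {v : Fin m → ℝ} {w : Fin n → ℝ}
    (h : |∑ i, |v i| ^ p - ∑ i, |w i| ^ p| ≤ ε * ∑ i, |w i| ^ p) :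
    (1 - ε) * lpNorm p w ≤ lpNorm p v ∧ lpNorm p v ≤ (1 + ε) * lpNorm p w := by
  have hp0 : 0 < p := by linarith
  have hp1 : 1 / p ≤ 1 := (div_le_one hp0).2 hp
  have hv : 0 ≤ ∑ i, |v i| ^ p := Finset.sum_nonneg fun i _ ↦ by positivity
  have hw : 0 ≤ ∑ i, |w i| ^ p := Finset.sum_nonneg fun i _ ↦ by positivity
  obtain ⟨h1, h2⟩ := abs_le.1 h
  have hlow : 0 < 1 - ε := by linarith
  unfold lpNorm
  constructor
  · calc (1 - ε) * (∑ i, |w i| ^ p) ^ (1 / p)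
        ≤ (1 - ε) ^ (1 / p) * (∑ i, |w i| ^ p) ^ (1 / p) := by
          gcongr
          simpa using Real.rpow_le_rpow_of_exponent_ge hlow (by linarith) hp1
      _ = ((1 - ε) * ∑ i, |w i| ^ p) ^ (1 / p) := (Real.mul_rpow hlow.le hw).symm
      _ ≤ _ := Real.rpow_le_rpow (by positivity) (by linarith) (by positivity)
  · calc (∑ i, |v i| ^ p) ^ (1 / p)
        ≤ ((1 + ε) * ∑ i, |w i| ^ p) ^ (1 / p) :=
          Real.rpow_le_rpow hv (by linarith) (by positivity)
      _ = (1 + ε) ^ (1 / p) * (∑ i, |w i| ^ p) ^ (1 / p) := Real.mul_rpow (by linarith) hw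
      _ ≤ _ := by
          gcongr
          simpa using Real.rpow_le_rpow_of_exponent_le (by linarith : 1 ≤ 1 + ε) hp1

/-- Row sampling for `ℓ_p` with `O(d ^ max 2 p / ε ^ 2)` rows. -/
theorem exists_rows_lpNorm_approx {n d : ℕ} (A : Matrix (Fin n) (Fin d) ℝ) {p ε : ℝ} (hp : 1 ≤ p)
    (hε : 0 < ε) (hε1 : ε < 1) :
    ∃ (m : ℕ) (σ : Fin m → Fin n) (c : Fin m → ℝ),
      (m : ℝ) ≤ 146 * p ^ 2 * (d : ℝ) ^ max 2 p / ε ^ 2 ∧ (∀ i, 0 ≤ c i) ∧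
      ∀ x : Fin d → ℝ,
        (1 - ε) * lpNorm p (A.mulVec x) ≤ lpNorm p (fun i ↦ c i * A.mulVec x (σ i)) ∧
        lpNorm p (fun i ↦ c i * A.mulVec x (σ i)) ≤ (1 + ε) * lpNorm p (A.mulVec x) := by
  have hp0 : 0 < p := by linarith
  set W := Submodule.span ℝ (Set.range fun i ↦ (WithLp.toLp 2 (A i) : EuclideanSpace ℝ (Fin d)))
    with hW
  set a : Fin n → W := fun i ↦ ⟨WithLp.toLp 2 (A i), Submodule.subset_span ⟨i, rfl⟩⟩ with ha
  have hspan : Submodule.span ℝ (Set.range a) = ⊤ := by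
    refine Submodule.map_injective_of_injective W.injective_subtype ?_
    rw [Submodule.map_span, ← Set.range_comp, Submodule.map_subtype_top]
    rfl
  rcases subsingleton_or_nontrivial W with hsub | hnt
  · refine ⟨0, Fin.elim0, Fin.elim0, by rw [Nat.cast_zero]; positivity, fun i ↦ i.elim0, fun x ↦ ?_⟩
    refine lpNorm_bounds_of_abs_sub_le hp hε.le hε1 ?_
    have hA : ∀ i, A i = 0 := fun i ↦ by
      have := congrArg (fun z : W ↦ WithLp.ofLp (z : EuclideanSpace ℝ (Fin d)))
        (Subsingleton.elim (a i) 0)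
      simpa [ha] using this
    have hAx : ∀ i, A.mulVec x i = 0 := fun i ↦ by simp [Matrix.mulVec, hA i]
    simp [hAx, Real.zero_rpow hp0.ne']
  obtain ⟨T, hTdet, hT1, hTv⟩ := exists_lewis_position hspan hp0
  set r := Module.finrank ℝ W with hr
  have hr1 : (1 : ℝ) ≤ r := by exact_mod_cast (Module.finrank_pos : 0 < r)
  have hrd : (r : ℝ) ≤ d := by
    exact_mod_cast (Submodule.finrank_le W).trans_eq (finrank_euclideanSpace_fin (𝕜 := ℝ))
  set K : ℝ := (r : ℝ) ^ max 1 (p / 2) with hK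
  have hK1 : 1 ≤ K := Real.one_le_rpow hr1 (le_max_of_le_left zero_le_one)
  have hKbound : ∀ x : W, ‖x‖ ^ p ≤ K * ∑ i, |inner ℝ (T (a i)) x| ^ p := fun x ↦ by
    rcases le_total p 2 with h | h
    · rw [hK, max_eq_left (by linarith), Real.rpow_one]
      exact norm_rpow_le_of_lewis_of_le_two hp h (by linarith) (hTv x)
    · rw [hK, max_eq_right (by linarith)]
      exact norm_rpow_le_of_lewis_of_two_le h (by linarith) hT1 (hTv x)
  obtain ⟨m, σ, c, hm, hc, happ⟩ := exists_rpow_sampling hp hε hT1 (zero_lt_one.trans_le hK1)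
    hKbound (Nat.le_ceil (72 * p ^ 2 * K ^ 2 / ε ^ 2))
  refine ⟨m, σ, c, ?_, hc, fun x ↦ ?_⟩
  · have hKd : K ^ 2 ≤ (d : ℝ) ^ max 2 p := by
      rw [hK, ← Real.rpow_natCast, ← Real.rpow_mul (by linarith), max_mul_of_nonneg _ _ (by simp)]
      push_cast
      rw [one_mul, div_mul_cancel₀ _ two_ne_zero]
      exact Real.rpow_le_rpow (by linarith) hrd (by positivity)
    have h1 := Nat.ceil_lt_add_one (show 0 ≤ 72 * p ^ 2 * K ^ 2 / ε ^ 2 by positivity)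
    have h2 : (m : ℝ) ≤ 2 * ⌈72 * p ^ 2 * K ^ 2 / ε ^ 2⌉₊ := by exact_mod_cast hm
    have h3 : 1 ≤ p ^ 2 * K ^ 2 / ε ^ 2 := by
      rw [one_le_div (by positivity)]
      calc ε ^ 2 ≤ 1 := by nlinarith
        _ ≤ p ^ 2 * K ^ 2 := one_le_mul_of_one_le_of_one_le (one_le_pow₀ hp) (one_le_pow₀ hK1)
    calc (m : ℝ) ≤ 146 * p ^ 2 * K ^ 2 / ε ^ 2 := by
          rw [mul_assoc, mul_div_assoc] at h1 h2 ⊢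
          linarith
      _ ≤ _ := by gcongr
  · obtain ⟨z, hz⟩ := exists_inner_eq_mulVec_of_det_ne_zero A (a := a) (fun i ↦ rfl) hTdet x
    have := happ z
    simp only [hz] at this
    exact lpNorm_bounds_of_abs_sub_le hp hε.le hε1 this

end Assembly

/-- For every `θ > 0` and `1 ≤ p < 4` there is a constant `C > 0` such that every `n × d`
matrix `A` and `ε ∈ (0, 1/7]` admit an ℓ_p `(1 ± ε)`-approximation `B` whose rows are
nonnegative multiples of rows of `A`, with `m ≤ C·d^(4/p + θ)·ε⁻²` if `1 ≤ p ≤ 2` and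
`m ≤ C·d^((3/2)p − 1 + θ)·ε⁻²` if `2 ≤ p < 4`. -/
theorem lp_row_sampling (θ : ℝ) (hθ : 0 < θ) (p : ℝ) (hp1 : 1 ≤ p) (hp4 : p < 4) :
    ∃ C : ℝ, 0 < C ∧
      ∀ (n d : ℕ) (A : Matrix (Fin n) (Fin d) ℝ) (ε : ℝ), 0 < ε → ε ≤ 1 / 7 →
        ∃ (m : ℕ) (B : Matrix (Fin m) (Fin d) ℝ) (σ : Fin m → Fin n) (c : Fin m → ℝ),
          ((p ≤ 2 → (m : ℝ) ≤ C * (d : ℝ) ^ (4 / p + θ) / ε ^ 2) ∧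
           (2 ≤ p → (m : ℝ) ≤ C * (d : ℝ) ^ (3 / 2 * p - 1 + θ) / ε ^ 2)) ∧
          (∀ i, 0 ≤ c i) ∧
          (∀ i j, B i j = c i * A (σ i) j) ∧
          (∀ x : Fin d → ℝ,
            (1 - ε) * lpNorm p (A.mulVec x) ≤ lpNorm p (B.mulVec x) ∧
            lpNorm p (B.mulVec x) ≤ (1 + ε) * lpNorm p (A.mulVec x)) := by
  have hp0 : 0 < p := by linarith
  refine ⟨146 * p ^ 2, by positivity, fun n d A ε hε hε7 ↦ ?_⟩
  obtain ⟨m, σ, c, hm, hc, happ⟩ := exists_rows_lpNorm_approx A hp1 hε (by linarith)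
  have hexp : ∀ q, max 2 p ≤ q → (m : ℝ) ≤ 146 * p ^ 2 * (d : ℝ) ^ q / ε ^ 2 := fun q hq ↦ by
    refine hm.trans ?_
    have hmax : 0 < max 2 p := lt_max_of_lt_left two_pos
    have : (d : ℝ) ^ max 2 p ≤ (d : ℝ) ^ q := by
      rcases Nat.eq_zero_or_pos d with rfl | hd
      · rw [Nat.cast_zero, Real.zero_rpow hmax.ne', Real.zero_rpow (hmax.trans_le hq).ne']
      · exact Real.rpow_le_rpow_of_exponent_le (by exact_mod_cast hd) hq
    gcongr
  refine ⟨m, fun i j ↦ c i * A (σ i) j, σ, c, ⟨fun h ↦ hexp _ ?_, fun h ↦ hexp _ ?_⟩, hc,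
    fun _ _ ↦ rfl, fun x ↦ ?_⟩
  · have : 2 ≤ 4 / p := by
      rw [le_div_iff₀ hp0]
      linarith
    exact max_le (by linarith) (by linarith)
  · exact max_le (by linarith) (by linarith)
  · have hB : Matrix.mulVec (fun i j ↦ c i * A (σ i) j) x = fun i ↦ c i * A.mulVec x (σ i) := by
      ext i
      simp [Matrix.mulVec, dotProduct, Finset.mul_sum, mul_assoc]
    rw [hB]
    exact happ x
end

section
/- For every θ > 0 and every real p ∈ [1, ∞) there exists a constant C = C(θ, p) > 0 such that for every n × d real matrix A and every ε ∈ (0, 1/7], there exist a natural number m and an m × d real matrix B each of whose rows is a nonnegative scalar multiple of some row of A, such that (1 − ε)‖Ax‖_p ≤ ‖Bx‖_p ≤ (1 + ε)‖Ax‖_p for all x ∈ ℝᵈ, where m ≤ C · n^{1 − p/2} · d^{2 + θ} · ε⁻² if 1 ≤ p ≤ 2, and m ≤ C · n^{p/2 − 1} · d^{(3/2)p − 1 + θ} · ε⁻² if p ≥ 2. -/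
open Matrix BigOperators

open MeasureTheory Metric Module in
theorem card_le_of_separated_of_norm_le_one {E : Type*} [NormedAddCommGroup E] [NormedSpace ℝ E]
    [FiniteDimensional ℝ E] {t : ℝ} (ht : 0 < t) (s : Finset E) (hs : ∀ x ∈ s, ‖x‖ ≤ 1)
    (h : ∀ x ∈ s, ∀ y ∈ s, x ≠ y → t ≤ ‖x - y‖) :
    (s.card : ℝ) ≤ (1 + 2 / t) ^ finrank ℝ E := by
  borelize E
  let μ : Measure E := Measure.addHaar
  have hδ : 0 < t / 2 := by positivity
  have hρ : 0 < 1 + t / 2 := by positivity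
  have D : Set.Pairwise (s : Set E) (Function.onFun Disjoint fun c => ball (c : E) (t / 2)) := by
    rintro c hc d hd hcd
    apply ball_disjoint_ball
    rw [dist_eq_norm]
    linarith [h c hc d hd hcd]
  have hsub : (⋃ c ∈ s, ball (c : E) (t / 2)) ⊆ ball (0 : E) (1 + t / 2) := by
    refine Set.iUnion₂_subset fun x hx => ?_
    apply ball_subset_ball'
    rw [dist_zero_right]
    linarith [hs x hx]
  have I : (s.card : ENNReal) * ENNReal.ofReal ((t / 2) ^ finrank ℝ E) * μ (ball 0 1) ≤
      ENNReal.ofReal ((1 + t / 2) ^ finrank ℝ E) * μ (ball 0 1) :=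
    calc
      (s.card : ENNReal) * ENNReal.ofReal ((t / 2) ^ finrank ℝ E) * μ (ball 0 1)
          = μ (⋃ c ∈ s, ball (c : E) (t / 2)) := by
        rw [measure_biUnion_finset D fun c _ => measurableSet_ball]
        simp only [μ.addHaar_ball_of_pos _ hδ]
        simp only [Finset.sum_const, nsmul_eq_mul, mul_assoc]
      _ ≤ μ (ball (0 : E) (1 + t / 2)) := measure_mono hsub
      _ = ENNReal.ofReal ((1 + t / 2) ^ finrank ℝ E) * μ (ball 0 1) := by
        simp only [μ.addHaar_ball_of_pos _ hρ]
  have J : (s.card : ENNReal) * ENNReal.ofReal ((t / 2) ^ finrank ℝ E) ≤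
      ENNReal.ofReal ((1 + t / 2) ^ finrank ℝ E) :=
    (ENNReal.mul_le_mul_iff_left (measure_ball_pos _ _ zero_lt_one).ne' measure_ball_lt_top.ne).1 I
  have K := ENNReal.toReal_le_of_le_ofReal (pow_nonneg hρ.le _) J
  rw [ENNReal.toReal_mul, ENNReal.toReal_natCast, ENNReal.toReal_ofReal (by positivity),
    ← le_div_iff₀ (by positivity), ← div_pow] at K
  have hbase : (1 + t / 2) / (t / 2) = 1 + 2 / t := by
    field_simp
    ring
  rwa [hbase] at K

open Module in
theorem exists_net_unit_ball (E : Type*) [NormedAddCommGroup E] [NormedSpace ℝ E]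
    [FiniteDimensional ℝ E] {t : ℝ} (ht : 0 < t) :
    ∃ s : Finset E, (s.card : ℝ) ≤ (1 + 2 / t) ^ finrank ℝ E ∧ (∀ x ∈ s, ‖x‖ ≤ 1) ∧
      ∀ x : E, ‖x‖ ≤ 1 → ∃ y ∈ s, ‖x - y‖ ≤ t := by
  classical
  let P : Finset E → Prop := fun s => (∀ x ∈ s, ‖x‖ ≤ 1) ∧
    ∀ x ∈ s, ∀ y ∈ s, x ≠ y → t ≤ ‖x - y‖
  let T : Set ℕ := {k | ∃ s, P s ∧ s.card = k}
  have hne : T.Nonempty := ⟨0, ∅, by simp [P], rfl⟩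
  have hb : BddAbove T := by
    refine ⟨⌈(1 + 2 / t) ^ finrank ℝ E⌉₊, ?_⟩
    rintro _ ⟨s, hs, rfl⟩
    exact_mod_cast (card_le_of_separated_of_norm_le_one ht s hs.1 hs.2).trans (Nat.le_ceil _)
  obtain ⟨s, hs, hcard⟩ := Nat.sSup_mem hne hb
  refine ⟨s, card_le_of_separated_of_norm_le_one ht s hs.1 hs.2, hs.1, fun x hx => ?_⟩
  by_contra! hfar
  have hxs : x ∉ s := fun hxs => by
    have := hfar x hxs
    simp at this
    linarith
  have hins : P (insert x s) := by
    refine ⟨fun y hy => ?_, fun y hy z hz hyz => ?_⟩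
    · rcases Finset.mem_insert.1 hy with rfl | hy
      exacts [hx, hs.1 y hy]
    · rcases Finset.mem_insert.1 hy with rfl | hys <;>
        rcases Finset.mem_insert.1 hz with rfl | hzs
      · exact absurd rfl hyz
      · exact (hfar z hzs).le
      · rw [norm_sub_rev]
        exact (hfar y hys).le
      · exact hs.2 y hys z hzs hyz
  have := le_csSup hb ⟨_, hins, rfl⟩
  rw [Finset.card_insert_of_notMem hxs, ← hcard] at this
  omega

theorem rpow_sub_rpow_le {p a b : ℝ} (hp : 1 ≤ p) (hb : 0 ≤ b) (hba : b ≤ a) :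
    a ^ p - b ^ p ≤ p * (a - b) * a ^ (p - 1) := by
  rcases hb.trans hba |>.eq_or_lt with rfl | ha
  · obtain rfl : b = 0 := le_antisymm hba hb
    simp
  have h := one_add_mul_self_le_rpow_one_add (s := b / a - 1) (by
    have : 0 ≤ b / a := by positivity
    linarith) hp
  rw [add_sub_cancel, Real.div_rpow hb ha.le, le_div_iff₀ (by positivity)] at h
  have h1 : a ^ p = a * a ^ (p - 1) := by
    rw [Real.rpow_sub_one ha.ne']
    field_simp
  have h2 : (1 + p * (b / a - 1)) * a ^ p = a ^ p - p * (a - b) * a ^ (p - 1) := by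
    rw [h1]
    field_simp
    ring
  linarith

theorem abs_rpow_sub_rpow_le_of_abs_sub_le {p t w a b : ℝ} (hp : 1 ≤ p) (ht : 0 ≤ t) (hw : 0 ≤ w)
    (h : |a - b| ≤ t * w) :
    |(|a| ^ p - |b| ^ p)| ≤ p * t * (|a| ^ p + |b| ^ p + w ^ p) := by
  wlog hab : |b| ≤ |a| generalizing a b
  · rw [abs_sub_comm, add_comm (|a| ^ p)]
    exact this (by rwa [abs_sub_comm]) (le_of_not_ge hab)
  have h0 : |b| ^ p ≤ |a| ^ p := Real.rpow_le_rpow (abs_nonneg _) hab (by linarith)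
  rw [abs_of_nonneg (sub_nonneg.2 h0)]
  have h1 := rpow_sub_rpow_le hp (abs_nonneg b) hab
  have h2 : |a| - |b| ≤ t * w := (abs_sub_abs_le_abs_sub a b).trans h
  have h3 : w * |a| ^ (p - 1) ≤ |a| ^ p + w ^ p := by
    have key : ∀ y : ℝ, 0 ≤ y → y * y ^ (p - 1) = y ^ p := by
      intro y hy
      conv_lhs => rw [← Real.rpow_one y]
      rw [Real.rpow_one, ← Real.rpow_one_add' hy (by linarith)]
      congr 1
      ring
    rcases le_total w |a| with hwa | hwa
    · have := mul_le_mul_of_nonneg_right hwa (Real.rpow_nonneg (abs_nonneg a) (p - 1))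
      rw [key |a| (abs_nonneg a)] at this
      linarith [Real.rpow_nonneg hw p]
    · have := mul_le_mul_of_nonneg_left
        (Real.rpow_le_rpow (abs_nonneg a) hwa (by linarith : 0 ≤ p - 1)) hw
      rw [key w hw] at this
      linarith [Real.rpow_nonneg (abs_nonneg a) p]
  have h4 : 0 ≤ |b| ^ p := by positivity
  have h5 : 0 ≤ |a| ^ (p - 1) := by positivity
  calc |a| ^ p - |b| ^ p ≤ p * (|a| - |b|) * |a| ^ (p - 1) := h1
    _ ≤ p * (t * w) * |a| ^ (p - 1) := by gcongr
    _ = p * t * (w * |a| ^ (p - 1)) := by ring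
    _ ≤ p * t * (|a| ^ p + w ^ p) := by gcongr
    _ ≤ p * t * (|a| ^ p + |b| ^ p + w ^ p) := by gcongr; linarith

theorem sum_mul_exp_le_exp {ι : Type*} [Fintype ι] {q : ι → ℝ} (hq : ∀ i, 0 ≤ q i)
    (hq1 : ∑ i, q i = 1) {Y : ι → ℝ} (h0 : ∑ i, q i * Y i = 0) (h1 : ∀ i, |Y i| ≤ 1) :
    ∑ i, q i * Real.exp (Y i) ≤ Real.exp (∑ i, q i * Y i ^ 2) := by
  calc ∑ i, q i * Real.exp (Y i) ≤ ∑ i, q i * (1 + Y i + Y i ^ 2) := by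
        gcongr with i
        · exact hq i
        · linarith [(abs_le.1 (Real.abs_exp_sub_one_sub_id_le (h1 i))).2]
    _ = ∑ i, q i * Y i ^ 2 + 1 := by
        simp only [mul_add, mul_one, Finset.sum_add_distrib, hq1, h0]
        ring
    _ ≤ _ := Real.add_one_le_exp _

/-- Derandomised Bernstein bound: if every `Y a` is centred and bounded by `1` for the
distribution `q`, some sequence of `m` samples keeps the exponential potential below its mean. -/
theorem exists_samples_sum_exp_le {ι κ : Type*} [Fintype ι] {q : ι → ℝ}
    (hq : ∀ i, 0 ≤ q i) (hq1 : ∑ i, q i = 1) (T : Finset κ) (Y : κ → ι → ℝ) (V : κ → ℝ)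
    (h0 : ∀ a ∈ T, ∑ i, q i * Y a i = 0) (h1 : ∀ a ∈ T, ∀ i, |Y a i| ≤ 1)
    (hV : ∀ a ∈ T, ∑ i, q i * Y a i ^ 2 ≤ V a) (m : ℕ) (c : κ → ℝ) (hc : ∀ a, 0 ≤ c a) :
    ∃ τ : Fin m → ι, ∑ a ∈ T, c a * Real.exp (∑ j, Y a (τ j)) ≤
      ∑ a ∈ T, c a * Real.exp (m * V a) := by
  induction m generalizing c with
  | zero => exact ⟨Fin.elim0, by simp⟩
  | succ m ih =>
    have hι : (Finset.univ : Finset ι).Nonempty := by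
      by_contra h
      rw [Finset.not_nonempty_iff_eq_empty] at h
      simp [h] at hq1
    obtain ⟨i, hi⟩ : ∃ i, ∑ a ∈ T, (c a * Real.exp (m * V a)) * Real.exp (Y a i) ≤
        ∑ a ∈ T, (c a * Real.exp (m * V a)) * Real.exp (V a) := by
      by_contra! hcon
      have hpos : ∃ i, 0 < q i := by
        by_contra! h
        have := Finset.sum_nonpos fun i (_ : i ∈ Finset.univ) => h i
        linarith
      obtain ⟨i₀, hi₀⟩ := hpos
      have hlt : ∑ i, q i * ∑ a ∈ T, (c a * Real.exp (m * V a)) * Real.exp (V a) <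
          ∑ i, q i * ∑ a ∈ T, (c a * Real.exp (m * V a)) * Real.exp (Y a i) :=
        Finset.sum_lt_sum (fun i _ => mul_le_mul_of_nonneg_left (hcon i).le (hq i))
          ⟨i₀, Finset.mem_univ _, mul_lt_mul_of_pos_left (hcon i₀) hi₀⟩
      rw [← Finset.sum_mul, hq1, one_mul] at hlt
      refine hlt.not_ge ?_
      simp only [Finset.mul_sum]
      rw [Finset.sum_comm]
      refine Finset.sum_le_sum fun a ha => ?_
      have := (sum_mul_exp_le_exp hq hq1 (h0 a ha) (h1 a ha)).trans (Real.exp_le_exp.2 (hV a ha))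
      calc ∑ i, q i * (c a * Real.exp (m * V a) * Real.exp (Y a i))
          = c a * Real.exp (m * V a) * ∑ i, q i * Real.exp (Y a i) := by
            rw [Finset.mul_sum]
            exact Finset.sum_congr rfl fun i _ => by ring
        _ ≤ _ := mul_le_mul_of_nonneg_left this (mul_nonneg (hc a) (Real.exp_nonneg _))
    obtain ⟨τ, hτ⟩ := ih (fun a => c a * Real.exp (Y a i))
      fun a => mul_nonneg (hc a) (Real.exp_nonneg _)
    refine ⟨Fin.cons i τ, ?_⟩
    calc ∑ a ∈ T, c a * Real.exp (∑ j, Y a ((Fin.cons i τ : Fin (m + 1) → ι) j))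
        = ∑ a ∈ T, c a * Real.exp (Y a i) * Real.exp (∑ j, Y a (τ j)) := by
          refine Finset.sum_congr rfl fun a _ => ?_
          rw [Fin.sum_univ_succ, Real.exp_add]
          simp only [Fin.cons_zero, Fin.cons_succ]
          ring
      _ ≤ ∑ a ∈ T, c a * Real.exp (Y a i) * Real.exp (m * V a) := hτ
      _ = ∑ a ∈ T, (c a * Real.exp (m * V a)) * Real.exp (Y a i) :=
          Finset.sum_congr rfl fun a _ => by ring
      _ ≤ _ := hi
      _ = _ := by
          refine Finset.sum_congr rfl fun a _ => ?_
          rw [mul_assoc, ← Real.exp_add]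
          push_cast
          ring_nf

/-- Centred one-sample estimator of `‖y‖ ^ p`: row `i` of weight `s i` is drawn with
probability `s i / ∑ s`. -/
noncomputable def sampleError {ι E : Type*} [Fintype ι] [NormedAddCommGroup E] [NormedSpace ℝ E]
    (p : ℝ) (l : ι → E →ₗ[ℝ] ℝ) (s : ι → ℝ) (i : ι) (y : E) : ℝ :=
  |l i y| ^ p / (s i / ∑ k, s k) - ‖y‖ ^ p

section Chaining

variable {ι E : Type*} [Fintype ι] [NormedAddCommGroup E] [NormedSpace ℝ E]
  {p : ℝ} {l : ι → E →ₗ[ℝ] ℝ} {s : ι → ℝ}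

theorem sampleError_smul (i : ι) (a : ℝ) (y : E) :
    sampleError p l s i (a • y) = |a| ^ p * sampleError p l s i y := by
  simp only [sampleError, map_smul, smul_eq_mul, abs_mul, norm_smul, Real.norm_eq_abs]
  rw [Real.mul_rpow (abs_nonneg _) (abs_nonneg _), Real.mul_rpow (abs_nonneg _) (norm_nonneg _)]
  ring

theorem sampleError_zero (hp : 1 ≤ p) (i : ι) : sampleError p l s i (0 : E) = 0 := by
  have : p ≠ 0 := by linarith
  simp [sampleError, Real.zero_rpow this]

theorem sampleError_sub_bounds (hp : 1 ≤ p) (hnorm : ∀ y, ‖y‖ ^ p = ∑ i, |l i y| ^ p)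
    (hs0 : ∀ i, 0 < s i) (hs : ∀ i y, |l i y| ^ p ≤ s i * ‖y‖ ^ p) (hS : 1 ≤ ∑ i, s i)
    {t : ℝ} (ht : 0 < t) {u v : E} (hu : ‖u‖ ≤ 1) (hv : ‖v‖ ≤ 1) (huv : ‖u - v‖ ≤ t) :
    ∑ i, s i / (∑ k, s k) * (sampleError p l s i u - sampleError p l s i v) = 0 ∧
    (∀ i, |sampleError p l s i u - sampleError p l s i v| ≤ 6 * p * t * ∑ k, s k) ∧
    ∑ i, s i / (∑ k, s k) * (sampleError p l s i u - sampleError p l s i v) ^ 2 ≤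
      9 * p ^ 2 * t ^ 2 * ∑ k, s k := by
  set S := ∑ k, s k with hSdef
  have hS0 : 0 < S := by linarith
  have hp0 : 0 < p := by linarith
  have hq0 : ∀ i, 0 < s i / S := fun i => div_pos (hs0 i) hS0
  have hq1 : ∑ i, s i / S = 1 := by
    rw [← Finset.sum_div, ← hSdef, div_self hS0.ne']
  set w : E := t⁻¹ • (u - v) with hw
  have hw1 : ‖w‖ ≤ 1 := by
    rw [hw, norm_smul, Real.norm_eq_abs, abs_of_pos (inv_pos.2 ht), inv_mul_le_iff₀ ht]
    linarith
  have hpow : ∀ y : E, ‖y‖ ≤ 1 → ‖y‖ ^ p ≤ 1 := fun y hy =>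
    Real.rpow_le_one (norm_nonneg y) hy hp0.le
  have hpt : ∀ y : E, ‖y‖ ≤ 1 → ∀ i, |l i y| ^ p ≤ s i := fun y hy i =>
    (hs i y).trans (by nlinarith [hpow y hy, hs0 i])
  set g : ι → ℝ := fun i => |l i u| ^ p - |l i v| ^ p with hg
  have hgG : ∑ i, g i = ‖u‖ ^ p - ‖v‖ ^ p := by
    rw [hg, Finset.sum_sub_distrib, ← hnorm, ← hnorm]
  have hgi : ∀ i, |g i| ≤ p * t * (|l i u| ^ p + |l i v| ^ p + |l i w| ^ p) := fun i => by
    refine abs_rpow_sub_rpow_le_of_abs_sub_le hp ht.le (abs_nonneg _) (le_of_eq ?_)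
    rw [hw, map_smul, smul_eq_mul, abs_mul, abs_of_pos (inv_pos.2 ht), map_sub]
    field_simp
  have hg1 : ∀ i, |g i| ≤ 3 * p * t * s i := fun i => by
    refine (hgi i).trans ?_
    have : |l i u| ^ p + |l i v| ^ p + |l i w| ^ p ≤ 3 * s i := by
      linarith [hpt u hu i, hpt v hv i, hpt w hw1 i]
    calc _ ≤ p * t * (3 * s i) := by gcongr
      _ = _ := by ring
  have hg2 : ∑ i, |g i| ≤ 3 * p * t := by
    calc ∑ i, |g i| ≤ ∑ i, p * t * (|l i u| ^ p + |l i v| ^ p + |l i w| ^ p) :=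
          Finset.sum_le_sum fun i _ => hgi i
      _ = p * t * (‖u‖ ^ p + ‖v‖ ^ p + ‖w‖ ^ p) := by
          rw [← Finset.mul_sum, Finset.sum_add_distrib, Finset.sum_add_distrib, hnorm, hnorm, hnorm]
      _ ≤ p * t * (1 + 1 + 1) := by
          gcongr
          exacts [hpow u hu, hpow v hv, hpow w hw1]
      _ = _ := by ring
  have hdiff : ∀ i, sampleError p l s i u - sampleError p l s i v =
      g i / (s i / S) - ∑ k, g k := fun i => by
    rw [hgG, sampleError, sampleError, ← hSdef, hg]
    ring
  have hgq : ∀ i, |g i / (s i / S)| ≤ 3 * p * t * S := fun i => by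
    rw [abs_div, abs_of_pos (hq0 i), div_le_iff₀ (hq0 i)]
    calc |g i| ≤ 3 * p * t * s i := hg1 i
      _ = _ := by field_simp
  have hmean : ∑ i, s i / S * (g i / (s i / S)) = ∑ k, g k :=
    Finset.sum_congr rfl fun i _ => mul_div_cancel₀ _ (hq0 i).ne'
  simp only [hdiff]
  refine ⟨?_, fun i => ?_, ?_⟩
  · simp only [mul_sub, Finset.sum_sub_distrib]
    rw [hmean, ← Finset.sum_mul, hq1]
    ring
  · have h1 : |∑ k, g k| ≤ 3 * p * t * S :=
      (Finset.abs_sum_le_sum_abs _ _).trans (hg2.trans (le_mul_of_one_le_right (by positivity) hS))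
    calc _ ≤ |g i / (s i / S)| + |∑ k, g k| := abs_sub _ _
      _ ≤ 3 * p * t * S + 3 * p * t * S := add_le_add (hgq i) h1
      _ = _ := by ring
  · have hexp : ∑ i, s i / S * (g i / (s i / S) - ∑ k, g k) ^ 2 =
        ∑ i, s i / S * (g i / (s i / S)) ^ 2 - (∑ k, g k) ^ 2 := by
      have : ∀ i, s i / S * (g i / (s i / S) - ∑ k, g k) ^ 2 =
          s i / S * (g i / (s i / S)) ^ 2 - 2 * (∑ k, g k) * (s i / S * (g i / (s i / S))) +
            (∑ k, g k) ^ 2 * (s i / S) := fun i => by ring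
      simp only [this, Finset.sum_add_distrib, Finset.sum_sub_distrib, ← Finset.mul_sum, hmean, hq1]
      ring
    rw [hexp]
    calc _ ≤ ∑ i, s i / S * (g i / (s i / S)) ^ 2 := by linarith [sq_nonneg (∑ k, g k)]
      _ ≤ ∑ i, 3 * p * t * S * |g i| := by
          refine Finset.sum_le_sum fun i _ => ?_
          have : s i / S * (g i / (s i / S)) ^ 2 = |g i / (s i / S)| * |g i| := by
            have h : s i / S * |g i / (s i / S)| = |g i| := by
              rw [abs_div, abs_of_pos (hq0 i), mul_div_cancel₀ _ (hq0 i).ne']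
            rw [← sq_abs (g i / _)]
            linear_combination |g i / (s i / S)| * h
          rw [this]
          exact mul_le_mul_of_nonneg_right (hgq i) (abs_nonneg _)
      _ = 3 * p * t * S * ∑ i, |g i| := (Finset.mul_sum _ _ _).symm
      _ ≤ 3 * p * t * S * (3 * p * t) := by gcongr
      _ = _ := by ring

theorem sum_range_succ_div_two_pow (K : ℕ) :
    ∑ k ∈ Finset.range K, ((k : ℝ) + 1) / 2 ^ k = 4 - (2 * K + 4) / 2 ^ K := by
  induction K with
  | zero => norm_num
  | succ K ih =>
    rw [Finset.sum_range_succ, ih]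
    push_cast
    field_simp
    ring

theorem sum_exp_neg_succ_le_one (K : ℕ) :
    ∑ k ∈ Finset.range K, Real.exp (-((k : ℝ) + 1)) ≤ 1 := by
  have h2 : Real.exp (-1) ≤ 1 / 2 := by
    rw [Real.exp_neg, one_div]
    exact inv_anti₀ two_pos (by linarith [Real.add_one_le_exp 1])
  have hsum : ∀ K : ℕ, ∑ k ∈ Finset.range K, (1 / 2 : ℝ) ^ (k + 1) = 1 - (1 / 2) ^ K := by
    intro K
    induction K with
    | zero => simp
    | succ K ih =>
      rw [Finset.sum_range_succ, ih]
      ring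
  calc _ ≤ ∑ k ∈ Finset.range K, (1 / 2 : ℝ) ^ (k + 1) := by
        refine Finset.sum_le_sum fun k _ => ?_
        have : Real.exp (-((k : ℝ) + 1)) = Real.exp (-1) ^ (k + 1) := by
          rw [← Real.exp_nat_mul]
          push_cast
          ring_nf
        rw [this]
        gcongr
    _ ≤ 1 := by
        rw [hsum]
        linarith [pow_pos (by norm_num : (0 : ℝ) < 1 / 2) K]

open Module in
theorem exists_nets (E : Type*) [NormedAddCommGroup E] [NormedSpace ℝ E] [FiniteDimensional ℝ E]
    {d : ℕ} (hd : finrank ℝ E ≤ d) :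
    ∃ N : ℕ → Finset E, N 0 = {0} ∧ (∀ k, ((N k).card : ℝ) ≤ Real.exp ((k + 2) * d)) ∧
      (∀ k, ∀ x ∈ N k, ‖x‖ ≤ 1) ∧
      ∀ k, ∀ x : E, ‖x‖ ≤ 1 → ∃ y ∈ N k, ‖x - y‖ ≤ 1 / 2 ^ k := by
  have key : ∀ k : ℕ, ∃ s : Finset E, (k = 0 → s = {0}) ∧
      ((s.card : ℝ) ≤ Real.exp ((k + 2) * d)) ∧ (∀ x ∈ s, ‖x‖ ≤ 1) ∧
      ∀ x : E, ‖x‖ ≤ 1 → ∃ y ∈ s, ‖x - y‖ ≤ 1 / 2 ^ k := by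
    intro k
    rcases Nat.eq_zero_or_pos k with rfl | hk
    · refine ⟨{0}, fun _ => rfl, ?_, by simp, by simp⟩
      simp only [Finset.card_singleton, Nat.cast_one]
      exact Real.one_le_exp (by positivity)
    · obtain ⟨s, h1, h2, h3⟩ := exists_net_unit_ball E (t := 1 / 2 ^ k) (by positivity)
      refine ⟨s, fun h => by omega, h1.trans ?_, h2, h3⟩
      have hb : (1 + 2 / (1 / 2 ^ k) : ℝ) ≤ Real.exp (k + 2) := by
        have h2e : (2 : ℝ) ≤ Real.exp 1 := by linarith [Real.add_one_le_exp 1]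
        calc (1 + 2 / (1 / 2 ^ k) : ℝ) ≤ 2 ^ (k + 2) := by
              have : (1 : ℝ) ≤ 2 ^ k := one_le_pow₀ (by norm_num)
              rw [div_div_eq_mul_div, div_one, pow_add]
              linarith
          _ ≤ Real.exp 1 ^ (k + 2) := by gcongr
          _ = Real.exp (k + 2) := by
              rw [← Real.exp_nat_mul]
              push_cast
              ring_nf
      calc (1 + 2 / (1 / 2 ^ k) : ℝ) ^ finrank ℝ E
          ≤ (1 + 2 / (1 / 2 ^ k) : ℝ) ^ d := by
            refine pow_le_pow_right₀ ?_ hd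
            have : (0 : ℝ) ≤ 2 / (1 / 2 ^ k) := by positivity
            linarith
        _ ≤ Real.exp (k + 2) ^ d := by gcongr
        _ = _ := by
            rw [← Real.exp_nat_mul]
            ring_nf
  choose N h0 h1 h2 h3 using key
  exact ⟨N, h0 0 rfl, h1, h2, h3⟩

/-- Sampling `m ≳ p² d S / ε²` rows proportionally to their sensitivities `s i` controls all
chaining increments along a sequence of nets. -/
theorem exists_samples_increment_le (hp : 1 ≤ p)
    (hnorm : ∀ y, ‖y‖ ^ p = ∑ i, |l i y| ^ p)
    (hs0 : ∀ i, 0 < s i) (hs : ∀ i y, |l i y| ^ p ≤ s i * ‖y‖ ^ p) (hS : 1 ≤ ∑ i, s i)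
    {d : ℕ} (hd1 : 1 ≤ d) {ε : ℝ} (hε : 0 < ε) (hε1 : ε ≤ 1) {m : ℕ}
    (hm : 147456 * p ^ 2 * d * (∑ i, s i) / ε ^ 2 ≤ m)
    (N : ℕ → Finset E) (hcard : ∀ k, ((N k).card : ℝ) ≤ Real.exp ((k + 2) * d))
    (hball : ∀ k, ∀ x ∈ N k, ‖x‖ ≤ 1) (K : ℕ) :
    ∃ τ : Fin m → ι, ∀ k < K, ∀ u ∈ N k, ∀ v ∈ N (k + 1), ‖u - v‖ ≤ 2 / 2 ^ k →
      |∑ j, (sampleError p l s (τ j) u - sampleError p l s (τ j) v)| ≤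
        m * (ε / 8 * ((k + 1) / 2 ^ k)) := by
  classical
  set S := ∑ k, s k with hSdef
  have hS0 : 0 < S := by linarith
  have hp0 : 0 < p := by linarith
  have hd0 : (0 : ℝ) < d := by exact_mod_cast hd1
  have hd1' : (1 : ℝ) ≤ d := by exact_mod_cast hd1
  have hm0 : (0 : ℝ) < m := lt_of_lt_of_le (by positivity) hm
  rw [div_le_iff₀ (by positivity)] at hm
  have hq0 : ∀ i, 0 ≤ s i / S := fun i => (div_pos (hs0 i) hS0).le
  have hq1 : ∑ i, s i / S = 1 := by
    rw [← Finset.sum_div, ← hSdef, div_self hS0.ne']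
  let T : Finset (Σ _ : ℕ, E × E × ℝ) := (Finset.range K).sigma fun k =>
    (N k ×ˢ N (k + 1) ×ˢ ({1, -1} : Finset ℝ)).filter fun a => ‖a.1 - a.2.1‖ ≤ 2 / 2 ^ k
  let r : ℕ → ℝ := fun k => 64 * d * 2 ^ k / (ε * m)
  have hr : ∀ k, 0 < r k := fun k => by positivity
  let Y : (Σ _ : ℕ, E × E × ℝ) → ι → ℝ := fun a i =>
    a.2.2.2 * r a.1 * (sampleError p l s i a.2.1 - sampleError p l s i a.2.2.1)
  let c : (Σ _ : ℕ, E × E × ℝ) → ℝ := fun a => Real.exp (-(8 * (a.1 + 1) * d))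
  have hT : ∀ a ∈ T, |a.2.2.2| = 1 ∧ ‖a.2.1‖ ≤ 1 ∧ ‖a.2.2.1‖ ≤ 1 ∧
      ‖a.2.1 - a.2.2.1‖ ≤ 2 / 2 ^ a.1 := by
    rintro ⟨k, u, v, σ⟩ ha
    simp only [T, Finset.mem_sigma, Finset.mem_filter, Finset.mem_product, Finset.mem_insert,
      Finset.mem_singleton] at ha
    obtain ⟨-, ⟨hu, hv, hσ⟩, huv⟩ := ha
    refine ⟨?_, hball _ u hu, hball _ v hv, huv⟩
    rcases hσ with rfl | rfl <;> simp
  have hbd := fun a ha => sampleError_sub_bounds hp hnorm hs0 hs hS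
    (t := 2 / 2 ^ a.1) (by positivity) (hT a ha).2.1 (hT a ha).2.2.1 (hT a ha).2.2.2
  obtain ⟨τ, hτ⟩ := exists_samples_sum_exp_le hq0 hq1 T Y (fun _ => d / m)
    (fun a ha => by
      have := (hbd a ha).1
      calc _ = a.2.2.2 * r a.1 * ∑ i, s i / S *
            (sampleError p l s i a.2.1 - sampleError p l s i a.2.2.1) := by
            rw [Finset.mul_sum]
            exact Finset.sum_congr rfl fun i _ => by simp only [Y]; ring
        _ = 0 := by rw [this, mul_zero])
    (fun a ha i => by
      have := (hbd a ha).2.1 i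
      simp only [Y]
      rw [abs_mul, abs_mul, (hT a ha).1, one_mul, abs_of_pos (hr _)]
      calc _ ≤ r a.1 * (6 * p * (2 / 2 ^ a.1) * S) := by
            have := (hr a.1).le
            gcongr
        _ = 768 * p * d * S / (ε * m) := by
            simp only [r]
            field_simp
            ring
        _ ≤ 1 := by
            rw [div_le_one (by positivity)]
            have h1 : 147456 * p ^ 2 * d * S ≤ ε * m :=
              hm.trans (by rw [mul_comm]; gcongr; nlinarith)
            have h2 : 768 * p * d * S ≤ 147456 * p ^ 2 * d * S := by
              gcongr
              · norm_num
              · exact le_self_pow₀ hp two_ne_zero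
            linarith)
    (fun a ha => by
      have := (hbd a ha).2.2
      calc _ = (|a.2.2.2| * r a.1) ^ 2 * ∑ i, s i / S *
            (sampleError p l s i a.2.1 - sampleError p l s i a.2.2.1) ^ 2 := by
            rw [Finset.mul_sum, mul_pow, sq_abs]
            exact Finset.sum_congr rfl fun i _ => by simp only [Y]; ring
        _ ≤ (1 * r a.1) ^ 2 * (9 * p ^ 2 * (2 / 2 ^ a.1) ^ 2 * S) := by
            rw [(hT a ha).1]
            gcongr
        _ = (147456 * p ^ 2 * d * S) * (d / (ε ^ 2 * m ^ 2)) := by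
            simp only [r]
            field_simp
            ring
        _ ≤ (m * ε ^ 2) * (d / (ε ^ 2 * m ^ 2)) := by gcongr
        _ = d / m := by field_simp)
    m c (fun a => (Real.exp_pos _).le)
  have hone : ∑ a ∈ T, c a * Real.exp (m * (d / m)) ≤ 1 := by
    rw [Finset.sum_sigma]
    refine le_trans (Finset.sum_le_sum fun k _ => ?_) (sum_exp_neg_succ_le_one K)
    simp only [c]
    rw [Finset.sum_const, nsmul_eq_mul, mul_div_cancel₀ _ hm0.ne']
    have hc : (((N k ×ˢ N (k + 1) ×ˢ ({1, -1} : Finset ℝ)).filter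
        fun a => ‖a.1 - a.2.1‖ ≤ 2 / 2 ^ k).card : ℝ) ≤
        Real.exp ((k + 2) * d) * (Real.exp ((k + 3) * d) * Real.exp 1) := by
      have h1 := Finset.card_filter_le (N k ×ˢ N (k + 1) ×ˢ ({1, -1} : Finset ℝ))
        fun a => ‖a.1 - a.2.1‖ ≤ 2 / 2 ^ k
      have h2 : (({1, -1} : Finset ℝ).card : ℝ) ≤ Real.exp 1 := by
        have : (({1, -1} : Finset ℝ).card : ℝ) ≤ 2 := by exact_mod_cast Finset.card_le_two
        linarith [Real.add_one_le_exp 1]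
      have h3 := hcard (k + 1)
      rw [show (((k + 1 : ℕ) : ℝ) + 2) = k + 3 by push_cast; ring] at h3
      rw [Finset.card_product, Finset.card_product] at h1
      calc _ ≤ ((N k).card : ℝ) * ((N (k + 1)).card * ({1, -1} : Finset ℝ).card) := by
            exact_mod_cast h1
        _ ≤ _ := by gcongr; exact hcard k
    calc _ ≤ Real.exp ((k + 2) * d) * (Real.exp ((k + 3) * d) * Real.exp 1) *
          (Real.exp (-(8 * (k + 1) * d)) * Real.exp d) := by gcongr
      _ = Real.exp (1 - (6 * k + 2) * d) := by
          simp only [← Real.exp_add]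
          congr 1
          ring
      _ ≤ _ := by
          gcongr
          have : (0 : ℝ) ≤ k := by positivity
          nlinarith
  refine ⟨τ, fun k hk u hu v hv huv => ?_⟩
  have hsign : ∀ σ : ℝ, σ = 1 ∨ σ = -1 →
      σ * ∑ j, (sampleError p l s (τ j) u - sampleError p l s (τ j) v) ≤
        m * (ε / 8 * ((k + 1) / 2 ^ k)) := by
    intro σ hσ
    have hmem : (⟨k, u, v, σ⟩ : Σ _ : ℕ, E × E × ℝ) ∈ T := by
      simp only [T, Finset.mem_sigma, Finset.mem_filter, Finset.mem_product, Finset.mem_insert,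
        Finset.mem_singleton, Finset.mem_range]
      exact ⟨hk, ⟨hu, hv, hσ⟩, huv⟩
    have h1 := (Finset.single_le_sum (f := fun a => c a * Real.exp (∑ j, Y a (τ j)))
      (fun a _ => mul_nonneg (Real.exp_pos _).le (Real.exp_pos _).le) hmem).trans (hτ.trans hone)
    simp only [c] at h1
    rw [← Real.exp_add, Real.exp_le_one_iff] at h1
    simp only [Y] at h1
    rw [← Finset.mul_sum, mul_right_comm, mul_assoc, mul_comm _ (r k)] at h1
    set Z := ∑ j, (sampleError p l s (τ j) u - sampleError p l s (τ j) v)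
    have h2 : r k * (σ * Z) ≤ 8 * (k + 1) * d := by linarith
    rw [mul_comm, ← le_div_iff₀ (hr k)] at h2
    refine h2.trans (le_of_eq ?_)
    simp only [r]
    field_simp
    ring
  refine abs_le.2 ⟨?_, ?_⟩
  · linarith [hsign (-1) (Or.inr rfl)]
  · linarith [hsign 1 (Or.inl rfl)]

open Module in
theorem exists_samples_norm_approx [FiniteDimensional ℝ E] (hp : 1 ≤ p)
    (hnorm : ∀ y, ‖y‖ ^ p = ∑ i, |l i y| ^ p)
    (hs0 : ∀ i, 0 < s i) (hs : ∀ i y, |l i y| ^ p ≤ s i * ‖y‖ ^ p) (hS : 1 ≤ ∑ i, s i)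
    {d : ℕ} (hd1 : 1 ≤ d) (hd : finrank ℝ E ≤ d) {ε : ℝ} (hε : 0 < ε) (hε1 : ε ≤ 1) {m : ℕ}
    (hm : 147456 * p ^ 2 * d * (∑ i, s i) / ε ^ 2 ≤ m) :
    ∃ τ : Fin m → ι, ∀ y : E,
      |∑ j, sampleError p l s (τ j) y| ≤ m * (ε * ‖y‖ ^ p) := by
  set S := ∑ k, s k with hSdef
  have hS0 : 0 < S := by linarith
  have hp0 : 0 < p := by linarith
  obtain ⟨N, hN0, hcard, hball, hcov⟩ := exists_nets E hd
  obtain ⟨K, hK⟩ : ∃ K : ℕ, (1 / 2 : ℝ) ^ K < ε / (12 * p * S) :=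
    exists_pow_lt_of_lt_one (by positivity) (by norm_num)
  obtain ⟨τ, hτ⟩ := exists_samples_increment_le hp hnorm hs0 hs hS hd1 hε hε1 hm N hcard hball K
  have hunit : ∀ y : E, ‖y‖ ≤ 1 → |∑ j, sampleError p l s (τ j) y| ≤ m * ε := by
    intro y hy
    choose π hπN hπ using fun k => hcov k y hy
    have hπ0 : π 0 = 0 := by simpa [hN0] using hπN 0
    have hstep : ∀ k, ‖π k - π (k + 1)‖ ≤ 2 / 2 ^ k := fun k => by
      calc ‖π k - π (k + 1)‖ = ‖(y - π (k + 1)) - (y - π k)‖ := by congr 1; abel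
        _ ≤ ‖y - π (k + 1)‖ + ‖y - π k‖ := norm_sub_le _ _
        _ ≤ 1 / 2 ^ (k + 1) + 1 / 2 ^ k := add_le_add (hπ _) (hπ _)
        _ ≤ 2 / 2 ^ k := by
          have : (0 : ℝ) < 1 / 2 ^ k := by positivity
          have h2 : (1 : ℝ) / 2 ^ (k + 1) = 1 / 2 ^ k / 2 := by rw [pow_succ, div_div]
          have h3 : (2 : ℝ) / 2 ^ k = 2 * (1 / 2 ^ k) := by ring
          linarith
    have hchain : ∀ L ≤ K, |∑ j, sampleError p l s (τ j) (π L)| ≤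
        ∑ k ∈ Finset.range L, m * (ε / 8 * (((k : ℝ) + 1) / 2 ^ k)) := by
      intro L hL
      induction L with
      | zero => simp [hπ0, sampleError_zero hp]
      | succ L ih =>
        rw [Finset.sum_range_succ]
        have h1 := hτ L (by omega) _ (hπN L) _ (hπN (L + 1)) (hstep L)
        rw [Finset.sum_sub_distrib] at h1
        have h2 := ih (by omega)
        have h3 := abs_sub_abs_le_abs_sub (∑ j, sampleError p l s (τ j) (π (L + 1)))
          (∑ j, sampleError p l s (τ j) (π L))
        rw [abs_sub_comm] at h3
        linarith
    have hmain : |∑ j, sampleError p l s (τ j) (π K)| ≤ m * (ε / 2) := by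
      refine (hchain K le_rfl).trans ?_
      rw [← Finset.mul_sum, ← Finset.mul_sum, sum_range_succ_div_two_pow]
      have : (0 : ℝ) ≤ (2 * K + 4) / 2 ^ K := by positivity
      gcongr
      nlinarith
    have htail : |∑ j, (sampleError p l s (τ j) y - sampleError p l s (τ j) (π K))| ≤
        m * (ε / 2) := by
      have hb := (sampleError_sub_bounds hp hnorm hs0 hs hS (t := 1 / 2 ^ K) (by positivity) hy
        (hball K _ (hπN K)) (hπ K)).2.1
      calc _ ≤ ∑ j, |sampleError p l s (τ j) y - sampleError p l s (τ j) (π K)| :=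
            Finset.abs_sum_le_sum_abs _ _
        _ ≤ ∑ _j : Fin m, ε / 2 := by
            refine Finset.sum_le_sum fun j _ => (hb (τ j)).trans ?_
            rw [lt_div_iff₀ (by positivity), _root_.one_div_pow] at hK
            linarith
        _ = m * (ε / 2) := by simp
    rw [Finset.sum_sub_distrib] at htail
    have h3 := abs_sub_abs_le_abs_sub (∑ j, sampleError p l s (τ j) y)
      (∑ j, sampleError p l s (τ j) (π K))
    linarith
  refine ⟨τ, fun y => ?_⟩
  rcases eq_or_ne y 0 with rfl | hy
  · simp only [sampleError_zero hp, Finset.sum_const_zero, abs_zero]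
    positivity
  have hy0 : 0 < ‖y‖ := norm_pos_iff.2 hy
  have h := hunit (‖y‖⁻¹ • y) (by rw [norm_smul, norm_inv, norm_norm, inv_mul_cancel₀ hy0.ne'])
  simp only [sampleError_smul] at h
  rw [← Finset.mul_sum, abs_mul, abs_of_pos (inv_pos.2 hy0), Real.inv_rpow hy0.le,
    abs_of_pos (by positivity), inv_mul_le_iff₀ (by positivity)] at h
  linarith

end Chaining

open Module in
/-- Leverage scores of the coordinates of a subspace. -/
theorem exists_leverage_scores {n : ℕ} (W : Submodule ℝ (EuclideanSpace ℝ (Fin n))) :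
    ∃ τ : Fin n → ℝ, (∀ i, 0 ≤ τ i) ∧ (∀ i, τ i ≤ 1) ∧ ∑ i, τ i = finrank ℝ W ∧
      ∀ y ∈ W, ∀ i, y i ^ 2 ≤ τ i * ∑ k, y k ^ 2 := by
  let b := stdOrthonormalBasis ℝ W
  have hnorm : ∀ y : EuclideanSpace ℝ (Fin n), ∑ i, y i ^ 2 = ‖y‖ ^ 2 := fun y => by
    simp [EuclideanSpace.norm_sq_eq]
  refine ⟨fun i => ∑ j, (b j : EuclideanSpace ℝ (Fin n)) i ^ 2,
    fun i => Finset.sum_nonneg fun j _ => sq_nonneg _, fun i => ?_, ?_, fun y hy i => ?_⟩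
  · have hb : Orthonormal ℝ (fun j => (b j : EuclideanSpace ℝ (Fin n))) :=
      b.orthonormal.comp_linearIsometry W.subtypeₗᵢ
    have := hb.sum_inner_products_le (EuclideanSpace.single i (1 : ℝ)) (s := Finset.univ)
    simpa [EuclideanSpace.inner_single_right] using this
  · rw [Finset.sum_comm]
    simp only [hnorm]
    have : ∀ j, ‖(b j : EuclideanSpace ℝ (Fin n))‖ = 1 := fun j => b.norm_eq_one j
    simp [this]
  · have hrepr : y i = ∑ j, inner ℝ (b j) ⟨y, hy⟩ * (b j : EuclideanSpace ℝ (Fin n)) i := by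
      have h := congrArg (fun z : W => (z : EuclideanSpace ℝ (Fin n)) i) (b.sum_repr' ⟨y, hy⟩)
      simp only [Submodule.coe_sum, Submodule.coe_smul] at h
      rw [← h]
      simp
    have hn : ∑ j, inner ℝ (b j) (⟨y, hy⟩ : W) ^ 2 = ∑ k, y k ^ 2 := by
      have h := b.sum_sq_norm_inner_right ⟨y, hy⟩
      simp only [Real.norm_eq_abs, sq_abs] at h
      rw [h, hnorm]
      rfl
    rw [hrepr, ← hn, mul_comm]
    exact Finset.sum_mul_sq_le_sq_mul_sq _ _ _

theorem rpow_sum_le_sum_rpow_of_le_one {ι : Type*} (s : Finset ι) {f : ι → ℝ} (hf : ∀ i, 0 ≤ f i)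
    {r : ℝ} (hr : 0 < r) (hr1 : r ≤ 1) : (∑ i ∈ s, f i) ^ r ≤ ∑ i ∈ s, f i ^ r := by
  classical
  induction s using Finset.induction_on with
  | empty => simp [Real.zero_rpow hr.ne']
  | insert a s ha ih =>
    rw [Finset.sum_insert ha, Finset.sum_insert ha]
    have := Real.rpow_add_le_add_rpow (hf a) (Finset.sum_nonneg fun i (_ : i ∈ s) => hf i)
      hr.le hr1
    linarith

/-- Sensitivity bounds for the `ℓ_p` norm on the column space of `A`. -/
theorem exists_sensitivities {p : ℝ} (hp : 1 ≤ p) {n d : ℕ} (hn : 1 ≤ n) (hd : 1 ≤ d)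
    (A : Matrix (Fin n) (Fin d) ℝ) :
    ∃ s : Fin n → ℝ, (∀ i, 0 < s i) ∧
      (∀ x i, |A.mulVec x i| ^ p ≤ s i * ∑ k, |A.mulVec x k| ^ p) ∧
      1 ≤ ∑ i, s i ∧ ∑ i, s i ≤ 2 * (n : ℝ) ^ |1 - p / 2| * d := by
  let f : (Fin d → ℝ) →ₗ[ℝ] EuclideanSpace ℝ (Fin n) :=
    (WithLp.linearEquiv 2 ℝ (Fin n → ℝ)).symm.toLinearMap ∘ₗ A.mulVecLin
  obtain ⟨τ, h0, h1, hsum, hτ⟩ := exists_leverage_scores (LinearMap.range f)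
  have hr : (Module.finrank ℝ (LinearMap.range f) : ℝ) ≤ d := by
    have := LinearMap.finrank_range_le f
    simp only [Module.finrank_fin_fun] at this
    exact_mod_cast this
  rw [← hsum] at hr
  have hsq : ∀ x i, A.mulVec x i ^ 2 ≤ τ i * ∑ k, A.mulVec x k ^ 2 := fun x i =>
    hτ (f x) (LinearMap.mem_range_self f x) i
  have hn1 : (1 : ℝ) ≤ n := by exact_mod_cast hn
  have hd1 : (1 : ℝ) ≤ d := by exact_mod_cast hd
  have hn0 : (0 : ℝ) < n := by linarith
  have hd0 : (0 : ℝ) < d := by linarith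
  have hτ0 : 0 ≤ ∑ i, τ i := Finset.sum_nonneg fun i _ => h0 i
  have habs : ∀ x : ℝ, (x ^ 2) ^ (p / 2) = |x| ^ p := fun x => by
    rw [← sq_abs, ← Real.rpow_natCast, ← Real.rpow_mul (abs_nonneg x)]
    congr 1
    push_cast
    ring
  have hbound : ∀ x i, |A.mulVec x i| ^ p ≤ τ i ^ (p / 2) * (∑ k, A.mulVec x k ^ 2) ^ (p / 2) :=
    fun x i => by
      rw [← Real.mul_rpow (h0 i) (Finset.sum_nonneg fun _ _ => sq_nonneg _), ← habs]
      exact Real.rpow_le_rpow (sq_nonneg _) (hsq x i) (by linarith)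
  have hpad : ∑ i, (τ i + d / n) = ∑ i, τ i + d := by
    rw [Finset.sum_add_distrib]
    simp only [Finset.sum_const, Finset.card_univ, Fintype.card_fin, nsmul_eq_mul]
    rw [mul_div_cancel₀ _ hn0.ne']
  rcases le_total p 2 with hp2 | hp2
  · refine ⟨fun i => (τ i + d / n) * (d / n : ℝ) ^ (p / 2 - 1), fun i => ?_, fun x i => ?_, ?_, ?_⟩
    · have := h0 i
      positivity
    · refine (hbound x i).trans (mul_le_mul ?_ ?_ (by positivity) ?_)
      · have hpos : 0 < τ i + d / n := add_pos_of_nonneg_of_pos (h0 i) (by positivity)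
        calc τ i ^ (p / 2) ≤ (τ i + d / n) ^ (p / 2) :=
              Real.rpow_le_rpow (h0 i) (le_add_of_nonneg_right (by positivity)) (by linarith)
          _ = (τ i + d / n) * (τ i + d / n) ^ (p / 2 - 1) := by
              rw [Real.rpow_sub_one hpos.ne', mul_div_cancel₀ _ hpos.ne']
          _ ≤ _ := mul_le_mul_of_nonneg_left (Real.rpow_le_rpow_of_nonpos (by positivity)
                (le_add_of_nonneg_left (h0 i)) (by linarith)) hpos.le
      · simp only [← habs]
        exact rpow_sum_le_sum_rpow_of_le_one _ (fun _ => sq_nonneg _) (by linarith) (by linarith)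
      · have := h0 i
        positivity
    all_goals
      rw [← Finset.sum_mul, hpad]
      have hval : (d : ℝ) * (d / n : ℝ) ^ (p / 2 - 1) = d ^ (p / 2) * n ^ (1 - p / 2) := by
        rw [Real.div_rpow hd0.le hn0.le, Real.rpow_sub_one hd0.ne', ← neg_sub (p / 2),
          Real.rpow_neg hn0.le]
        field_simp
    · have hnp : 1 ≤ (n : ℝ) ^ (1 - p / 2) := Real.one_le_rpow hn1 (by linarith)
      have hdp : 1 ≤ (d : ℝ) ^ (p / 2) := Real.one_le_rpow hd1 (by linarith)
      calc (1 : ℝ) ≤ d ^ (p / 2) * n ^ (1 - p / 2) := one_le_mul_of_one_le_of_one_le hdp hnp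
        _ = d * (d / n : ℝ) ^ (p / 2 - 1) := hval.symm
        _ ≤ _ := by
            gcongr
            linarith
    · rw [abs_of_nonneg (by linarith)]
      have hdp : (d : ℝ) ^ (p / 2) ≤ d := by
        conv_rhs => rw [← Real.rpow_one (d : ℝ)]
        exact Real.rpow_le_rpow_of_exponent_le hd1 (by linarith)
      calc _ ≤ (d + d) * (d / n : ℝ) ^ (p / 2 - 1) := by gcongr
        _ = 2 * (d ^ (p / 2) * n ^ (1 - p / 2)) := by rw [← hval]; ring
        _ ≤ 2 * (d * n ^ (1 - p / 2)) := by gcongr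
        _ = _ := by ring
  · have hnp : 1 ≤ (n : ℝ) ^ (p / 2 - 1) := Real.one_le_rpow hn1 (by linarith)
    refine ⟨fun i => (τ i + d / n) * (n : ℝ) ^ (p / 2 - 1), fun i => ?_, fun x i => ?_, ?_, ?_⟩
    · have := h0 i
      positivity
    · have hτp : τ i ^ (p / 2) ≤ τ i + d / n := by
        have hle : τ i ^ (p / 2) ≤ τ i ^ (1 : ℝ) := by
          rcases (h0 i).eq_or_lt with h | h
          · rw [← h, Real.zero_rpow (by linarith), Real.zero_rpow one_ne_zero]
          · exact Real.rpow_le_rpow_of_exponent_ge h (h1 i) (by linarith)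
        rw [Real.rpow_one] at hle
        exact hle.trans (le_add_of_nonneg_right (by positivity))
      have hpm : (∑ k, A.mulVec x k ^ 2) ^ (p / 2) ≤
          (n : ℝ) ^ (p / 2 - 1) * ∑ k, |A.mulVec x k| ^ p := by
        have h := Real.rpow_sum_le_const_mul_sum_rpow (Finset.univ : Finset (Fin n))
          (fun k => A.mulVec x k ^ 2) (p := p / 2) (by linarith)
        simpa only [abs_pow, sq_abs, habs, Finset.card_univ, Fintype.card_fin] using h
      have hpad0 : 0 ≤ τ i + d / n := add_nonneg (h0 i) (by positivity)
      calc _ ≤ _ := hbound x i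
        _ ≤ (τ i + d / n) * ((n : ℝ) ^ (p / 2 - 1) * ∑ k, |A.mulVec x k| ^ p) :=
            mul_le_mul hτp hpm (by positivity) hpad0
        _ = _ := by ring
    all_goals rw [← Finset.sum_mul, hpad]
    · exact one_le_mul_of_one_le_of_one_le (by linarith) hnp
    · rw [abs_sub_comm, abs_of_nonneg (by linarith)]
      calc _ ≤ (d + d) * (n : ℝ) ^ (p / 2 - 1) := by gcongr
        _ = _ := by ring

theorem lpNorm_nonneg {n : ℕ} (p : ℝ) (v : Fin n → ℝ) : 0 ≤ lpNorm p v :=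
  Real.rpow_nonneg (Finset.sum_nonneg fun _ _ => Real.rpow_nonneg (abs_nonneg _) _) _

theorem lpNorm_rpow {n : ℕ} {p : ℝ} (hp : p ≠ 0) (v : Fin n → ℝ) :
    lpNorm p v ^ p = ∑ i, |v i| ^ p := by
  rw [lpNorm, ← Real.rpow_mul (Finset.sum_nonneg fun _ _ => Real.rpow_nonneg (abs_nonneg _) _),
    one_div_mul_cancel hp, Real.rpow_one]

theorem approx_of_abs_rpow_sub_le {p ε a b : ℝ} (hp : 1 ≤ p) (hε : 0 ≤ ε) (hε1 : ε ≤ 1)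
    (ha : 0 ≤ a) (hb : 0 ≤ b) (h : |b ^ p - a ^ p| ≤ ε * a ^ p) :
    (1 - ε) * a ≤ b ∧ b ≤ (1 + ε) * a := by
  have hp0 : 0 < p := by linarith
  have hap : 0 ≤ a ^ p := Real.rpow_nonneg ha p
  obtain ⟨h1, h2⟩ := abs_le.1 h
  have hlo : (1 - ε) ^ p ≤ 1 - ε := by
    rcases (sub_nonneg.2 hε1).eq_or_lt with h | h
    · rw [← h, Real.zero_rpow hp0.ne']
    · conv_rhs => rw [← Real.rpow_one (1 - ε)]
      exact Real.rpow_le_rpow_of_exponent_ge h (by linarith) hp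
  have hhi : 1 + ε ≤ (1 + ε) ^ p := by
    conv_lhs => rw [← Real.rpow_one (1 + ε)]
    exact Real.rpow_le_rpow_of_exponent_le (by linarith) hp
  constructor
  · rw [← Real.rpow_le_rpow_iff (mul_nonneg (by linarith) ha) hb hp0,
      Real.mul_rpow (by linarith) ha]
    nlinarith
  · rw [← Real.rpow_le_rpow_iff hb (mul_nonneg (by linarith) ha) hp0,
      Real.mul_rpow (by linarith) ha]
    nlinarith

/-- Row sampling by sensitivities, with `O(p² d S / ε²)` rows for total sensitivity `S`. -/
theorem exists_row_sample {p : ℝ} (hp : 1 ≤ p) {n d : ℕ} (hd : 1 ≤ d)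
    (A : Matrix (Fin n) (Fin d) ℝ) {s : Fin n → ℝ} (hs0 : ∀ i, 0 < s i)
    (hs : ∀ x i, |A.mulVec x i| ^ p ≤ s i * ∑ k, |A.mulVec x k| ^ p) (hS : 1 ≤ ∑ i, s i)
    {ε : ℝ} (hε : 0 < ε) (hε1 : ε ≤ 1) {m : ℕ}
    (hm : 147456 * p ^ 2 * d * (∑ i, s i) / ε ^ 2 ≤ m) :
    ∃ (σ : Fin m → Fin n) (c : Fin m → ℝ), (∀ j, 0 ≤ c j) ∧ ∀ x : Fin d → ℝ,
      |lpNorm p ((Matrix.of fun j k => c j * A (σ j) k).mulVec x) ^ p - lpNorm p (A.mulVec x) ^ p| ≤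
        ε * lpNorm p (A.mulVec x) ^ p := by
  have hp0 : 0 < p := by linarith
  have hS0 : 0 < ∑ i, s i := by linarith
  have : Fact (1 ≤ ENNReal.ofReal p) := ⟨by simpa using hp⟩
  have htoReal : (ENNReal.ofReal p).toReal = p := ENNReal.toReal_ofReal hp0.le
  let f : (Fin d → ℝ) →ₗ[ℝ] PiLp (ENNReal.ofReal p) (fun _ : Fin n => ℝ) :=
    (WithLp.linearEquiv (ENNReal.ofReal p) ℝ (Fin n → ℝ)).symm.toLinearMap ∘ₗ A.mulVecLin
  let l : Fin n → LinearMap.range f →ₗ[ℝ] ℝ := fun i =>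
    (LinearMap.proj i ∘ₗ (WithLp.linearEquiv (ENNReal.ofReal p) ℝ (Fin n → ℝ)).toLinearMap) ∘ₗ
      (LinearMap.range f).subtype
  have hl : ∀ x i, l i (f.rangeRestrict x) = A.mulVec x i := fun x i => rfl
  have hnorm : ∀ y : LinearMap.range f, ‖y‖ ^ p = ∑ i, |l i y| ^ p := fun y => by
    have h1 : ‖y‖ = (∑ i, |l i y| ^ p) ^ (1 / p) := by
      have := PiLp.norm_eq_sum (p := ENNReal.ofReal p) (by rw [htoReal]; exact hp0)
        (y : PiLp (ENNReal.ofReal p) (fun _ : Fin n => ℝ))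
      rw [htoReal] at this
      exact this
    rw [h1, ← Real.rpow_mul (Finset.sum_nonneg fun _ _ => Real.rpow_nonneg (abs_nonneg _) _),
      one_div_mul_cancel hp0.ne', Real.rpow_one]
  have hsl : ∀ i (y : LinearMap.range f), |l i y| ^ p ≤ s i * ‖y‖ ^ p := fun i y => by
    obtain ⟨x, rfl⟩ := f.surjective_rangeRestrict y
    rw [hnorm]
    exact hs x i
  have hrank : Module.finrank ℝ (LinearMap.range f) ≤ d := by
    simpa only [Module.finrank_fin_fun] using LinearMap.finrank_range_le f
  obtain ⟨σ, hσ⟩ := exists_samples_norm_approx hp hnorm hs0 hsl hS hd hrank hε hε1 hm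
  have hd0 : (0 : ℝ) < d := by exact_mod_cast hd
  have hm0 : (0 : ℝ) < m := lt_of_lt_of_le (by positivity) hm
  have hw : ∀ j, 0 ≤ 1 / (m * (s (σ j) / ∑ k, s k)) := fun j => by
    have := hs0 (σ j)
    positivity
  refine ⟨σ, fun j => (1 / (m * (s (σ j) / ∑ k, s k))) ^ (1 / p),
    fun j => Real.rpow_nonneg (hw j) _, fun x => ?_⟩
  have hA : lpNorm p (A.mulVec x) ^ p = ‖f.rangeRestrict x‖ ^ p := by
    rw [lpNorm_rpow hp0.ne', hnorm]
    simp only [hl]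
  have hB : lpNorm p ((Matrix.of fun j k =>
      (1 / (m * (s (σ j) / ∑ k, s k))) ^ (1 / p) * A (σ j) k).mulVec x) ^ p =
      (∑ j, sampleError p l s (σ j) (f.rangeRestrict x)) / m + ‖f.rangeRestrict x‖ ^ p := by
    have hrow : ∀ j, (Matrix.of fun j k =>
        (1 / (m * (s (σ j) / ∑ k, s k))) ^ (1 / p) * A (σ j) k).mulVec x j =
        (1 / (m * (s (σ j) / ∑ k, s k))) ^ (1 / p) * A.mulVec x (σ j) := fun j => by
      simp only [Matrix.mulVec, dotProduct, Matrix.of_apply, Finset.mul_sum, mul_assoc]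
    rw [lpNorm_rpow hp0.ne']
    simp only [hrow, sampleError, hl, Finset.sum_sub_distrib, Finset.sum_const, Finset.card_univ,
      Fintype.card_fin, nsmul_eq_mul]
    rw [sub_div, mul_div_cancel_left₀ _ hm0.ne', sub_add_cancel, Finset.sum_div]
    refine Finset.sum_congr rfl fun j _ => ?_
    rw [abs_mul, abs_of_nonneg (Real.rpow_nonneg (hw j) _),
      Real.mul_rpow (Real.rpow_nonneg (hw j) _) (abs_nonneg _), ← Real.rpow_mul (hw j),
      one_div_mul_cancel hp0.ne', Real.rpow_one]
    have := (hs0 (σ j)).ne'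
    field_simp
  rw [hA, hB, add_sub_cancel_right, abs_div, abs_of_pos hm0, div_le_iff₀ hm0, mul_comm _ (m : ℝ)]
  exact hσ _

/-- Single ℓ_p reduction step (paper's Lemma 5.5): for every `θ > 0` and `p ∈ [1, ∞)`
there is `C > 0` such that every `n × d` matrix `A` and `ε ∈ (0, 1/7]` admit an ℓ_p
`(1 ± ε)`-approximation `B` whose rows are nonnegative multiples of rows of `A`, with
`m ≤ C·n^(1−p/2)·d^(2+θ)·ε⁻²` if `p ≤ 2` and `m ≤ C·n^(p/2−1)·d^((3/2)p−1+θ)·ε⁻²`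
if `p ≥ 2`. -/
theorem lp_reduction_step (θ : ℝ) (hθ : 0 < θ) (p : ℝ) (hp1 : 1 ≤ p) :
    ∃ C : ℝ, 0 < C ∧
      ∀ (n d : ℕ) (A : Matrix (Fin n) (Fin d) ℝ) (ε : ℝ), 0 < ε → ε ≤ 1 / 7 →
        ∃ (m : ℕ) (B : Matrix (Fin m) (Fin d) ℝ) (σ : Fin m → Fin n) (c : Fin m → ℝ),
          ((p ≤ 2 →
            (m : ℝ) ≤ C * (n : ℝ) ^ (1 - p / 2) * (d : ℝ) ^ (2 + θ) / ε ^ 2) ∧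
           (2 ≤ p →
            (m : ℝ) ≤ C * (n : ℝ) ^ (p / 2 - 1) * (d : ℝ) ^ (3 / 2 * p - 1 + θ) / ε ^ 2)) ∧
          (∀ i, 0 ≤ c i) ∧
          (∀ i j, B i j = c i * A (σ i) j) ∧
          (∀ x : Fin d → ℝ,
            (1 - ε) * lpNorm p (A.mulVec x) ≤ lpNorm p (B.mulVec x) ∧
            lpNorm p (B.mulVec x) ≤ (1 + ε) * lpNorm p (A.mulVec x)) := by
  have hp0 : 0 < p := by linarith
  refine ⟨589824 * p ^ 2, by positivity, fun n d A ε hε hε7 => ?_⟩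
  have hε1 : ε ≤ 1 := by linarith
  have hempty : lpNorm p (fun _ : Fin 0 => (0 : ℝ)) = 0 := by
    rw [lpNorm, Finset.univ_eq_empty, Finset.sum_empty, Real.zero_rpow (by positivity)]
  by_cases hnd : n = 0 ∨ d = 0
  · refine ⟨0, Matrix.of Fin.elim0, Fin.elim0, Fin.elim0, ⟨fun _ => ?_, fun _ => ?_⟩,
      fun i => i.elim0, fun i => i.elim0, fun x => ?_⟩
    · rw [Nat.cast_zero]
      positivity
    · rw [Nat.cast_zero]
      positivity
    · have hA : lpNorm p (A.mulVec x) = 0 := by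
        rw [lpNorm]
        have : ∑ i, |A.mulVec x i| ^ p = 0 := by
          refine Finset.sum_eq_zero fun i _ => ?_
          rcases hnd with rfl | rfl
          · exact i.elim0
          · simp [Matrix.mulVec, dotProduct, Real.zero_rpow hp0.ne']
        rw [this, Real.zero_rpow (by positivity)]
      have hB : lpNorm p ((Matrix.of Fin.elim0 : Matrix (Fin 0) (Fin d) ℝ).mulVec x) = 0 := by
        rw [← hempty]
        congr 1
        exact funext fun i => i.elim0
      rw [hA, hB]
      simp
  push Not at hnd
  have hn : 1 ≤ n := Nat.one_le_iff_ne_zero.2 hnd.1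
  have hd : 1 ≤ d := Nat.one_le_iff_ne_zero.2 hnd.2
  have hd1 : (1 : ℝ) ≤ d := by exact_mod_cast hd
  obtain ⟨s, hs0, hs, hS1, hS⟩ := exists_sensitivities hp1 hn hd A
  set M : ℝ := 147456 * p ^ 2 * d * (∑ i, s i) / ε ^ 2 with hM
  obtain ⟨σ, c, hc, hσ⟩ := exists_row_sample hp1 hd A hs0 hs hS1 hε hε1 (Nat.le_ceil M)
  have hM1 : 1 ≤ M := by
    rw [hM, le_div_iff₀ (by positivity), one_mul]
    have h1 : ε ^ 2 ≤ 1 := pow_le_one₀ hε.le hε1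
    have h2 : 1 ≤ p ^ 2 := one_le_pow₀ hp1
    have h3 : 1 ≤ p ^ 2 * d * ∑ i, s i :=
      one_le_mul_of_one_le_of_one_le (one_le_mul_of_one_le_of_one_le h2 hd1) hS1
    nlinarith
  have hcard : (⌈M⌉₊ : ℝ) ≤ 589824 * p ^ 2 * (n : ℝ) ^ |1 - p / 2| * (d : ℝ) ^ (2 : ℝ) / ε ^ 2 := by
    calc (⌈M⌉₊ : ℝ) ≤ 2 * M := by linarith [Nat.ceil_lt_add_one (zero_le_one.trans hM1)]
      _ ≤ 2 * (147456 * p ^ 2 * d * (2 * (n : ℝ) ^ |1 - p / 2| * d) / ε ^ 2) := by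
          rw [hM]
          gcongr
      _ = 589824 * p ^ 2 * (n : ℝ) ^ |1 - p / 2| * (d : ℝ) ^ (2 : ℝ) / ε ^ 2 := by
          rw [Real.rpow_two]
          ring
  refine ⟨⌈M⌉₊, Matrix.of fun j k => c j * A (σ j) k, σ, c, ⟨fun hp2 => ?_, fun hp2 => ?_⟩, hc,
    fun i j => rfl, fun x => approx_of_abs_rpow_sub_le hp1 hε.le hε1 (lpNorm_nonneg _ _)
      (lpNorm_nonneg _ _) (hσ x)⟩
  · rw [abs_of_nonneg (by linarith)] at hcard
    refine hcard.trans ?_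
    gcongr
    linarith
  · rw [abs_sub_comm, abs_of_nonneg (by linarith)] at hcard
    refine hcard.trans ?_
    gcongr
    linarith
end
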